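/- Let 1 < c < 2 and let x be a real number with τ ≤ |x| ≤ K. Then for every fixed η > 0, S(x) ≪ X^{(6+c)/8 + η} + X^{14/15 + η}, where the implied constant depends only on c and η. -/

import Mathlib

open MeasureTheory

noncomputable def e (t : ℝ) : ℂ := Complex.exp (2 * Real.pi * Complex.I * t)

/-- The exponential sum `S(x) = Σ_{X/2 < p ≤ X} (log p) e(p^c x)` over primes. -/
noncomputable def S (X c : ℝ) (x : ℝ) : ℂ :=
  ∑ p ∈ (Finset.range (⌈X⌉₊ + 1)).filter
      (fun p : ℕ => p.Prime ∧ X / 2 < (p : ℝ) ∧ (p : ℝ) ≤ X),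
    (Real.log p : ℂ) * e ((p : ℝ) ^ c * x)

lemma e_norm (t : ℝ) : ‖e t‖ = 1 := by
  unfold e
  rw [show (2 * Real.pi * Complex.I * t : ℂ) = ((2 * Real.pi * t : ℝ) : ℂ) * Complex.I by
    push_cast; ring]
  exact Complex.norm_exp_ofReal_mul_I _

lemma e_add (a b : ℝ) : e (a + b) = e a * e b := by
  unfold e; rw [← Complex.exp_add]; congr 1; push_cast; ring

lemma e_zero : e 0 = 1 := by simp [e]

lemma e_neg_conj (a : ℝ) : (starRingEnd ℂ) (e a) = e (-a) := by
  unfold e; rw [← Complex.exp_conj]; congr 1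
  simp
  left; exact map_ofNat _ 2

lemma e_sub (a b : ℝ) : e (a - b) = e a * (starRingEnd ℂ) (e b) := by
  rw [e_neg_conj, ← e_add, sub_eq_add_neg]

lemma e_int (n : ℤ) : e n = 1 := by
  unfold e
  rw [Complex.exp_eq_one_iff]
  exact ⟨n, by push_cast; ring⟩

lemma e_continuous : Continuous e := by unfold e; fun_prop

lemma e_hasDerivAt (t : ℝ) : HasDerivAt e (2 * Real.pi * Complex.I * e t) t := by
  unfold e
  have h : HasDerivAt (fun t : ℝ => (2 * Real.pi * Complex.I * t : ℂ)) (2 * Real.pi * Complex.I) t := by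
    simpa using (Complex.ofRealCLM.hasDerivAt (x := t)).const_mul (2 * Real.pi * Complex.I : ℂ)
  simpa [mul_comm] using h.cexp

lemma gauss_fourier (T : ℝ) (hT : 0 < T) (D : ℝ) :
    ∫ t : ℝ, (Real.exp (-Real.pi * t ^ 2 / T ^ 2) : ℂ) * e (t * D)
      = ((T * Real.exp (-Real.pi * T ^ 2 * D ^ 2) : ℝ) : ℂ) := by
  have hb : 0 < ((Real.pi / T ^ 2 : ℝ) : ℂ).re := by
    rw [Complex.ofReal_re]; positivity
  have h := fourierIntegral_gaussian hb (2 * Real.pi * D : ℂ)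
  have h1 : ∀ t : ℝ, (Real.exp (-Real.pi * t ^ 2 / T ^ 2) : ℂ) * e (t * D)
     = Complex.exp (Complex.I * (2 * Real.pi * D : ℂ) * t) *
        Complex.exp (-((Real.pi / T ^ 2 : ℝ) : ℂ) * t ^ 2) := by
    intro t
    unfold e
    rw [mul_comm]
    push_cast
    congr 2 <;> ring
  simp_rw [h1]
  rw [h]
  have hT' : (T : ℂ) ≠ 0 := by exact_mod_cast hT.ne'
  have hpi : (Real.pi : ℂ) ≠ 0 := by exact_mod_cast Real.pi_ne_zero
  have h2 : ((Real.pi : ℂ) / ((Real.pi / T ^ 2 : ℝ) : ℂ)) = ((T ^ 2 : ℝ) : ℂ) := by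
    push_cast; field_simp
  rw [h2]
  have h3 : (((T ^ 2 : ℝ) : ℂ) ^ (1 / 2 : ℂ)) = ((T : ℝ) : ℂ) := by
    rw [show (1 / 2 : ℂ) = ((1 / 2 : ℝ) : ℂ) by push_cast; rfl, ← Complex.ofReal_cpow (by positivity)]
    rw [← Real.sqrt_eq_rpow, Real.sqrt_sq hT.le]
  rw [h3]
  push_cast
  congr 2
  field_simp
  ring

lemma gauss_integrable (T : ℝ) (hT : 0 < T) : Integrable (fun t : ℝ => Real.exp (-Real.pi * t ^ 2 / T ^ 2)) := by
  have := integrable_exp_neg_mul_sq (b := Real.pi / T ^ 2) (by positivity)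
  refine this.congr (Filter.Eventually.of_forall fun t => ?_)
  simp only
  congr 1; ring

noncomputable def Q2 {ι : Type*} (I : Finset ι) (ψ : ι → ℝ) (T : ℝ) : ℝ :=
  ∑ i ∈ I, ∑ j ∈ I, Real.exp (-Real.pi * T ^ 2 * (ψ i - ψ j) ^ 2)

lemma L2_eq {ι : Type*} (I : Finset ι) (ψ : ι → ℝ) (b : ι → ℂ) (T : ℝ) (hT : 0 < T) :
    ((∫ t : ℝ, Real.exp (-Real.pi * t ^ 2 / T ^ 2) * ‖∑ i ∈ I, b i * e (t * ψ i)‖ ^ 2 : ℝ) : ℂ)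
      = ∑ i ∈ I, ∑ j ∈ I, b i * (starRingEnd ℂ) (b j) *
          ((T * Real.exp (-Real.pi * T ^ 2 * (ψ i - ψ j) ^ 2) : ℝ) : ℂ) := by
  rw [← integral_complex_ofReal]
  have h1 : ∀ t : ℝ, ((Real.exp (-Real.pi * t ^ 2 / T ^ 2) * ‖∑ i ∈ I, b i * e (t * ψ i)‖ ^ 2 : ℝ) : ℂ)
      = ∑ i ∈ I, ∑ j ∈ I, (b i * (starRingEnd ℂ) (b j)) *
        ((Real.exp (-Real.pi * t ^ 2 / T ^ 2) : ℂ) * e (t * (ψ i - ψ j))) := by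
    intro t
    rw [Complex.ofReal_mul, Complex.ofReal_pow, ← Complex.mul_conj', map_sum, Finset.sum_mul_sum,
      Finset.mul_sum]
    refine Finset.sum_congr rfl fun i _ => ?_
    rw [Finset.mul_sum]
    refine Finset.sum_congr rfl fun j _ => ?_
    rw [mul_sub, e_sub, map_mul]
    ring
  simp_rw [h1]
  have hint : ∀ i j, Integrable (fun t : ℝ => (b i * (starRingEnd ℂ) (b j)) *
        ((Real.exp (-Real.pi * t ^ 2 / T ^ 2) : ℂ) * e (t * (ψ i - ψ j)))) := by
    intro i j
    refine Integrable.const_mul ?_ _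
    refine Integrable.mono' (gauss_integrable T hT) ?_ (Filter.Eventually.of_forall fun t => ?_)
    · apply Continuous.aestronglyMeasurable
      have := e_continuous
      fun_prop
    · rw [norm_mul, e_norm, mul_one, Complex.norm_real, Real.norm_of_nonneg (Real.exp_pos _).le]
  rw [integral_finsetSum _ (fun i _ => integrable_finsetSum _ (fun j _ => hint i j))]
  refine Finset.sum_congr rfl fun i _ => ?_
  rw [integral_finsetSum _ (fun j _ => hint i j)]
  refine Finset.sum_congr rfl fun j _ => ?_
  rw [integral_const_mul, gauss_fourier T hT]

lemma L2_integrable {ι : Type*} (I : Finset ι) (ψ : ι → ℝ) (b : ι → ℂ) (T : ℝ) (hT : 0 < T) :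
    Integrable (fun t : ℝ => Real.exp (-Real.pi * t ^ 2 / T ^ 2) * ‖∑ i ∈ I, b i * e (t * ψ i)‖ ^ 2) := by
  refine Integrable.mono' ((gauss_integrable T hT).mul_const ((∑ i ∈ I, ‖b i‖) ^ 2)) ?_
    (Filter.Eventually.of_forall fun t => ?_)
  · apply Continuous.aestronglyMeasurable
    have := e_continuous
    fun_prop
  · rw [Real.norm_of_nonneg (by positivity)]
    gcongr
    refine (norm_sum_le _ _).trans (Finset.sum_le_sum fun i _ => ?_)
    rw [norm_mul, e_norm, mul_one]

lemma L2_le {ι : Type*} (I : Finset ι) (ψ : ι → ℝ) (b : ι → ℂ) (B : ℝ)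
    (hb : ∀ i ∈ I, ‖b i‖ ≤ B) (T : ℝ) (hT : 0 < T) :
    ∫ t : ℝ, Real.exp (-Real.pi * t ^ 2 / T ^ 2) * ‖∑ i ∈ I, b i * e (t * ψ i)‖ ^ 2 ≤ B ^ 2 * (T * Q2 I ψ T) := by
  have h := L2_eq I ψ b T hT
  have h2 : (∫ t : ℝ, Real.exp (-Real.pi * t ^ 2 / T ^ 2) * ‖∑ i ∈ I, b i * e (t * ψ i)‖ ^ 2) ≤
    ‖∑ i ∈ I, ∑ j ∈ I, b i * (starRingEnd ℂ) (b j) *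
          ((T * Real.exp (-Real.pi * T ^ 2 * (ψ i - ψ j) ^ 2) : ℝ) : ℂ)‖ := by
    rw [← h, Complex.norm_real]; exact le_abs_self _
  refine h2.trans ?_
  unfold Q2
  rw [Finset.mul_sum, Finset.mul_sum]
  refine (norm_sum_le _ _).trans (Finset.sum_le_sum fun i hi => ?_)
  rw [Finset.mul_sum, Finset.mul_sum]
  refine (norm_sum_le _ _).trans (Finset.sum_le_sum fun j hj => ?_)
  rw [norm_mul, norm_mul, RCLike.norm_conj, Complex.norm_real, Real.norm_of_nonneg (by positivity)]
  have := hb i hi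
  have := hb j hj
  have := (norm_nonneg _).trans (hb i hi)
  have hB : ‖b i‖ * ‖b j‖ ≤ B ^ 2 := by rw [sq]; gcongr
  gcongr

lemma L2_ge {ι : Type*} (I I0 : Finset ι) (h0 : I0 ⊆ I) (ψ : ι → ℝ) (w : ι → ℝ)
    (hw : ∀ i ∈ I, 0 ≤ w i) (hw1 : ∀ i ∈ I0, 1 ≤ w i) (T : ℝ) (hT : 0 < T) :
    T * Q2 I0 ψ T ≤ ∫ t : ℝ, Real.exp (-Real.pi * t ^ 2 / T ^ 2) * ‖∑ i ∈ I, (w i : ℂ) * e (t * ψ i)‖ ^ 2 := by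
  have h := L2_eq I ψ (fun i => (w i : ℂ)) T hT
  have h2 : (∫ t : ℝ, Real.exp (-Real.pi * t ^ 2 / T ^ 2) * ‖∑ i ∈ I, (w i : ℂ) * e (t * ψ i)‖ ^ 2) =
    ∑ i ∈ I, ∑ j ∈ I, w i * w j * (T * Real.exp (-Real.pi * T ^ 2 * (ψ i - ψ j) ^ 2)) := by
    have : ((∫ t : ℝ, Real.exp (-Real.pi * t ^ 2 / T ^ 2) * ‖∑ i ∈ I, (w i : ℂ) * e (t * ψ i)‖ ^ 2 : ℝ) : ℂ) =
      ((∑ i ∈ I, ∑ j ∈ I, w i * w j * (T * Real.exp (-Real.pi * T ^ 2 * (ψ i - ψ j) ^ 2)) : ℝ) : ℂ) := by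
      rw [h]; push_cast
      simp
    exact_mod_cast this
  rw [h2]
  unfold Q2
  rw [Finset.mul_sum]
  calc _ ≤ ∑ i ∈ I0, ∑ j ∈ I, w i * w j * (T * Real.exp (-Real.pi * T ^ 2 * (ψ i - ψ j) ^ 2)) := by
        refine Finset.sum_le_sum fun i hi => ?_
        rw [Finset.mul_sum]
        calc _ ≤ ∑ j ∈ I0, w i * w j * (T * Real.exp (-Real.pi * T ^ 2 * (ψ i - ψ j) ^ 2)) := by
              refine Finset.sum_le_sum fun j hj => ?_
              refine le_mul_of_one_le_left (by positivity) ?_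
              exact one_le_mul_of_one_le_of_one_le (hw1 i hi) (hw1 j hj)
          _ ≤ _ := by
              refine Finset.sum_le_sum_of_subset_of_nonneg h0 fun j hj _ => ?_
              have := hw i (h0 hi); have := hw j hj
              positivity
    _ ≤ _ := by
        refine Finset.sum_le_sum_of_subset_of_nonneg h0 fun i hi _ => ?_
        refine Finset.sum_nonneg fun j hj => ?_
        have := hw i hi; have := hw j hj
        positivity

lemma Q2_nonneg {ι : Type*} (I : Finset ι) (ψ : ι → ℝ) (T : ℝ) : 0 ≤ Q2 I ψ T :=
  Finset.sum_nonneg fun _ _ => Finset.sum_nonneg fun _ _ => (Real.exp_pos _).le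

lemma Q2_anti {ι : Type*} (I : Finset ι) (ψ : ι → ℝ) {T T' : ℝ} (h0 : 0 ≤ T) (h : T ≤ T') :
    Q2 I ψ T' ≤ Q2 I ψ T := by
  unfold Q2
  refine Finset.sum_le_sum fun i _ => Finset.sum_le_sum fun j _ => ?_
  rw [Real.exp_le_exp]
  have : T ^ 2 ≤ T' ^ 2 := by gcongr
  have : Real.pi * (ψ i - ψ j) ^ 2 * T ^ 2 ≤ Real.pi * (ψ i - ψ j) ^ 2 * T' ^ 2 := by gcongr
  nlinarith

lemma TQ2_mono {ι : Type*} (I : Finset ι) (ψ : ι → ℝ) {T T' : ℝ} (h0 : 0 < T) (h : T ≤ T') :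
    T * Q2 I ψ T ≤ T' * Q2 I ψ T' := by
  have h1 := L2_ge I I subset_rfl ψ (fun _ => 1) (by simp) (by simp) T h0
  have h2 := L2_le I ψ (fun _ => ((1 : ℝ) : ℂ)) 1 (by simp) T' (h0.trans_le h)
  refine h1.trans (le_trans ?_ (h2.trans (by rw [one_pow, one_mul])))
  refine integral_mono (L2_integrable I ψ _ T h0) (L2_integrable I ψ _ T' (h0.trans_le h)) fun t => ?_
  simp only
  gcongr ?_ * _
  rw [Real.exp_le_exp, neg_mul, neg_div, neg_div, neg_le_neg_iff]
  gcongr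

/-- four-fold version -/
noncomputable def Q4 (s : Finset ℕ) (φ : ℕ → ℝ) (T : ℝ) : ℝ :=
  Q2 (s ×ˢ s) (fun p => φ p.1 + φ p.2) T

lemma sq_sum (s : Finset ℕ) (φ : ℕ → ℝ) (a : ℕ → ℂ) (t : ℝ) :
    ‖∑ m ∈ s, a m * e (t * φ m)‖ ^ 4 =
    ‖∑ p ∈ s ×ˢ s, (a p.1 * a p.2) * e (t * (φ p.1 + φ p.2))‖ ^ 2 := by
  have : ∑ p ∈ s ×ˢ s, (a p.1 * a p.2) * e (t * (φ p.1 + φ p.2)) = (∑ m ∈ s, a m * e (t * φ m)) ^ 2 := by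
    rw [sq, Finset.sum_mul_sum, Finset.sum_product]
    refine Finset.sum_congr rfl fun i _ => Finset.sum_congr rfl fun j _ => ?_
    rw [mul_add, e_add]; ring
  rw [this, norm_pow]; ring

lemma L4_le (s : Finset ℕ) (φ : ℕ → ℝ) (a : ℕ → ℂ) (ha : ∀ m ∈ s, ‖a m‖ ≤ 1) (T : ℝ) (hT : 0 < T) :
    ∫ t : ℝ, Real.exp (-Real.pi * t ^ 2 / T ^ 2) * ‖∑ m ∈ s, a m * e (t * φ m)‖ ^ 4 ≤ T * Q4 s φ T := by
  simp_rw [sq_sum]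
  refine (L2_le _ _ _ 1 ?_ T hT).trans (by rw [one_pow, one_mul]; rfl)
  rintro ⟨i, j⟩ hij
  rw [Finset.mem_product] at hij
  rw [norm_mul]
  exact mul_le_one₀ (ha _ hij.1) (norm_nonneg _) (ha _ hij.2)

lemma L4_integrable (s : Finset ℕ) (φ : ℕ → ℝ) (a : ℕ → ℂ) (T : ℝ) (hT : 0 < T) :
    Integrable (fun t : ℝ => Real.exp (-Real.pi * t ^ 2 / T ^ 2) * ‖∑ m ∈ s, a m * e (t * φ m)‖ ^ 4) := by
  simp_rw [sq_sum]
  exact L2_integrable _ _ _ T hT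

lemma L4_ge (s s0 : Finset ℕ) (h0 : s0 ⊆ s) (φ : ℕ → ℝ) (w : ℕ → ℝ) (hw : ∀ m ∈ s, 0 ≤ w m)
    (hw1 : ∀ m ∈ s0, 1 ≤ w m) (T : ℝ) (hT : 0 < T) :
    T * Q4 s0 φ T ≤ ∫ t : ℝ, Real.exp (-Real.pi * t ^ 2 / T ^ 2) * ‖∑ m ∈ s, (w m : ℂ) * e (t * φ m)‖ ^ 4 := by
  simp_rw [sq_sum]
  have := L2_ge (s ×ˢ s) (s0 ×ˢ s0) (Finset.product_subset_product h0 h0) (fun p => φ p.1 + φ p.2)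
    (fun p => w p.1 * w p.2) (fun p hp => by
      rw [Finset.mem_product] at hp; exact mul_nonneg (hw _ hp.1) (hw _ hp.2))
    (fun p hp => by
      rw [Finset.mem_product] at hp; exact one_le_mul_of_one_le_of_one_le (hw1 _ hp.1) (hw1 _ hp.2)) T hT
  push_cast at this
  exact this

lemma ibp {A B t : ℝ} (hAB : A ≤ B) (ψ ψ' G G' : ℝ → ℝ)
    (hψ : ∀ v ∈ Set.Icc A B, HasDerivAt ψ (ψ' v) v) (hψc : ContinuousOn ψ' (Set.Icc A B))
    (hG : ∀ v ∈ Set.Icc A B, HasDerivAt G (G' v) v) (hGc : ContinuousOn G' (Set.Icc A B))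
    (hA : G A = 0) (hB : G B = 0) :
    (2 * Real.pi * Complex.I * t) * ∫ v in A..B, ((ψ' v * G v : ℝ) : ℂ) * e (t * ψ v)
      = - ∫ v in A..B, (G' v : ℂ) * e (t * ψ v) := by
  have hE : ∀ v ∈ Set.uIcc A B, HasDerivAt (fun v => e (t * ψ v))
      (2 * Real.pi * Complex.I * e (t * ψ v) * (t * ψ' v : ℝ)) v := by
    intro v hv
    rw [Set.uIcc_of_le hAB] at hv
    have h1 := ((hψ v hv).const_mul t)
    have h2 := HasDerivAt.scomp v (e_hasDerivAt (t * ψ v)) h1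
    refine HasDerivAt.congr_deriv h2 ?_
    rw [Complex.real_smul, mul_comm]
  have hGd : ∀ v ∈ Set.uIcc A B, HasDerivAt (fun v => (G v : ℂ)) (G' v : ℂ) v := by
    intro v hv
    rw [Set.uIcc_of_le hAB] at hv
    exact (hG v hv).ofReal_comp
  have hψcont : ContinuousOn ψ (Set.Icc A B) := fun v hv => (hψ v hv).continuousAt.continuousWithinAt
  have hEc : ContinuousOn (fun v => e (t * ψ v)) (Set.Icc A B) :=
    e_continuous.comp_continuousOn (by fun_prop)
  have h := intervalIntegral.integral_mul_deriv_eq_deriv_mul hGd hE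
    (by apply ContinuousOn.intervalIntegrable; rw [Set.uIcc_of_le hAB]
        exact Complex.continuous_ofReal.comp_continuousOn hGc)
    (by apply ContinuousOn.intervalIntegrable; rw [Set.uIcc_of_le hAB]
        have : ContinuousOn (fun v => ((t * ψ' v : ℝ) : ℂ)) (Set.Icc A B) :=
          Complex.continuous_ofReal.comp_continuousOn (by fun_prop)
        fun_prop)
  simp only [hA, hB] at h
  rw [← intervalIntegral.integral_const_mul]
  simp only [Complex.ofReal_zero, zero_mul, sub_zero, zero_sub] at h
  rw [← h]
  refine intervalIntegral.integral_congr fun v _ => ?_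
  push_cast; ring

lemma int_cauchy_le (A B v0 t : ℝ) (ht : 0 < t) :
    ∫ v in A..B, (1 + t * (v - v0) ^ 2)⁻¹ ≤ Real.pi * t ^ (-(1 / 2) : ℝ) := by
  have hs : 0 < Real.sqrt t := Real.sqrt_pos.2 ht
  have h1 : ∀ v : ℝ, (1 + t * (v - v0) ^ 2)⁻¹ = (1 + (Real.sqrt t * v + -(Real.sqrt t * v0)) ^ 2)⁻¹ := by
    intro v
    congr 2
    nlinarith [Real.sq_sqrt ht.le]
  simp_rw [h1]
  rw [intervalIntegral.integral_comp_mul_add (fun x => (1 + x ^ 2)⁻¹) hs.ne',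
    integral_inv_one_add_sq, smul_eq_mul, Real.rpow_neg ht.le, ← Real.sqrt_eq_rpow, mul_comm]
  gcongr
  have := Real.arctan_lt_pi_div_two (Real.sqrt t * B + -(Real.sqrt t * v0))
  have := Real.neg_pi_div_two_lt_arctan (Real.sqrt t * A + -(Real.sqrt t * v0))
  linarith

lemma sqrt_aux {t s : ℝ} (ht : 0 < t) : |t * s / (1 + t * s ^ 2)| ≤ t ^ (1 / 2 : ℝ) := by
  rw [← Real.sqrt_eq_rpow, abs_div, abs_of_pos (a := 1 + t * s ^ 2) (by positivity), div_le_iff₀ (by positivity)]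
  have h := Real.sq_sqrt ht.le
  have hs := Real.sqrt_nonneg t
  set r := Real.sqrt t
  rw [← h, abs_mul, abs_of_nonneg (sq_nonneg r), ← sq_abs s]
  have := abs_nonneg s
  nlinarith [mul_nonneg hs (sq_nonneg (r * |s| - 1)), mul_nonneg hs this, mul_nonneg hs (sq_nonneg (r * |s|))]

/-- basic second-derivative test -/
lemma osc1 {A B t v0 D : ℝ} (hAB : A ≤ B) (ht : 1 ≤ t) (ψ ψ' u g g' : ℝ → ℝ)
    (hψ : ∀ v ∈ Set.Icc A B, HasDerivAt ψ (ψ' v) v) (hψc : ContinuousOn ψ' (Set.Icc A B))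
    (hg : ∀ v ∈ Set.Icc A B, HasDerivAt g (g' v) v) (hgc : ContinuousOn g' (Set.Icc A B))
    (hA : g A = 0) (hB : g B = 0) (huc : ContinuousOn u (Set.Icc A B))
    (hug : ∀ v ∈ Set.Icc A B, u v * (v - v0) = ψ' v * g v)
    (hu : ∀ v ∈ Set.Icc A B, |u v| ≤ D) (hgD : ∀ v ∈ Set.Icc A B, |g v| ≤ D)
    (hgD' : ∀ v ∈ Set.Icc A B, |g' v| ≤ D) :
    ‖∫ v in A..B, (u v : ℂ) * e (t * ψ v)‖ ≤ D * (8 + (B - A)) * t ^ (-(1 / 2) : ℝ) := by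
  have ht0 : 0 < t := by linarith
  have hD : 0 ≤ D := (abs_nonneg _).trans (hu A (Set.left_mem_Icc.2 hAB))
  set G : ℝ → ℝ := fun v => g v * (t * (v - v0) / (1 + t * (v - v0) ^ 2)) with hGdef
  set G' : ℝ → ℝ := fun v => g' v * (t * (v - v0) / (1 + t * (v - v0) ^ 2)) +
    g v * (t * (1 - t * (v - v0) ^ 2) / (1 + t * (v - v0) ^ 2) ^ 2) with hG'def
  have hpos : ∀ v : ℝ, 1 + t * (v - v0) ^ 2 ≠ 0 := fun v => by positivity
  have hgcont : ContinuousOn g (Set.Icc A B) := fun v hv => (hg v hv).continuousAt.continuousWithinAt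
  have hψcont : ContinuousOn ψ (Set.Icc A B) := fun v hv => (hψ v hv).continuousAt.continuousWithinAt
  have hEc : ContinuousOn (fun v => e (t * ψ v)) (Set.Icc A B) :=
    e_continuous.comp_continuousOn (by fun_prop)
  have hG'c : ContinuousOn G' (Set.Icc A B) := by
    simp only [hG'def]
    refine ContinuousOn.add (hgc.mul ?_) (hgcont.mul ?_)
    · exact ContinuousOn.div (by fun_prop) (by fun_prop) (fun v _ => hpos v)
    · exact ContinuousOn.div (by fun_prop) (by fun_prop) (fun v _ => pow_ne_zero 2 (hpos v))
  have hI := ibp (t := t) hAB ψ ψ' G G' hψ hψc (fun v hv => by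
      have h1 : HasDerivAt (fun v : ℝ => t * (v - v0)) t v := by
        simpa using ((hasDerivAt_id v).sub_const v0).const_mul t
      have h2 : HasDerivAt (fun v : ℝ => 1 + t * (v - v0) ^ 2) (t * (2 * (v - v0))) v := by
        simpa using ((((hasDerivAt_id v).sub_const v0).pow 2).const_mul t).const_add 1
      refine HasDerivAt.congr_deriv ((hg v hv).mul (h1.div h2 (hpos v))) ?_
      simp only [hG'def, Pi.div_apply]
      congr 2
      congr 1
      ring) hG'c (by simp [hGdef, hA]) (by simp [hGdef, hB])
  have hsplit : ∫ v in A..B, (u v : ℂ) * e (t * ψ v) =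
      (∫ v in A..B, ((ψ' v * G v : ℝ) : ℂ) * e (t * ψ v)) +
      ∫ v in A..B, ((u v * (1 + t * (v - v0) ^ 2)⁻¹ : ℝ) : ℂ) * e (t * ψ v) := by
    rw [← intervalIntegral.integral_add]
    · refine intervalIntegral.integral_congr fun v hv => ?_
      rw [Set.uIcc_of_le hAB] at hv
      rw [← add_mul, ← Complex.ofReal_add]
      congr 2
      simp only [hGdef]
      rw [← mul_assoc, ← hug v hv]
      have := hpos v
      field_simp
      ring
    · apply ContinuousOn.intervalIntegrable; rw [Set.uIcc_of_le hAB]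
      refine ContinuousOn.mul (Complex.continuous_ofReal.comp_continuousOn (hψc.mul (hgcont.mul ?_))) hEc
      exact ContinuousOn.div (by fun_prop) (by fun_prop) (fun v _ => hpos v)
    · apply ContinuousOn.intervalIntegrable; rw [Set.uIcc_of_le hAB]
      refine ContinuousOn.mul (Complex.continuous_ofReal.comp_continuousOn (huc.mul ?_)) hEc
      exact ContinuousOn.inv₀ (by fun_prop) (fun v _ => hpos v)
  have hci : IntervalIntegrable (fun v => (1 + t * (v - v0) ^ 2)⁻¹) volume A B :=
    ContinuousOn.intervalIntegrable (ContinuousOn.inv₀ (by fun_prop) (fun v _ => hpos v))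
  have b2 : ‖∫ v in A..B, ((u v * (1 + t * (v - v0) ^ 2)⁻¹ : ℝ) : ℂ) * e (t * ψ v)‖ ≤
      D * (Real.pi * t ^ (-(1 / 2) : ℝ)) := by
    refine (intervalIntegral.norm_integral_le_of_norm_le hAB (g := fun v => D * (1 + t * (v - v0) ^ 2)⁻¹)
      (ae_of_all _ fun v hv => ?_) (hci.const_mul D)).trans ?_
    · rw [norm_mul, e_norm, mul_one, Complex.norm_real, Real.norm_eq_abs, abs_mul, abs_of_pos (a := (_)⁻¹) (by positivity)]
      gcongr
      exact hu v (Set.Ioc_subset_Icc_self hv)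
    · rw [intervalIntegral.integral_const_mul]
      gcongr
      exact int_cauchy_le A B v0 t ht0
  have b1 : ‖∫ v in A..B, (G' v : ℂ) * e (t * ψ v)‖ ≤
      D * t ^ (1 / 2 : ℝ) * (B - A) + D * t * (Real.pi * t ^ (-(1 / 2) : ℝ)) := by
    refine (intervalIntegral.norm_integral_le_of_norm_le hAB
      (g := fun v => D * t ^ (1 / 2 : ℝ) + D * t * (1 + t * (v - v0) ^ 2)⁻¹)
      (ae_of_all _ fun v hv => ?_) ((intervalIntegrable_const).add (hci.const_mul (D * t)))).trans ?_
    · have hv' := Set.Ioc_subset_Icc_self hv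
      rw [norm_mul, e_norm, mul_one, Complex.norm_real, Real.norm_eq_abs]
      refine (abs_add_le _ _).trans (add_le_add ?_ ?_)
      · rw [abs_mul]
        exact mul_le_mul (hgD' v hv') (sqrt_aux ht0) (abs_nonneg _) hD
      · rw [abs_mul, mul_assoc]
        refine mul_le_mul (hgD v hv') ?_ (abs_nonneg _) hD
        have h1 : 0 ≤ t * (v - v0) ^ 2 := by positivity
        set y := t * (v - v0) ^ 2
        rw [abs_div, abs_mul, abs_of_pos ht0, abs_of_pos (a := (1 + y) ^ 2) (by positivity), mul_div_assoc]
        gcongr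
        rw [div_le_iff₀ (by positivity), sq, ← mul_assoc, inv_mul_cancel₀ (by positivity), one_mul, abs_le]
        constructor <;> linarith
    · rw [intervalIntegral.integral_add intervalIntegrable_const (hci.const_mul (D * t)),
        intervalIntegral.integral_const, intervalIntegral.integral_const_mul, smul_eq_mul, mul_comm (B - A)]
      gcongr
      exact int_cauchy_le A B v0 t ht0
  have hn : ‖∫ v in A..B, ((ψ' v * G v : ℝ) : ℂ) * e (t * ψ v)‖ * (2 * Real.pi * t) =
      ‖∫ v in A..B, (G' v : ℂ) * e (t * ψ v)‖ := by
    rw [← norm_neg (∫ v in A..B, (G' v : ℂ) * e (t * ψ v)), ← hI, norm_mul, mul_comm]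
    congr 1
    simp [abs_of_pos ht0, abs_of_pos Real.pi_pos]
  rw [hsplit]
  refine (norm_add_le _ _).trans ?_
  set y := ‖∫ v in A..B, ((ψ' v * G v : ℝ) : ℂ) * e (t * ψ v)‖
  have hth : t ^ (1 / 2 : ℝ) = t * t ^ (-(1 / 2) : ℝ) := by
    rw [← Real.rpow_one_add' ht0.le (by norm_num)]; norm_num
  set r := t ^ (-(1 / 2) : ℝ)
  have hr : 0 < r := Real.rpow_pos_of_pos ht0 _
  rw [hth] at b1
  rw [← hn] at b1
  have hy : y * (2 * Real.pi) ≤ D * r * (B - A) + D * Real.pi * r := by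
    refine le_of_mul_le_mul_right ?_ ht0
    nlinarith
  have hpi := Real.pi_gt_three
  have hpi4 := Real.pi_le_four
  have hy0 : 0 ≤ y := norm_nonneg _
  have hDr : 0 ≤ D * r := by positivity
  have hba : 0 ≤ D * r * (B - A) := mul_nonneg hDr (by linarith)
  nlinarith [mul_nonneg hDr (sub_nonneg.2 hpi4), mul_nonneg hy0 (sub_nonneg.2 hpi.le)]

lemma analyticAt_rpow' (γ r : ℝ) (hr : 0 < r) : AnalyticAt ℝ (fun x : ℝ => x ^ γ) r := by
  have : AnalyticAt ℝ (fun x : ℝ => Real.exp (Real.log x * γ)) r :=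
    AnalyticAt.rexp ((AnalyticAt.log analyticAt_id hr).mul analyticAt_const)
  refine this.congr ?_
  filter_upwards [lt_mem_nhds hr] with x hx
  rw [Real.rpow_def_of_pos hx]

lemma kappa_exists (γ : ℝ) (hγ : 0 < γ) : ∃ k k1 k2 : ℝ → ℝ,
    (∀ r > 0, HasDerivAt k (k1 r) r) ∧ (∀ r > 0, HasDerivAt k1 (k2 r) r) ∧
    ContinuousOn k2 (Set.Ioi 0) ∧ ∀ r > 0, k r * (r ^ γ - 1) = r - 1 := by
  set f : ℝ → ℝ := fun r => r ^ γ with hf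
  set d : ℝ → ℝ := dslope f 1 with hd
  have hana : ∀ r > 0, AnalyticAt ℝ d r := by
    intro r hr
    by_cases h1 : r = 1
    · subst h1
      have : AnalyticAt ℝ f 1 := analyticAt_rpow' γ 1 one_pos
      obtain ⟨p, hp⟩ := this
      exact ⟨_, hp.has_fpower_series_dslope_fslope⟩
    · have h2 : AnalyticAt ℝ (fun x => (f x - f 1) / (x - 1)) r := by
        refine AnalyticAt.div (AnalyticAt.sub ?_ analyticAt_const) (analyticAt_id.sub analyticAt_const) (sub_ne_zero.2 h1)
        exact analyticAt_rpow' γ r hr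
      refine h2.congr ?_
      filter_upwards [isOpen_ne.mem_nhds h1] with x hx
      rw [hd, dslope_of_ne _ hx, slope_def_field]
  have hpos : ∀ r > 0, 0 < d r := by
    intro r hr
    by_cases h1 : r = 1
    · subst h1
      rw [hd, dslope_same]
      have : HasDerivAt f (γ * 1 ^ (γ - 1)) 1 := Real.hasDerivAt_rpow_const (Or.inl one_ne_zero)
      rw [this.deriv]; simpa using hγ
    · rw [hd, dslope_of_ne _ h1, slope_def_field]
      simp only [hf, Real.one_rpow]
      rcases lt_or_gt_of_ne h1 with h | h
      · exact div_pos_of_neg_of_neg (by linarith [Real.rpow_lt_one hr.le h hγ]) (by linarith)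
      · exact div_pos (by linarith [Real.one_lt_rpow h hγ]) (by linarith)
  set k : ℝ → ℝ := fun r => (d r)⁻¹
  have hk : ∀ r > 0, AnalyticAt ℝ k r := fun r hr => (hana r hr).inv (hpos r hr).ne'
  refine ⟨k, deriv k, deriv (deriv k), fun r hr => (hk r hr).differentiableAt.hasDerivAt,
    fun r hr => (hk r hr).deriv.differentiableAt.hasDerivAt,
    fun r hr => (hk r hr).deriv.deriv.continuousAt.continuousWithinAt, fun r hr => ?_⟩
  by_cases h1 : r = 1
  · subst h1; simp
  · have h := hpos r hr
    simp only [k]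
    have h2 : d r = (r ^ γ - 1) / (r - 1) := by
      rw [hd, dslope_of_ne _ h1, slope_def_field]; simp [hf]
    have h3 : r - 1 ≠ 0 := sub_ne_zero.2 h1
    have h4 : r ^ γ - 1 ≠ 0 := by
      intro h0; rw [h2, h0] at h; simp at h
    rw [h2]; field_simp

/-- version with two variables: `kap v v0` with `v - v0 = α (v^(α-1) - v0^(α-1)) kap v v0` -/
lemma kappa2 (α : ℝ) (hα : 1 < α) : ∃ k k1 k2 : ℝ → ℝ → ℝ,
    (∀ v0 > 0, ∀ v > 0, HasDerivAt (k v0) (k1 v0 v) v) ∧ (∀ v0 > 0, ∀ v > 0, HasDerivAt (k1 v0) (k2 v0 v) v) ∧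
    (ContinuousOn (fun p : ℝ × ℝ => k p.1 p.2) (Set.Ioi 0 ×ˢ Set.Ioi 0)) ∧
    (ContinuousOn (fun p : ℝ × ℝ => k1 p.1 p.2) (Set.Ioi 0 ×ˢ Set.Ioi 0)) ∧
    (ContinuousOn (fun p : ℝ × ℝ => k2 p.1 p.2) (Set.Ioi 0 ×ˢ Set.Ioi 0)) ∧
    ∀ v0 > 0, ∀ v > 0, α * (v ^ (α - 1) - v0 ^ (α - 1)) * k v0 v = v - v0 := by
  obtain ⟨k, k1, k2, h1, h2, h3, h4⟩ := kappa_exists (α - 1) (by linarith)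
  have key : ∀ f : ℝ → ℝ, ContinuousOn f (Set.Ioi 0) → ∀ b : ℝ,
      ContinuousOn (fun p : ℝ × ℝ => f (p.2 / p.1) * (p.1 ^ b / α)) (Set.Ioi 0 ×ˢ Set.Ioi 0) := by
    intro f hf b
    refine ContinuousOn.mul (hf.comp ?_ ?_) ?_
    · exact ContinuousOn.div (by fun_prop) (by fun_prop) fun p hp => (ne_of_gt hp.1)
    · intro p hp; exact div_pos (Set.mem_Ioi.1 hp.2) (Set.mem_Ioi.1 hp.1)
    · refine ContinuousOn.div_const (ContinuousOn.rpow_const (by fun_prop) fun p hp => Or.inl (ne_of_gt hp.1)) _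
  have hdiv : ∀ v0 v : ℝ, HasDerivAt (fun v : ℝ => v / v0) (1 / v0) v := fun v0 v => (hasDerivAt_id v).div_const v0
  refine ⟨fun v0 v => k (v / v0) * (v0 ^ (2 - α) / α), fun v0 v => k1 (v / v0) * (v0 ^ (1 - α) / α),
    fun v0 v => k2 (v / v0) * (v0 ^ (-α) / α), ?_, ?_, key k ?_ _, key k1 ?_ _, key k2 h3 _, ?_⟩
  · intro v0 hv0 v hv
    refine HasDerivAt.congr_deriv ((HasDerivAt.comp v (h1 (v / v0) (div_pos hv hv0)) (hdiv v0 v)).mul_const _) ?_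
    rw [show 2 - α = (1 - α) + 1 by ring, Real.rpow_add_one hv0.ne']; field_simp
  · intro v0 hv0 v hv
    refine HasDerivAt.congr_deriv ((HasDerivAt.comp v (h2 (v / v0) (div_pos hv hv0)) (hdiv v0 v)).mul_const _) ?_
    rw [show 1 - α = -α + 1 by ring, Real.rpow_add_one hv0.ne']; field_simp
  · exact fun r hr => (h1 r hr).continuousAt.continuousWithinAt
  · exact fun r hr => (h2 r hr).continuousAt.continuousWithinAt
  · intro v0 hv0 v hv
    have h := h4 _ (div_pos hv hv0)
    rw [Real.div_rpow hv.le hv0.le] at h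
    have hp : (0:ℝ) < v0 ^ (α - 1) := Real.rpow_pos_of_pos hv0 _
    have he : v0 ^ (2 - α) * v0 ^ (α - 1) = v0 := by
      rw [← Real.rpow_add hv0]; convert Real.rpow_one v0 using 2; ring
    have h5 : k (v / v0) * (v ^ (α - 1) - v0 ^ (α - 1)) = (v / v0 - 1) * v0 ^ (α - 1) := by
      rw [← h]; field_simp
    have : α ≠ 0 := by linarith
    calc α * (v ^ (α - 1) - v0 ^ (α - 1)) * (k (v / v0) * (v0 ^ (2 - α) / α)) =
        k (v / v0) * (v ^ (α - 1) - v0 ^ (α - 1)) * v0 ^ (2 - α) := by field_simp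
      _ = (v / v0 - 1) * (v0 ^ (2 - α) * v0 ^ (α - 1)) := by rw [h5]; ring
      _ = v - v0 := by rw [he]; field_simp

/-- normalized phase -/
noncomputable def psi (α v0 v : ℝ) : ℝ := v ^ α - v0 ^ α - α * v0 ^ (α - 1) * (v - v0)

lemma psi_deriv {α v0 v : ℝ} (hv : 0 < v) :
    HasDerivAt (psi α v0) (α * (v ^ (α - 1) - v0 ^ (α - 1))) v := by
  unfold psi
  have h1 : HasDerivAt (fun v : ℝ => v ^ α) (α * v ^ (α - 1)) v := Real.hasDerivAt_rpow_const (Or.inl hv.ne')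
  refine ((h1.sub_const _).sub (((hasDerivAt_id v).sub_const v0).const_mul (α * v0 ^ (α - 1)))).congr_deriv ?_
  ring

lemma psi_deriv0 {α v0 v : ℝ} (hv : 0 < v0) :
    HasDerivAt (fun v0 => psi α v0 v) (-(α * (α - 1) * v0 ^ (α - 2) * (v - v0))) v0 := by
  unfold psi
  have h1 : HasDerivAt (fun v : ℝ => v ^ α) (α * v0 ^ (α - 1)) v0 := Real.hasDerivAt_rpow_const (Or.inl hv.ne')
  have h2 : HasDerivAt (fun v : ℝ => v ^ (α - 1)) ((α - 1) * v0 ^ (α - 1 - 1)) v0 :=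
    Real.hasDerivAt_rpow_const (Or.inl hv.ne')
  have h3 : HasDerivAt (fun x : ℝ => v - x) (-1) v0 := by simpa using (hasDerivAt_id v0).const_sub v
  refine ((h1.const_sub _).sub ((h2.const_mul α).mul h3)).congr_deriv ?_
  rw [show α - 1 - 1 = α - 2 by ring]; ring

noncomputable def ampl (α a0 b0 : ℝ) (w : ℝ → ℝ) (t v0 : ℝ) : ℂ :=
  ∫ v in a0..b0, (w v : ℂ) * e (t * psi α v0 v)

lemma psi_cont {α v0 a0 b0 : ℝ} (ha0 : 0 < a0) : ContinuousOn (psi α v0) (Set.Icc a0 b0) := fun _ hv =>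
  (psi_deriv (lt_of_lt_of_le ha0 hv.1)).continuousAt.continuousWithinAt

lemma ampl_deriv {α a0 b0 : ℝ} {w : ℝ → ℝ} (hw : Continuous w) (ha0 : 0 < a0) (hab : a0 ≤ b0) (t v0 : ℝ) (hv0 : 0 < v0) :
    HasDerivAt (ampl α a0 b0 w t) (∫ v in a0..b0, (w v : ℂ) * (((t * -(α * (α - 1) * v0 ^ (α - 2) * (v - v0)) : ℝ) : ℂ) *
      (2 * Real.pi * Complex.I * e (t * psi α v0 v)))) v0 := by
  set F' : ℝ → ℝ → ℂ := fun v0 v => (w v : ℂ) * (((t * -(α * (α - 1) * v0 ^ (α - 2) * (v - v0)) : ℝ) : ℂ) *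
      (2 * Real.pi * Complex.I * e (t * psi α v0 v))) with hF'
  have hEc : ∀ x : ℝ, ContinuousOn (fun v => e (t * psi α x v)) (Set.uIcc a0 b0) := fun x =>
    e_continuous.comp_continuousOn (by rw [Set.uIcc_of_le hab]; exact continuousOn_const.mul (psi_cont ha0))
  have hwc : Continuous (fun v => (w v : ℂ)) := Complex.continuous_ofReal.comp hw
  have hcomp : IsCompact (Set.Icc (v0 / 2) (2 * v0) ×ˢ Set.Icc a0 b0) := isCompact_Icc.prod isCompact_Icc
  obtain ⟨C, hC⟩ := hcomp.exists_bound_of_continuousOn (f := fun p : ℝ × ℝ =>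
      w p.2 * ((t * -(α * (α - 1) * p.1 ^ (α - 2) * (p.2 - p.1)) : ℝ) * (2 * Real.pi))) (by
    have : ContinuousOn (fun p : ℝ × ℝ => p.1 ^ (α - 2)) (Set.Icc (v0 / 2) (2 * v0) ×ˢ Set.Icc a0 b0) :=
      ContinuousOn.rpow_const (by fun_prop) fun p hp => Or.inl (by have := hp.1.1; intro h; linarith)
    fun_prop)
  refine (intervalIntegral.hasDerivAt_integral_of_dominated_loc_of_deriv_le (F' := F')
    (s := Set.Ioo (v0 / 2) (2 * v0)) (bound := fun _ => C) (Ioo_mem_nhds (by linarith) (by linarith))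
    (Filter.Eventually.of_forall fun x => ?_) ?_ ?_ (ae_of_all _ ?_) intervalIntegrable_const (ae_of_all _ ?_)).2
  · exact ((hwc.continuousOn.mul (hEc x)).mono Set.uIoc_subset_uIcc).aestronglyMeasurable measurableSet_uIoc
  · exact (hwc.continuousOn.mul (hEc v0)).intervalIntegrable
  · refine ContinuousOn.aestronglyMeasurable ?_ measurableSet_uIoc
    refine ContinuousOn.mono ?_ Set.uIoc_subset_uIcc
    have := hEc v0
    simp only [hF']
    fun_prop
  · intro v hv x hx
    rw [Set.uIoc_of_le hab] at hv
    have := hC (x, v) ⟨⟨hx.1.le, hx.2.le⟩, ⟨hv.1.le, hv.2⟩⟩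
    refine le_trans (le_of_eq ?_) this
    simp only [hF', norm_mul, e_norm, Complex.norm_real, Complex.norm_I, RCLike.norm_ofNat, mul_one]
  · intro v _ x hx
    have h1 := (psi_deriv0 (α := α) (v := v) (by linarith [hx.1] : 0 < x)).const_mul t
    have h2 := (HasDerivAt.scomp x (e_hasDerivAt (t * psi α x v)) h1).const_mul (w v : ℂ)
    exact h2.congr_deriv (by rw [Complex.real_smul])

lemma amp_bounds (α : ℝ) (hα : 1 < α) (w : ℝ → ℝ) (hw : ContDiff ℝ 2 w) (a0 b0 A0 B0 : ℝ) (ha0 : 0 < a0)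
    (hab : a0 ≤ b0) (hs : tsupport w ⊆ Set.Ioo a0 b0) (hA0 : 0 < A0) : ∃ C > 0,
    (∀ t ≥ 1, ∀ v0 ∈ Set.Icc A0 B0, ‖ampl α a0 b0 w t v0‖ ≤ C * t ^ (-(1 / 2) : ℝ)) ∧
    (∀ t ≥ 1, ∀ v0 ∈ Set.Icc A0 B0, ∀ v1 ∈ Set.Icc A0 B0,
      ‖ampl α a0 b0 w t v0 - ampl α a0 b0 w t v1‖ ≤ C * t ^ (-(1 / 2) : ℝ) * |v0 - v1|) := by
  obtain ⟨k, k1, k2, hk, hk1, kc, k1c, k2c, hkey⟩ := kappa2 α hα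
  have hwc : Continuous w := hw.continuous
  have hwd : ∀ v, HasDerivAt w (deriv w v) v := fun v => (hw.differentiable (by norm_num)).differentiableAt.hasDerivAt
  have hw1 : ContDiff ℝ 1 (deriv w) := ContDiff.deriv' (n := 1) (by rw [one_add_one_eq_two]; exact hw)
  have hw1c : Continuous (deriv w) := hw1.continuous
  have hw1d : ∀ v, HasDerivAt (deriv w) (deriv (deriv w) v) v := fun v =>
    (hw1.differentiable (by norm_num)).differentiableAt.hasDerivAt
  have hw2c : Continuous (deriv (deriv w)) := hw1.continuous_deriv (by norm_num)
  have za : w a0 = 0 ∧ deriv w a0 = 0 := by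
    have : a0 ∉ tsupport w := fun h => (lt_irrefl _ (hs h).1)
    exact ⟨image_eq_zero_of_notMem_tsupport this, by
      by_contra h; exact this (support_deriv_subset h)⟩
  have zb : w b0 = 0 ∧ deriv w b0 = 0 := by
    have : b0 ∉ tsupport w := fun h => (lt_irrefl _ (hs h).2)
    exact ⟨image_eq_zero_of_notMem_tsupport this, by
      by_contra h; exact this (support_deriv_subset h)⟩
  set K : Set (ℝ × ℝ) := Set.Icc A0 B0 ×ˢ Set.Icc a0 b0 with hK
  have hKs : K ⊆ Set.Ioi 0 ×ˢ Set.Ioi 0 := fun p hp => ⟨lt_of_lt_of_le hA0 hp.1.1, lt_of_lt_of_le ha0 hp.2.1⟩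
  replace kc := kc.mono hKs
  replace k1c := k1c.mono hKs
  replace k2c := k2c.mono hKs
  set u1 : ℝ → ℝ → ℝ := fun v0 v => deriv w v * k v0 v + w v * k1 v0 v with hu1
  set u2 : ℝ → ℝ → ℝ := fun v0 v => (deriv (deriv w) v * k v0 v + deriv w v * k1 v0 v) +
    (deriv w v * k1 v0 v + w v * k2 v0 v) with hu2
  have hcomp : IsCompact K := isCompact_Icc.prod isCompact_Icc
  have cw : ContinuousOn (fun p : ℝ × ℝ => w p.2) K := (hwc.comp continuous_snd).continuousOn
  have cw1 : ContinuousOn (fun p : ℝ × ℝ => deriv w p.2) K := (hw1c.comp continuous_snd).continuousOn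
  have cw2 : ContinuousOn (fun p : ℝ × ℝ => deriv (deriv w) p.2) K := (hw2c.comp continuous_snd).continuousOn
  have cu1 : ContinuousOn (fun p : ℝ × ℝ => u1 p.1 p.2) K := (cw1.mul kc).add (cw.mul k1c)
  have cu2 : ContinuousOn (fun p : ℝ × ℝ => u2 p.1 p.2) K :=
    ((cw2.mul kc).add (cw1.mul k1c)).add ((cw1.mul k1c).add (cw.mul k2c))
  obtain ⟨D1, hD1⟩ := hcomp.exists_bound_of_continuousOn cw
  obtain ⟨D2, hD2⟩ := hcomp.exists_bound_of_continuousOn (cw.mul kc)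
  obtain ⟨D3, hD3⟩ := hcomp.exists_bound_of_continuousOn cu1
  obtain ⟨D4, hD4⟩ := hcomp.exists_bound_of_continuousOn (cu1.mul kc)
  obtain ⟨D5, hD5⟩ := hcomp.exists_bound_of_continuousOn ((cu2.mul kc).add (cu1.mul k1c))
  obtain ⟨D6, hD6⟩ := hcomp.exists_bound_of_continuousOn (f := fun p : ℝ × ℝ => α * (α - 1) * p.1 ^ (α - 2))
    (continuousOn_const.mul (ContinuousOn.rpow_const (by fun_prop) fun p hp => Or.inl (ne_of_gt (lt_of_lt_of_le hA0 hp.1.1))))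
  set D := |D1| + |D2| + |D3| + |D4| + |D5| with hD
  have l1 : D1 ≤ D := by rw [hD]; linarith [le_abs_self D1, abs_nonneg D2, abs_nonneg D3, abs_nonneg D4, abs_nonneg D5]
  have l2 : D2 ≤ D := by rw [hD]; linarith [le_abs_self D2, abs_nonneg D1, abs_nonneg D3, abs_nonneg D4, abs_nonneg D5]
  have l3 : D3 ≤ D := by rw [hD]; linarith [le_abs_self D3, abs_nonneg D2, abs_nonneg D1, abs_nonneg D4, abs_nonneg D5]
  have l4 : D4 ≤ D := by rw [hD]; linarith [le_abs_self D4, abs_nonneg D2, abs_nonneg D3, abs_nonneg D1, abs_nonneg D5]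
  have l5 : D5 ≤ D := by rw [hD]; linarith [le_abs_self D5, abs_nonneg D2, abs_nonneg D3, abs_nonneg D4, abs_nonneg D1]
  have hD0 : 0 ≤ D := by positivity
  have hmem : ∀ v0 ∈ Set.Icc A0 B0, ∀ v ∈ Set.Icc a0 b0, ((v0, v) : ℝ × ℝ) ∈ K := fun v0 h0 v hv => ⟨h0, hv⟩
  have sec : ∀ v0 ∈ Set.Icc A0 B0, ∀ f : ℝ × ℝ → ℝ, ContinuousOn f K → ContinuousOn (fun v => f (v0, v)) (Set.Icc a0 b0) :=
    fun v0 h0 f hf => hf.comp (by fun_prop) (fun v hv => hmem v0 h0 v hv)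
  have pos : ∀ v ∈ Set.Icc a0 b0, 0 < v := fun v hv => lt_of_lt_of_le ha0 hv.1
  have pos0 : ∀ v ∈ Set.Icc A0 B0, 0 < v := fun v hv => lt_of_lt_of_le hA0 hv.1
  have hψc : ∀ v0, ContinuousOn (fun v => α * (v ^ (α - 1) - v0 ^ (α - 1))) (Set.Icc a0 b0) := fun v0 =>
    continuousOn_const.mul (ContinuousOn.sub (ContinuousOn.rpow_const (by fun_prop) fun p hp =>
      Or.inl (ne_of_gt (pos p hp))) continuousOn_const)
  have hd1 : ∀ v0 ∈ Set.Icc A0 B0, ∀ v ∈ Set.Icc a0 b0, HasDerivAt (fun v => w v * k v0 v) (u1 v0 v) v :=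
    fun v0 h0 v hv => (hwd v).mul (hk v0 (pos0 v0 h0) v (pos v hv))
  have hd2 : ∀ v0 ∈ Set.Icc A0 B0, ∀ v ∈ Set.Icc a0 b0, HasDerivAt (fun v => u1 v0 v) (u2 v0 v) v :=
    fun v0 h0 v hv => ((hw1d v).mul (hk v0 (pos0 v0 h0) v (pos v hv))).add
      ((hwd v).mul (hk1 v0 (pos0 v0 h0) v (pos v hv)))
  have R1 : ∀ t ≥ 1, ∀ v0 ∈ Set.Icc A0 B0, ‖ampl α a0 b0 w t v0‖ ≤ D * (8 + (b0 - a0)) * t ^ (-(1 / 2) : ℝ) := by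
    intro t ht v0 h0
    refine osc1 (v0 := v0) hab ht (psi α v0) _ w (fun v => w v * k v0 v) (u1 v0) (fun v hv => psi_deriv (pos v hv)) (hψc v0)
      (hd1 v0 h0) (sec v0 h0 _ cu1) (by simp [za.1]) (by simp [zb.1]) hwc.continuousOn ?_
      (fun v hv => (hD1 _ (hmem v0 h0 v hv)).trans l1) (fun v hv => (hD2 _ (hmem v0 h0 v hv)).trans l2)
      (fun v hv => (hD3 _ (hmem v0 h0 v hv)).trans l3)
    intro v hv
    rw [← hkey v0 (pos0 v0 h0) v (pos v hv)]; ring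
  have R2 : ∀ t ≥ 1, ∀ v0 ∈ Set.Icc A0 B0, ‖∫ v in a0..b0, (u1 v0 v : ℂ) * e (t * psi α v0 v)‖ ≤
      D * (8 + (b0 - a0)) * t ^ (-(1 / 2) : ℝ) := by
    intro t ht v0 h0
    refine osc1 (v0 := v0) hab ht (psi α v0) _ (u1 v0) (fun v => u1 v0 v * k v0 v) (fun v => u2 v0 v * k v0 v + u1 v0 v * k1 v0 v)
      (fun v hv => psi_deriv (pos v hv)) (hψc v0)
      (fun v hv => (hd2 v0 h0 v hv).mul (hk v0 (pos0 v0 h0) v (pos v hv)))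
      (sec v0 h0 _ ((cu2.mul kc).add (cu1.mul k1c))) (by simp [hu1, za.1, za.2]) (by simp [hu1, zb.1, zb.2])
      (sec v0 h0 _ cu1) ?_
      (fun v hv => (hD3 _ (hmem v0 h0 v hv)).trans l3) (fun v hv => (hD4 _ (hmem v0 h0 v hv)).trans l4)
      (fun v hv => (hD5 _ (hmem v0 h0 v hv)).trans l5)
    intro v hv
    rw [← hkey v0 (pos0 v0 h0) v (pos v hv)]; ring
  refine ⟨D * (8 + (b0 - a0)) * (1 + |D6|) + 1, ?_, ?_, ?_⟩
  · have : 0 ≤ D * (8 + (b0 - a0)) := mul_nonneg hD0 (by linarith)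
    positivity
  · intro t ht v0 h0
    refine (R1 t ht v0 h0).trans ?_
    have : 0 ≤ D * (8 + (b0 - a0)) := mul_nonneg hD0 (by linarith)
    gcongr
    nlinarith [abs_nonneg D6]
  · intro t ht v0 h0 v1 h1
    have hDD : 0 ≤ D * (8 + (b0 - a0)) := mul_nonneg hD0 (by linarith)
    have ht0 : (0:ℝ) < t := by linarith
    refine Convex.norm_image_sub_le_of_norm_hasDerivWithin_le (s := Set.Icc A0 B0)
      (fun x hx => (ampl_deriv (α := α) hwc ha0 hab t x (pos0 x hx)).hasDerivWithinAt) (fun x hx => ?_)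
      (convex_Icc _ _) h1 h0
    have hI := ibp (t := t) hab (psi α x) _ (fun v => w v * k x v) (u1 x) (fun v hv => psi_deriv (pos v hv)) (hψc x)
      (hd1 x hx) (sec x hx _ cu1) (by simp [za.1]) (by simp [zb.1])
    have heq : ∫ v in a0..b0, (w v : ℂ) * (((t * -(α * (α - 1) * x ^ (α - 2) * (v - x)) : ℝ) : ℂ) *
      (2 * Real.pi * Complex.I * e (t * psi α x v))) = ((α * (α - 1) * x ^ (α - 2) : ℝ) : ℂ) *
        ∫ v in a0..b0, (u1 x v : ℂ) * e (t * psi α x v) := by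
      rw [← neg_eq_iff_eq_neg.2 hI, ← intervalIntegral.integral_const_mul, ← intervalIntegral.integral_neg,
        ← intervalIntegral.integral_const_mul]
      refine intervalIntegral.integral_congr fun v hv => ?_
      rw [Set.uIcc_of_le hab] at hv
      have := hkey x (pos0 x hx) v (pos v hv)
      rw [← this]; push_cast; ring
    rw [heq, norm_mul, Complex.norm_real]
    have h6 := hD6 (x, a0) ⟨hx, Set.left_mem_Icc.2 hab⟩
    calc _ ≤ |D6| * (D * (8 + (b0 - a0)) * t ^ (-(1 / 2) : ℝ)) := by
          gcongr
          · exact h6.trans (le_abs_self _)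
          · exact R2 t ht x hx
      _ ≤ _ := by
          rw [← mul_assoc]
          gcongr
          nlinarith [abs_nonneg D6]

lemma nonstat_abs {a0 b0 D W b : ℝ} (hab : a0 ≤ b0) (hD : 0 < D) (w w1 w2 ρ ρ1 r r1 r2 : ℝ → ℝ)
    (hw : ∀ v ∈ Set.Icc a0 b0, HasDerivAt w (w1 v) v) (hw1 : ∀ v ∈ Set.Icc a0 b0, HasDerivAt w1 (w2 v) v)
    (hw2 : ContinuousOn w2 (Set.Icc a0 b0))
    (hρ : ∀ v ∈ Set.Icc a0 b0, HasDerivAt ρ (ρ1 v) v) (hρ1 : ContinuousOn ρ1 (Set.Icc a0 b0))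
    (hr : ∀ v ∈ Set.Icc a0 b0, HasDerivAt r (r1 v) v) (hr1 : ∀ v ∈ Set.Icc a0 b0, HasDerivAt r1 (r2 v) v)
    (hr2 : ContinuousOn r2 (Set.Icc a0 b0)) (hρr : ∀ v ∈ Set.Icc a0 b0, ρ1 v * r v = 1)
    (hWb : ∀ v ∈ Set.Icc a0 b0, |w v| ≤ W ∧ |w1 v| ≤ W ∧ |w2 v| ≤ W)
    (hrb : ∀ v ∈ Set.Icc a0 b0, |r v| ≤ b ∧ |r1 v| ≤ b ∧ |r2 v| ≤ b)
    (z0 : w a0 = 0 ∧ w b0 = 0) (z1 : w1 a0 = 0 ∧ w1 b0 = 0) :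
    ‖∫ v in a0..b0, (w v : ℂ) * e (D * ρ v)‖ ≤ 6 * W * b ^ 2 * (b0 - a0) / D ^ 2 := by
  set u1 : ℝ → ℝ := fun v => w1 v * r v + w v * r1 v with hu1
  set u1' : ℝ → ℝ := fun v => (w2 v * r v + w1 v * r1 v) + (w1 v * r1 v + w v * r2 v)
  set u2 : ℝ → ℝ := fun v => u1' v * r v + u1 v * r1 v
  have c : ∀ {f f' : ℝ → ℝ}, (∀ v ∈ Set.Icc a0 b0, HasDerivAt f (f' v) v) → ContinuousOn f (Set.Icc a0 b0) :=
    fun h v hv => (h v hv).continuousAt.continuousWithinAt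
  have cw := c hw; have cw1 := c hw1; have cr := c hr; have cr1 := c hr1
  have cu1 : ContinuousOn u1 (Set.Icc a0 b0) := (cw1.mul cr).add (cw.mul cr1)
  have cu2 : ContinuousOn u2 (Set.Icc a0 b0) :=
    ((((hw2.mul cr).add (cw1.mul cr1)).add ((cw1.mul cr1).add (cw.mul hr2))).mul cr).add (cu1.mul cr1)
  have i1 := ibp (t := D) hab ρ ρ1 (fun v => w v * r v) u1 hρ hρ1 (fun v hv => (hw v hv).mul (hr v hv)) cu1
    (by simp [z0]) (by simp [z0])
  have i2 := ibp (t := D) hab ρ ρ1 (fun v => u1 v * r v) u2 hρ hρ1 (fun v hv =>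
    (((hw1 v hv).mul (hr v hv)).add ((hw v hv).mul (hr1 v hv))).mul (hr v hv)) cu2
    (by simp [hu1, z0, z1]) (by simp [hu1, z0, z1])
  have e1 : ∀ f : ℝ → ℝ, ∫ v in a0..b0, ((ρ1 v * (f v * r v) : ℝ) : ℂ) * e (D * ρ v) = ∫ v in a0..b0, (f v : ℂ) * e (D * ρ v) := by
    intro f
    refine intervalIntegral.integral_congr fun v hv => ?_
    rw [Set.uIcc_of_le hab] at hv
    rw [show ρ1 v * (f v * r v) = (ρ1 v * r v) * f v by ring, hρr v hv, one_mul]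
  rw [e1] at i1 i2
  have n1 := congrArg norm i1
  have n2 := congrArg norm i2
  have hpi := Real.pi_gt_three
  have hc : ‖(2 * Real.pi * Complex.I * D : ℂ)‖ = 2 * Real.pi * D := by
    simp [abs_of_pos hD, abs_of_pos Real.pi_pos]
  rw [norm_mul, norm_neg, hc] at n1 n2
  have b2 : ‖∫ v in a0..b0, (u2 v : ℂ) * e (D * ρ v)‖ ≤ 6 * W * b ^ 2 * |b0 - a0| := by
    refine intervalIntegral.norm_integral_le_of_norm_le_const fun v hv => ?_
    rw [Set.uIoc_of_le hab] at hv
    rw [norm_mul, e_norm, mul_one, Complex.norm_real, Real.norm_eq_abs]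
    obtain ⟨h1, h2, h3⟩ := hWb v (Set.Ioc_subset_Icc_self hv)
    obtain ⟨h4, h5, h6⟩ := hrb v (Set.Ioc_subset_Icc_self hv)
    have hW := (abs_nonneg _).trans h1
    have hb := (abs_nonneg _).trans h4
    have m : ∀ {x y X Y : ℝ}, |x| ≤ X → |y| ≤ Y → |x * y| ≤ X * Y := fun hx hy => by
      rw [abs_mul]; exact mul_le_mul hx hy (abs_nonneg _) ((abs_nonneg _).trans hx)
    have g1 : |u1 v| ≤ W * b + W * b := (abs_add_le _ _).trans (add_le_add (m h2 h4) (m h1 h5))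
    have g2 : |u1' v| ≤ (W * b + W * b) + (W * b + W * b) := (abs_add_le _ _).trans
      (add_le_add ((abs_add_le _ _).trans (add_le_add (m h3 h4) (m h2 h5)))
        ((abs_add_le _ _).trans (add_le_add (m h2 h5) (m h1 h6))))
    refine ((abs_add_le _ _).trans (add_le_add (m g2 h4) (m g1 h5))).trans (le_of_eq (by ring))
  rw [abs_of_nonneg (sub_nonneg.2 hab)] at b2
  rw [le_div_iff₀ (by positivity)]
  refine le_trans ?_ b2
  rw [← n2, ← n1]
  have hy : 0 ≤ ‖∫ v in a0..b0, (w v : ℂ) * e (D * ρ v)‖ := norm_nonneg _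
  have : 1 ≤ 2 * Real.pi := by linarith
  calc _ = ‖∫ v in a0..b0, (w v : ℂ) * e (D * ρ v)‖ * D ^ 2 * (1 * 1) := by ring
    _ ≤ ‖∫ v in a0..b0, (w v : ℂ) * e (D * ρ v)‖ * D ^ 2 * (2 * Real.pi * (2 * Real.pi)) := by gcongr
    _ = _ := by ring

noncomputable def Iosc (α a0 b0 : ℝ) (w : ℝ → ℝ) (t ξ : ℝ) : ℂ :=
  ∫ v in a0..b0, (w v : ℂ) * e (t * v ^ α - ξ * v)

lemma w_facts {w : ℝ → ℝ} (hw : ContDiff ℝ 2 w) {a0 b0 : ℝ} (hs : tsupport w ⊆ Set.Ioo a0 b0) :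
    (∀ v, HasDerivAt w (deriv w v) v) ∧ (∀ v, HasDerivAt (deriv w) (deriv (deriv w) v) v) ∧
    Continuous (deriv (deriv w)) ∧ (w a0 = 0 ∧ w b0 = 0) ∧ (deriv w a0 = 0 ∧ deriv w b0 = 0) := by
  have hw1 : ContDiff ℝ 1 (deriv w) := ContDiff.deriv' (n := 1) (by rw [one_add_one_eq_two]; exact hw)
  have ha : a0 ∉ tsupport w := fun h => (lt_irrefl _ (hs h).1)
  have hb : b0 ∉ tsupport w := fun h => (lt_irrefl _ (hs h).2)
  exact ⟨fun v => (hw.differentiable (by norm_num)).differentiableAt.hasDerivAt,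
    fun v => (hw1.differentiable (by norm_num)).differentiableAt.hasDerivAt, hw1.continuous_deriv (by norm_num),
    ⟨image_eq_zero_of_notMem_tsupport ha, image_eq_zero_of_notMem_tsupport hb⟩,
    ⟨by by_contra h; exact ha (support_deriv_subset h), by by_contra h; exact hb (support_deriv_subset h)⟩⟩

set_option maxHeartbeats 1600000 in
lemma nonstat (α : ℝ) (hα : 1 < α) (w : ℝ → ℝ) (hw : ContDiff ℝ 2 w) (a0 b0 p1 p2 : ℝ) (ha0 : 0 < a0)
    (hab : a0 ≤ b0) (hs : tsupport w ⊆ Set.Ioo a0 b0) (hp1 : 0 < p1) (hp1' : p1 < α * a0 ^ (α - 1))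
    (hp2 : α * b0 ^ (α - 1) < p2) : ∃ C > 0, ∀ t > 0, ∀ ξ : ℝ, (ξ ≤ p1 * t ∨ p2 * t ≤ ξ) →
      ‖Iosc α a0 b0 w t ξ‖ ≤ C / (t + |ξ|) ^ 2 := by
  obtain ⟨hwd, hwd1, hw2c, z0, z1⟩ := w_facts hw hs
  obtain ⟨W1, hW1⟩ := (isCompact_Icc (a := a0) (b := b0)).exists_bound_of_continuousOn hw.continuous.continuousOn
  obtain ⟨W2, hW2⟩ := (isCompact_Icc (a := a0) (b := b0)).exists_bound_of_continuousOn
    (f := deriv w) (fun v _ => (hwd1 v).continuousAt.continuousWithinAt)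
  obtain ⟨W3, hW3⟩ := (isCompact_Icc (a := a0) (b := b0)).exists_bound_of_continuousOn hw2c.continuousOn
  have pos : ∀ v ∈ Set.Icc a0 b0, 0 < v := fun v hv => lt_of_lt_of_le ha0 hv.1
  have hrc : ∀ s : ℝ, ContinuousOn (fun v : ℝ => v ^ s) (Set.Icc a0 b0) := fun s =>
    ContinuousOn.rpow_const (by fun_prop) fun p hp => Or.inl (ne_of_gt (pos p hp))
  obtain ⟨E1, hE1⟩ := (isCompact_Icc (a := a0) (b := b0)).exists_bound_of_continuousOn
    (continuousOn_const.mul (hrc (α - 2)) : ContinuousOn (fun v : ℝ => α * (α - 1) * v ^ (α - 2)) _)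
  obtain ⟨E2, hE2⟩ := (isCompact_Icc (a := a0) (b := b0)).exists_bound_of_continuousOn
    (continuousOn_const.mul (hrc (α - 3)) : ContinuousOn (fun v : ℝ => α * (α - 1) * (α - 2) * v ^ (α - 3)) _)
  set W := |W1| + |W2| + |W3| + 1 with hW
  set E := |E1| + |E2| with hE
  set q1 := α * a0 ^ (α - 1) with hq1
  set q2 := α * b0 ^ (α - 1) with hq2
  have hb0 : 0 < b0 := by linarith
  have hq1p : 0 < q1 := by positivity
  have hq2p : 0 < q2 := by positivity
  obtain ⟨c, hc, hcb⟩ : ∃ c > 0, ∀ θ1 θ2 : ℝ, 0 < θ1 → θ1 + |θ2| = 1 → (θ2 ≤ p1 * θ1 ∨ p2 * θ1 ≤ θ2) →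
      ∀ v ∈ Set.Icc a0 b0, c ≤ |θ1 * (α * v ^ (α - 1)) - θ2| := by
    refine ⟨min (min q1 1) (min ((q1 - p1) / (1 + p1)) ((p2 - q2) / (1 + p2))), ?_, ?_⟩
    · have : 0 < q1 - p1 := by linarith
      have : 0 < p2 - q2 := by linarith
      have : 0 < p2 := by linarith
      positivity
    · intro θ1 θ2 h1 h2 h3 v hv
      have hv1 : q1 ≤ α * v ^ (α - 1) := by
        rw [hq1]; gcongr
        exact hv.1
      have hv2 : α * v ^ (α - 1) ≤ q2 := by
        have := (pos v hv).le
        rw [hq2]; gcongr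
        exact hv.2
      set y := α * v ^ (α - 1)
      rcases h3 with h3 | h3
      · refine le_trans ?_ (le_abs_self _)
        rcases le_total θ2 0 with h4 | h4
        · refine (min_le_left _ _).trans ?_
          rw [abs_of_nonpos h4] at h2
          rcases le_total q1 1 with h5 | h5
          · rw [min_eq_left h5]; nlinarith
          · rw [min_eq_right h5]; nlinarith
        · refine ((min_le_right _ _).trans (min_le_left _ _)).trans ?_
          rw [abs_of_nonneg h4] at h2
          rw [div_le_iff₀ (by linarith)]
          have : 1 ≤ θ1 * (1 + p1) := by nlinarith
          have : (q1 - p1) * θ1 ≤ θ1 * y - θ2 := by nlinarith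
          nlinarith [mul_le_mul_of_nonneg_right this (by linarith : 0 ≤ 1 + p1)]
      · refine le_trans ?_ (neg_le_abs _)
        refine ((min_le_right _ _).trans (min_le_right _ _)).trans ?_
        have hp2 : 0 < p2 := by linarith
        have h4 : 0 ≤ θ2 := le_trans (by positivity) h3
        rw [abs_of_nonneg h4] at h2
        rw [div_le_iff₀ (by linarith)]
        have h5 : θ1 * y ≤ θ1 * q2 := by gcongr
        have : θ1 * (1 + p2) ≤ 1 := by nlinarith
        nlinarith
  set b := c⁻¹ + E * (c⁻¹) ^ 2 + (E * (c⁻¹) ^ 2 + 2 * E ^ 2 * (c⁻¹) ^ 3) with hb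
  have hE0 : 0 ≤ E := by positivity
  have hb0 : 0 < b := by positivity
  refine ⟨6 * W * b ^ 2 * (b0 - a0) + 1, by have := sub_nonneg.2 hab; positivity, fun t ht ξ hξ => ?_⟩
  set D := t + |ξ| with hD
  have hDp : 0 < D := by positivity
  set θ1 := t / D with hθ1
  set θ2 := ξ / D with hθ2
  have hθ1p : 0 < θ1 := by positivity
  have hθ : θ1 + |θ2| = 1 := by rw [hθ1, hθ2, abs_div, abs_of_pos hDp, ← add_div, div_self hDp.ne']
  have hθle : θ1 ≤ 1 := by linarith [abs_nonneg θ2]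
  have hcond : θ2 ≤ p1 * θ1 ∨ p2 * θ1 ≤ θ2 := by
    rcases hξ with h | h
    · left; rw [hθ1, hθ2, ← mul_div_assoc]; gcongr
    · right; rw [hθ1, hθ2, ← mul_div_assoc]; gcongr
  have hlow := hcb θ1 θ2 hθ1p hθ hcond
  set ρ1 : ℝ → ℝ := fun v => θ1 * (α * v ^ (α - 1)) - θ2
  set ρ2 : ℝ → ℝ := fun v => θ1 * (α * (α - 1) * v ^ (α - 2))
  set ρ3 : ℝ → ℝ := fun v => θ1 * (α * (α - 1) * (α - 2) * v ^ (α - 3))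
  have d1 : ∀ v ∈ Set.Icc a0 b0, HasDerivAt (fun v => θ1 * v ^ α - θ2 * v) (ρ1 v) v := fun v hv => by
    have h1 : HasDerivAt (fun v : ℝ => v ^ α) (α * v ^ (α - 1)) v := Real.hasDerivAt_rpow_const (Or.inl (pos v hv).ne')
    exact ((h1.const_mul θ1).sub ((hasDerivAt_id v).const_mul θ2)).congr_deriv (by simp [ρ1])
  have d2 : ∀ v ∈ Set.Icc a0 b0, HasDerivAt ρ1 (ρ2 v) v := fun v hv => by
    have h1 : HasDerivAt (fun v : ℝ => v ^ (α - 1)) ((α - 1) * v ^ (α - 1 - 1)) v := Real.hasDerivAt_rpow_const (Or.inl (pos v hv).ne')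
    exact (((h1.const_mul α).const_mul θ1).sub_const θ2).congr_deriv (by
      simp only [ρ2]; rw [show α - 1 - 1 = α - 2 by ring]; ring)
  have d3 : ∀ v ∈ Set.Icc a0 b0, HasDerivAt ρ2 (ρ3 v) v := fun v hv => by
    have h1 : HasDerivAt (fun v : ℝ => v ^ (α - 2)) ((α - 2) * v ^ (α - 2 - 1)) v := Real.hasDerivAt_rpow_const (Or.inl (pos v hv).ne')
    exact ((h1.const_mul (α * (α - 1))).const_mul θ1).congr_deriv (by
      simp only [ρ3]; rw [show α - 2 - 1 = α - 3 by ring]; ring)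
  have hne : ∀ v ∈ Set.Icc a0 b0, ρ1 v ≠ 0 := fun v hv h => by
    have : c ≤ |ρ1 v| := hlow v hv
    rw [h, abs_zero] at this; linarith
  have cρ1 : ContinuousOn ρ1 (Set.Icc a0 b0) := fun v hv => (d2 v hv).continuousAt.continuousWithinAt
  have cρ2 : ContinuousOn ρ2 (Set.Icc a0 b0) := fun v hv => (d3 v hv).continuousAt.continuousWithinAt
  have cρ3 : ContinuousOn ρ3 (Set.Icc a0 b0) := continuousOn_const.mul (continuousOn_const.mul (hrc _))
  have := nonstat_abs (W := W) (b := b) hab hDp w (deriv w) (deriv (deriv w)) (fun v => θ1 * v ^ α - θ2 * v) ρ1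
    (fun v => (ρ1 v)⁻¹) (fun v => - ρ2 v / (ρ1 v) ^ 2)
    (fun v => (-ρ3 v * (ρ1 v) ^ 2 - (-ρ2 v) * (2 * ρ1 v * ρ2 v)) / ((ρ1 v) ^ 2) ^ 2)
    (fun v _ => hwd v) (fun v _ => hwd1 v) hw2c.continuousOn d1 cρ1
    (fun v hv => (d2 v hv).inv (hne v hv))
    (fun v hv => ((d3 v hv).neg.div ((d2 v hv).pow 2) (pow_ne_zero 2 (hne v hv))).congr_deriv (by
      simp))
    (ContinuousOn.div (by fun_prop) (by fun_prop) (fun v hv => pow_ne_zero 2 (pow_ne_zero 2 (hne v hv))))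
    (fun v hv => mul_inv_cancel₀ (hne v hv))
    (fun v hv => by
      have h1 := hW1 v hv; have h2 := hW2 v hv; have h3 := hW3 v hv
      rw [Real.norm_eq_abs] at h1 h2 h3
      have := le_abs_self W1; have := le_abs_self W2; have := le_abs_self W3
      have := abs_nonneg W1; have := abs_nonneg W2; have := abs_nonneg W3
      rw [hW]
      exact ⟨by linarith, by linarith, by linarith⟩)
    (fun v hv => by
      have h0 : |(ρ1 v)⁻¹| ≤ c⁻¹ := by
        rw [abs_inv]; exact inv_anti₀ hc (hlow v hv)
      have g2 : |ρ2 v| ≤ E := by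
        have h1 := hE1 v hv
        rw [abs_mul, abs_of_pos hθ1p]
        have : |α * (α - 1) * v ^ (α - 2)| ≤ E := h1.trans ((le_abs_self _).trans (by rw [hE]; linarith [abs_nonneg E2]))
        nlinarith [abs_nonneg (α * (α - 1) * v ^ (α - 2))]
      have g3 : |ρ3 v| ≤ E := by
        have h1 := hE2 v hv
        rw [abs_mul, abs_of_pos hθ1p]
        have : |α * (α - 1) * (α - 2) * v ^ (α - 3)| ≤ E := h1.trans ((le_abs_self _).trans (by rw [hE]; linarith [abs_nonneg E1]))
        nlinarith [abs_nonneg (α * (α - 1) * (α - 2) * v ^ (α - 3))]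
      have hn := hne v hv
      have hci : 0 < c⁻¹ := by positivity
      refine ⟨h0.trans ?_, ?_, ?_⟩
      · rw [hb]; have : 0 ≤ E * c⁻¹ ^ 2 + (E * c⁻¹ ^ 2 + 2 * E ^ 2 * c⁻¹ ^ 3) := by positivity
        linarith
      · rw [div_eq_mul_inv, ← inv_pow, abs_mul, abs_neg, abs_pow]
        have : |ρ2 v| * |(ρ1 v)⁻¹| ^ 2 ≤ E * c⁻¹ ^ 2 := by gcongr
        have : 0 ≤ c⁻¹ + (E * c⁻¹ ^ 2 + 2 * E ^ 2 * c⁻¹ ^ 3) := by positivity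
        rw [hb]; linarith
      · have : (-ρ3 v * (ρ1 v) ^ 2 - (-ρ2 v) * (2 * ρ1 v * ρ2 v)) / ((ρ1 v) ^ 2) ^ 2 =
            -ρ3 v * ((ρ1 v)⁻¹) ^ 2 + 2 * ρ2 v ^ 2 * ((ρ1 v)⁻¹) ^ 3 := by field_simp; ring
        rw [this]
        refine (abs_add_le _ _).trans ?_
        rw [abs_mul (-ρ3 v), abs_mul (2 * ρ2 v ^ 2), abs_neg, abs_pow, abs_pow, abs_mul 2, abs_pow, abs_two]
        have : |ρ3 v| * |(ρ1 v)⁻¹| ^ 2 + 2 * |ρ2 v| ^ 2 * |(ρ1 v)⁻¹| ^ 3 ≤ E * c⁻¹ ^ 2 + 2 * E ^ 2 * c⁻¹ ^ 3 := by gcongr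
        have : 0 ≤ c⁻¹ + E * c⁻¹ ^ 2 := by positivity
        rw [hb]; linarith) z0 z1
  have heq : Iosc α a0 b0 w t ξ = ∫ v in a0..b0, (w v : ℂ) * e (D * (θ1 * v ^ α - θ2 * v)) := by
    unfold Iosc
    congr 1; ext v; congr 2
    rw [hθ1, hθ2]; field_simp
  rw [heq]
  refine this.trans ?_
  gcongr
  linarith

noncomputable def fS (α : ℝ) (w : ℝ → ℝ) (M ξ t y : ℝ) : ℂ := (w (y / M) : ℂ) * e (t * (y / M) ^ α + ξ * y)

noncomputable def Ssum (α : ℝ) (w : ℝ → ℝ) (M σ ξ t : ℝ) : ℂ := ∑' n : ℤ, fS α w M ξ t (σ + n)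

lemma fS_fourier {α a0 b0 M ξ t : ℝ} {w : ℝ → ℝ} (hM : 0 < M) (hab : a0 ≤ b0)
    (hs : tsupport w ⊆ Set.Ioo a0 b0) (k : ℝ) :
    FourierTransform.fourier (fS α w M ξ t) k = M * Iosc α a0 b0 w t ((k - ξ) * M) := by
  rw [Real.fourier_real_eq_integral_exp_smul]
  have h1 : ∀ y : ℝ, Complex.exp (↑(-2 * Real.pi * y * k) * Complex.I) • fS α w M ξ t y =
      (fun v => (w v : ℂ) * e (t * v ^ α - (k - ξ) * M * v)) (y / M) := by
    intro y
    have : Complex.exp (↑(-2 * Real.pi * y * k) * Complex.I) = e (- (k * y)) := by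
      unfold e; congr 1; push_cast; ring
    rw [this]
    unfold fS
    simp only [smul_eq_mul]
    rw [show t * (y / M) ^ α - (k - ξ) * M * (y / M) = -(k * y) + (t * (y / M) ^ α + ξ * y) by
      field_simp; ring, e_add (-(k * y))]
    ring
  rw [integral_congr_ae (Filter.Eventually.of_forall h1), MeasureTheory.Measure.integral_comp_div
    (fun v => (w v : ℂ) * e (t * v ^ α - (k - ξ) * M * v)), abs_of_pos hM, ← intervalIntegral.integral_eq_integral_of_support_subset (a := a0) (b := b0)]
  · simp [Iosc]
  · intro v hv
    have hv : w v ≠ 0 := by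
      intro h; apply hv; simp [h]
    have := hs (subset_tsupport _ hv)
    exact ⟨this.1, this.2.le⟩

lemma fS_cont {α M ξ t : ℝ} (hα : 1 < α) {w : ℝ → ℝ} (hw : Continuous w) : Continuous (fS α w M ξ t) := by
  unfold fS
  have h1 : Continuous fun y : ℝ => (y / M) ^ α := (continuous_id.div_const M).rpow_const (fun _ => Or.inr (by linarith))
  have := e_continuous
  have h2 : Continuous fun y : ℝ => e (t * (y / M) ^ α + ξ * y) := this.comp (by fun_prop)
  fun_prop

lemma fS_decay {α a0 b0 M ξ t : ℝ} {w : ℝ → ℝ} (hM : 0 < M)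
    (hs : tsupport w ⊆ Set.Ioo a0 b0) :
    Asymptotics.IsBigO (Filter.cocompact ℝ) (fS α w M ξ t) fun x : ℝ => |x| ^ (-2 : ℝ) := by
  have : fS α w M ξ t =ᶠ[Filter.cocompact ℝ] fun _ => 0 := by
    rw [Filter.EventuallyEq, Filter.Eventually, Filter.mem_cocompact]
    refine ⟨Set.Icc (a0 * M) (b0 * M), isCompact_Icc, ?_⟩
    intro y hy
    by_contra h
    have hv : w (y / M) ≠ 0 := by
      intro h'; apply h; simp [fS, h']
    have := hs (subset_tsupport _ hv)
    apply hy
    exact ⟨by rw [← le_div_iff₀ hM]; exact this.1.le, by rw [← div_le_iff₀ hM]; exact this.2.le⟩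
  exact this.trans_isBigO (Asymptotics.isBigO_zero _ _)

lemma sq_bound {M t ξ : ℝ} (hM : 0 < M) (ht : 0 < t) (hξ : ξ ∈ Set.Icc (0 : ℝ) 1) (k : ℤ) :
    1 / (t + |(k - ξ) * M|) ^ 2 ≤ (if k = 0 then 1 / t ^ 2 else 0) + (if k = 1 then 1 / t ^ 2 else 0)
      + 4 / M ^ 2 * (1 / (k : ℝ) ^ 2) := by
  have h0 : 0 ≤ |(k - ξ) * M| := abs_nonneg _
  have h1 : 1 / (t + |(k - ξ) * M|) ^ 2 ≤ 1 / t ^ 2 := by gcongr; linarith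
  have h2 : 0 ≤ 4 / M ^ 2 * (1 / (k : ℝ) ^ 2) := by positivity
  rcases eq_or_ne k 0 with h | h
  · rw [if_pos h, if_neg (by omega)]; linarith
  rcases eq_or_ne k 1 with h' | h'
  · rw [if_pos h', if_neg (by omega)]; linarith
  rw [if_neg h, if_neg h', zero_add, zero_add]
  have h3 : |(k : ℝ)| / 2 ≤ |k - ξ| := by
    rcases lt_or_ge k 0 with hk | hk
    · have : (k : ℝ) ≤ -1 := by exact_mod_cast (by omega : k ≤ -1)
      rw [abs_of_neg (by linarith), abs_of_neg (by linarith [hξ.1])]; linarith [hξ.1]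
    · have : (2 : ℝ) ≤ k := by exact_mod_cast (by omega : 2 ≤ k)
      rw [abs_of_pos (by linarith), abs_of_pos (by linarith [hξ.2])]; linarith [hξ.2]
  have hk : 0 < |(k : ℝ)| := by rw [abs_pos]; exact_mod_cast h
  calc _ ≤ 1 / (|(k : ℝ)| / 2 * M) ^ 2 := by
        rw [abs_mul, abs_of_pos hM]
        gcongr
        have : |(k : ℝ)| / 2 * M ≤ |k - ξ| * M := by gcongr
        linarith
    _ = _ := by rw [mul_pow, div_pow, sq_abs]; field_simp; norm_num

lemma sq_summable {M t : ℝ} :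
    Summable (fun k : ℤ => (if k = 0 then 1 / t ^ 2 else 0) + (if k = 1 then 1 / t ^ 2 else 0)
      + 4 / M ^ 2 * (1 / (k : ℝ) ^ 2)) := by
  refine Summable.add (Summable.add ?_ ?_) ((Real.summable_one_div_int_pow.2 (by norm_num)).mul_left _)
  · exact (hasSum_ite_eq 0 _).summable
  · exact (hasSum_ite_eq 1 _).summable

lemma sq_tsum : ∃ Z > 0, ∀ M t : ℝ, 
    ∑' (k : ℤ), ((if k = 0 then 1 / t ^ 2 else 0) + (if k = 1 then 1 / t ^ 2 else 0)
      + 4 / M ^ 2 * (1 / (k : ℝ) ^ 2)) ≤ 2 / t ^ 2 + Z / M ^ 2 := by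
  refine ⟨4 * ∑' (k : ℤ), (1 / (k : ℝ) ^ 2) + 1, by have : 0 ≤ ∑' (k : ℤ), (1 / (k : ℝ) ^ 2) := tsum_nonneg (fun k => by positivity); positivity, fun M t => ?_⟩
  rw [Summable.tsum_add, Summable.tsum_add, tsum_ite_eq, tsum_ite_eq, tsum_mul_left]
  · have : 0 ≤ 1 / M ^ 2 := by positivity
    calc _ = 2 / t ^ 2 + (4 * ∑' (k : ℤ), (1 / (k : ℝ) ^ 2)) / M ^ 2 := by ring
      _ ≤ _ := by rw [add_div]; linarith
  · exact (hasSum_ite_eq 0 _).summable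
  · exact (hasSum_ite_eq 1 _).summable
  · exact Summable.add (hasSum_ite_eq 0 _).summable (hasSum_ite_eq 1 _).summable
  · exact ((Real.summable_one_div_int_pow.2 (by norm_num)).mul_left _)

lemma poissonS (α : ℝ) (hα : 1 < α) (w : ℝ → ℝ) (hw : ContDiff ℝ 2 w) (a0 b0 p1 p2 : ℝ) (ha0 : 0 < a0)
    (hab : a0 ≤ b0) (hs : tsupport w ⊆ Set.Ioo a0 b0) (hp1 : 0 < p1) (hp1' : p1 < α * a0 ^ (α - 1))
    (hp2 : α * b0 ^ (α - 1) < p2) : ∃ C > 0, ∀ M > 0, ∀ t > 0, ∀ σ : ℝ, ∀ ξ ∈ Set.Icc (0 : ℝ) 1,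
      ∀ s : Finset ℤ, (∀ k : ℤ, p1 * t ≤ (k - ξ) * M → (k - ξ) * M ≤ p2 * t → k ∈ s) →
      ‖Ssum α w M σ ξ t - ∑ k ∈ s, M * Iosc α a0 b0 w t ((k - ξ) * M) * e (k * σ)‖ ≤ C * (M / t ^ 2 + 1 / M) := by
  obtain ⟨C, hC, hI⟩ := nonstat α hα w hw a0 b0 p1 p2 ha0 hab hs hp1 hp1' hp2
  obtain ⟨Z, hZ, hZ'⟩ := sq_tsum
  refine ⟨C * (2 + Z), by positivity, fun M hM t ht σ ξ hξ s hS => ?_⟩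
  set F : ℤ → ℂ := fun k => M * Iosc α a0 b0 w t ((k - ξ) * M) * e (k * σ)
  have hb : ∀ k ∉ s, ‖F k‖ ≤ M * C * ((if k = 0 then 1 / t ^ 2 else 0) + (if k = 1 then 1 / t ^ 2 else 0)
      + 4 / M ^ 2 * (1 / (k : ℝ) ^ 2)) := by
    intro k hk
    have : ((k : ℝ) - ξ) * M ≤ p1 * t ∨ p2 * t ≤ (k - ξ) * M := by
      by_contra h; push Not at h; exact hk (hS k h.1.le h.2.le)
    have h1 := hI t ht _ this
    simp only [F]
    rw [norm_mul, norm_mul, e_norm, mul_one, Complex.norm_real, Real.norm_eq_abs, abs_of_pos hM, mul_assoc]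
    gcongr
    refine h1.trans ?_
    rw [div_eq_mul_one_div]
    gcongr
    exact sq_bound hM ht hξ k
  have hsum := (sq_summable (M := M) (t := t)).mul_left (M * C)
  have hFs : Summable F := by
    refine Summable.of_norm_bounded_eventually hsum ?_
    refine Set.Finite.subset s.finite_toSet ?_
    intro k hk
    by_contra h
    exact hk (hb k h)
  have hpo : Ssum α w M σ ξ t = ∑' k, F k := by
    unfold Ssum
    have hn : ∀ k : ℤ, FourierTransform.fourier (fS α w M ξ t) (k : ℝ) = F k * e (-(k * σ)) := by
      intro k
      rw [fS_fourier hM hab hs]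
      simp only [F]
      rw [mul_assoc, ← e_add, add_neg_cancel, e_zero, mul_one]
    rw [Real.tsum_eq_tsum_fourier_of_rpow_decay_of_summable (fS_cont hα hw.continuous) (b := 2) (by norm_num) (fS_decay hM hs)]
    · refine tsum_congr fun k => ?_
      rw [hn]
      rw [fourier_coe_apply]
      have : Complex.exp (2 * Real.pi * Complex.I * k * σ / (1 : ℝ)) = e (k * σ) := by
        unfold e; congr 1; push_cast; ring
      rw [this, mul_assoc, ← e_add, neg_add_cancel, e_zero, mul_one]
    · refine Summable.of_norm ?_
      simp_rw [hn, norm_mul, e_norm, mul_one]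
      exact hFs.norm
  rw [hpo, ← hFs.sum_add_tsum_compl (s := s), add_sub_cancel_left]
  have hle : ∀ k : (↑(s : Set ℤ)ᶜ : Set ℤ), ‖F k‖ ≤ M * C * ((if (k : ℤ) = 0 then 1 / t ^ 2 else 0) + (if (k : ℤ) = 1 then 1 / t ^ 2 else 0)
      + 4 / M ^ 2 * (1 / ((k : ℤ) : ℝ) ^ 2)) := fun k => hb k k.2
  refine (tsum_of_norm_bounded (hsum.subtype _).hasSum hle).trans ?_
  refine (hsum.tsum_subtype_le _ _ (fun k => ?_)).trans ?_
  · have h1 : (0 : ℝ) ≤ (if k = 0 then 1 / t ^ 2 else 0) := by split_ifs <;> positivity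
    have h2 : (0 : ℝ) ≤ (if k = 1 then 1 / t ^ 2 else 0) := by split_ifs <;> positivity
    positivity
  · rw [tsum_mul_left]
    calc _ ≤ M * C * (2 / t ^ 2 + Z / M ^ 2) := by gcongr; exact hZ' M t
      _ = C * (2 * (M / t ^ 2) + Z * (1 / M)) := by field_simp
      _ ≤ C * ((2 + Z) * (M / t ^ 2) + (2 + Z) * (1 / M)) := by gcongr <;> linarith
      _ = _ := by ring

def PP (θ : ℝ) : Prop := ∀ α : ℝ, 1 < α → ∀ R : ℝ, 1 ≤ R → ∃ B > 0, ∀ σ ∈ Set.Icc (0 : ℝ) 1, ∀ M : ℝ, 1 ≤ M → ∀ s : Finset ℕ,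
  (∀ k ∈ s, M ≤ k + σ ∧ k + σ ≤ R * M) → ∀ T > 0,
  T * Q4 s (fun k => ((k + σ) / M) ^ α) T ≤ B * M ^ θ * (T * M ^ 2 + M ^ 4)

lemma Ssum_fin {α a0 b0 M σ ξ : ℝ} {w : ℝ → ℝ} (hM : 0 < M) (ha0 : 0 < a0)
    (hs : tsupport w ⊆ Set.Ioo a0 b0) (hσ : σ ∈ Set.Icc (0 : ℝ) 1) (N : ℕ) (hN : b0 * M ≤ N) (t : ℝ) :
    Ssum α w M σ ξ t = ∑ j ∈ Finset.range N, fS α w M ξ t (σ + j) := by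
  unfold Ssum
  rw [tsum_eq_sum (s := (Finset.range N).image (fun j : ℕ => (j : ℤ)))]
  · rw [Finset.sum_image (fun a _ b _ h => by exact_mod_cast h)]
    simp
  · intro n hn
    have h0 : w ((σ + n) / M) = 0 := by
      by_contra h
      have := hs (subset_tsupport _ h)
      have h1 : 0 < σ + n := by
        have : 0 < (σ + n) / M := ha0.trans this.1
        by_contra h'; push Not at h'
        linarith [div_nonpos_of_nonpos_of_nonneg h' hM.le]
      have h2 : σ + n < N := lt_of_lt_of_le ((div_lt_iff₀ hM).1 this.2) hN
      apply hn
      rw [Finset.mem_image]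
      have h3 : (-1 : ℤ) < n := by
        have : (-1 : ℝ) < n := by linarith [hσ.2]
        exact_mod_cast this
      have h4 : n < N := by
        have : (n : ℝ) < N := by linarith [hσ.1]
        exact_mod_cast this
      exact ⟨n.toNat, by rw [Finset.mem_range]; omega, by omega⟩
    simp [fS, h0]

lemma Ssum_cont {α a0 b0 M σ ξ : ℝ} {w : ℝ → ℝ} (hM : 0 < M) (ha0 : 0 < a0)
    (hs : tsupport w ⊆ Set.Ioo a0 b0) (hσ : σ ∈ Set.Icc (0 : ℝ) 1) :
    Continuous (Ssum α w M σ ξ) := by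
  obtain ⟨N, hN⟩ := exists_nat_ge (b0 * M)
  rw [show Ssum α w M σ ξ = fun t => ∑ j ∈ Finset.range N, fS α w M ξ t (σ + j) from
    funext fun t => Ssum_fin hM ha0 hs hσ N hN t]
  refine continuous_finsetSum _ fun j _ => ?_
  unfold fS
  exact continuous_const.mul (e_continuous.comp (by fun_prop))

lemma cov (γ κ : ℝ) (hγ : 0 < γ) (hκ : 0 < κ) : ∃ C > 0, ∀ T > 0, ∀ G : ℝ → ℝ, Continuous G → (∀ t, 0 ≤ G t) →
    Integrable (fun t => Real.exp (-Real.pi * t ^ 2 / (κ * T) ^ 2) * G t) →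
    ∫ t in T..2*T, G (-(κ * T ^ (1 + γ) * t ^ (-γ))) ≤ C * ∫ t, Real.exp (-Real.pi * t ^ 2 / (κ * T) ^ 2) * G t := by
  set c := κ * γ * 2 ^ (-γ - 1) with hc
  have hcp : 0 < c := by positivity
  refine ⟨c⁻¹ * Real.exp Real.pi, by positivity, fun T hT G hG hG0 hint => ?_⟩
  set f : ℝ → ℝ := fun t => -(κ * T ^ (1 + γ) * t ^ (-γ)) with hf
  set f' : ℝ → ℝ := fun t => κ * T ^ (1 + γ) * γ * t ^ (-γ - 1) with hf'
  have hTT : T ≤ 2 * T := by linarith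
  have pos : ∀ t ∈ Set.Icc T (2 * T), 0 < t := fun t ht => hT.trans_le ht.1
  have hd : ∀ t ∈ Set.Icc T (2 * T), HasDerivAt f (f' t) t := fun t ht => by
    have h1 : HasDerivAt (fun v : ℝ => v ^ (-γ)) (-γ * t ^ (-γ - 1)) t := Real.hasDerivAt_rpow_const (Or.inl (pos t ht).ne')
    exact (h1.const_mul (κ * T ^ (1 + γ))).neg.congr_deriv (by simp only [f']; ring)
  have hfc : ContinuousOn f (Set.Icc T (2 * T)) := fun t ht => (hd t ht).continuousAt.continuousWithinAt
  have hf'c : ContinuousOn f' (Set.Icc T (2 * T)) := by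
    refine continuousOn_const.mul (ContinuousOn.rpow_const (by fun_prop) fun p hp => Or.inl (ne_of_gt (pos p hp)))
  have hf'l : ∀ t ∈ Set.Icc T (2 * T), c ≤ f' t := by
    intro t ht
    have h1 : (2 * T) ^ (-γ - 1) ≤ t ^ (-γ - 1) := Real.rpow_le_rpow_of_nonpos (pos t ht) ht.2 (by linarith)
    calc c = κ * T ^ (1 + γ) * γ * (2 * T) ^ (-γ - 1) := by
          rw [Real.mul_rpow (by norm_num) hT.le, show -γ - 1 = -(1 + γ) by ring, Real.rpow_neg hT.le]
          have : T ^ (1 + γ) ≠ 0 := by positivity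
          rw [hc]; field_simp
          ring_nf
      _ ≤ _ := by simp only [f']; gcongr
  have hb : ∀ t ∈ Set.Icc T (2 * T), -(κ * T) ≤ f t ∧ f t ≤ 0 := by
    intro t ht
    have hp := pos t ht
    have h1 : t ^ (-γ) ≤ T ^ (-γ) := Real.rpow_le_rpow_of_nonpos hT ht.1 (by linarith)
    have : κ * T ^ (1 + γ) * t ^ (-γ) ≤ κ * T := by
      calc _ ≤ κ * T ^ (1 + γ) * T ^ (-γ) := by gcongr
        _ = κ * T := by rw [mul_assoc, ← Real.rpow_add hT]; simp
    have h2 : 0 ≤ κ * T ^ (1 + γ) * t ^ (-γ) := by positivity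
    exact ⟨by simp only [f]; linarith, by simp only [f]; linarith⟩
  have hGf : ContinuousOn (fun t => G (f t)) (Set.Icc T (2 * T)) := hG.comp_continuousOn hfc
  have i1 : ∫ t in T..2*T, G (f t) ≤ ∫ t in T..2*T, c⁻¹ * ((G ∘ f) t * f' t) := by
    refine intervalIntegral.integral_mono_on hTT (hGf.intervalIntegrable_of_Icc hTT)
      ((continuousOn_const.mul (hGf.mul hf'c)).intervalIntegrable_of_Icc hTT) fun t ht => ?_
    have := mul_le_mul_of_nonneg_left (hf'l t ht) (hG0 (f t))
    rw [inv_mul_eq_div, le_div_iff₀ hcp]; exact this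
  rw [intervalIntegral.integral_const_mul, intervalIntegral.integral_comp_mul_deriv' (by rwa [Set.uIcc_of_le hTT]) (by rwa [Set.uIcc_of_le hTT])
    hG.continuousOn] at i1
  refine i1.trans ?_
  rw [mul_assoc]
  gcongr
  have hTm : T ∈ Set.Icc T (2 * T) := ⟨le_refl _, hTT⟩
  have hTm2 : 2 * T ∈ Set.Icc T (2 * T) := ⟨hTT, le_refl _⟩
  have hmono : f T ≤ f (2 * T) := by
    simp only [f]
    have : (2 * T) ^ (-γ) ≤ T ^ (-γ) := Real.rpow_le_rpow_of_nonpos hT hTT (by linarith)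
    have : κ * T ^ (1 + γ) * (2 * T) ^ (-γ) ≤ κ * T ^ (1 + γ) * T ^ (-γ) := by gcongr
    linarith
  rw [← integral_const_mul, intervalIntegral.integral_of_le hmono]
  have hint' := hint.const_mul (Real.exp Real.pi)
  refine le_trans ?_ (setIntegral_le_integral (s := Set.Ioc (f T) (f (2 * T))) hint' (Filter.Eventually.of_forall fun t => by
    have := hG0 t; positivity))
  refine setIntegral_mono_on (hG.integrableOn_Ioc) hint'.integrableOn measurableSet_Ioc fun t ht => ?_
  rw [← mul_assoc, ← Real.exp_add]
  have : 1 ≤ Real.exp (Real.pi + -Real.pi * t ^ 2 / (κ * T) ^ 2) := by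
    apply Real.one_le_exp
    have h1 := (hb T hTm).1; have h2 := (hb _ hTm2).2
    have h3 : t ^ 2 ≤ (κ * T) ^ 2 := by
      have := ht.1; have := ht.2; have : 0 < κ * T := by positivity
      nlinarith
    have h4 : t ^ 2 / (κ * T) ^ 2 ≤ 1 := by rw [div_le_one (by positivity)]; exact h3
    have := Real.pi_pos
    rw [mul_div_assoc]; nlinarith
  nlinarith [hG0 t]

lemma abel_norm (n : ℕ) (a b : ℕ → ℂ) (A : ℝ) (ω : ℕ → ℝ) (hA : ∀ i < n, ‖a i‖ ≤ A)
    (hω : ∀ i, i + 1 < n → ‖a (i + 1) - a i‖ ≤ A * ω i) :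
    ‖∑ i ∈ Finset.range n, a i * b i‖ ≤
      A * ∑ i ∈ Finset.range n, (if i + 1 < n then ω i else 1) * ‖∑ j ∈ Finset.range (i + 1), b j‖ := by
  rcases n with _ | n
  · simp
  have := Finset.sum_range_by_parts a b (n + 1)
  simp only [smul_eq_mul] at this
  rw [this, add_tsub_cancel_right,
    Finset.sum_range_succ (fun i => (if i + 1 < n + 1 then ω i else 1) * ‖∑ j ∈ Finset.range (i + 1), b j‖), mul_add]
  refine (norm_sub_le _ _).trans ?_
  rw [add_comm ‖_‖]
  refine add_le_add ?_ ?_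
  · rw [Finset.mul_sum]
    refine (norm_sum_le _ _).trans (Finset.sum_le_sum fun i hi => ?_)
    rw [Finset.mem_range] at hi
    rw [norm_mul, if_pos (by omega), ← mul_assoc]
    exact mul_le_mul_of_nonneg_right (hω i (by omega)) (norm_nonneg _)
  · rw [norm_mul, if_neg (by omega), one_mul]
    exact mul_le_mul_of_nonneg_right (hA n (by omega)) (norm_nonneg _)

lemma holder4 {ι : Type*} (s : Finset ι) (ω x : ι → ℝ) (hω : ∀ i ∈ s, 0 ≤ ω i) :
    (∑ i ∈ s, ω i * x i) ^ 4 ≤ (∑ i ∈ s, ω i) ^ 3 * ∑ i ∈ s, ω i * x i ^ 4 := by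
  have h1 := Finset.sum_sq_le_sum_mul_sum_of_sq_eq_mul s (r := fun i => ω i * x i) (f := ω) (g := fun i => ω i * x i ^ 2)
    hω (fun i hi => mul_nonneg (hω i hi) (sq_nonneg _)) (fun i _ => by ring)
  have h2 := Finset.sum_sq_le_sum_mul_sum_of_sq_eq_mul s (r := fun i => ω i * x i ^ 2) (f := ω) (g := fun i => ω i * x i ^ 4)
    hω (fun i hi => mul_nonneg (hω i hi) (by positivity)) (fun i _ => by ring)
  have h0 : 0 ≤ ∑ i ∈ s, ω i := Finset.sum_nonneg hω
  calc _ = ((∑ i ∈ s, ω i * x i) ^ 2) ^ 2 := by ring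
    _ ≤ ((∑ i ∈ s, ω i) * ∑ i ∈ s, ω i * x i ^ 2) ^ 2 := by gcongr
    _ = (∑ i ∈ s, ω i) ^ 2 * (∑ i ∈ s, ω i * x i ^ 2) ^ 2 := by ring
    _ ≤ (∑ i ∈ s, ω i) ^ 2 * ((∑ i ∈ s, ω i) * ∑ i ∈ s, ω i * x i ^ 4) := by gcongr
    _ = _ := by ring

lemma Iosc_stat {α a0 b0 t y : ℝ} {w : ℝ → ℝ} (hα : 1 < α) (ht : 0 < t) (hy : 0 < y) :
    Iosc α a0 b0 w t y = e (-((α - 1) * (y / α) ^ (1 + 1 / (α - 1)) * t ^ (-(1 / (α - 1))))) *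
      ampl α a0 b0 w t ((y / (α * t)) ^ (1 / (α - 1))) := by
  unfold Iosc ampl
  rw [← intervalIntegral.integral_const_mul]
  congr 1; ext v
  rw [mul_left_comm, ← e_add]
  congr 2
  unfold psi
  have hα0 : 0 < α := by linarith
  have hα1 : α - 1 ≠ 0 := by linarith
  have hq : 0 < y / (α * t) := by positivity
  have h1 : ((y / (α * t)) ^ (1 / (α - 1))) ^ (α - 1) = y / (α * t) := by
    rw [← Real.rpow_mul hq.le, one_div, inv_mul_cancel₀ hα1, Real.rpow_one]
  set v0 := (y / (α * t)) ^ (1 / (α - 1)) with hv0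
  have hv0p : 0 < v0 := by positivity
  have h2 : v0 ^ α = y / (α * t) * v0 := by
    rw [← h1, ← Real.rpow_add_one hv0p.ne']; ring_nf
  have h3 : (y / α) ^ (1 + 1 / (α - 1)) * t ^ (-(1 / (α - 1))) = y / α * v0 := by
    rw [Real.rpow_add (by positivity), Real.rpow_one, mul_assoc, hv0,
      show y / (α * t) = (y / α) * t⁻¹ by field_simp, Real.mul_rpow (by positivity) (by positivity), Real.inv_rpow ht.le, Real.rpow_neg ht.le]
  rw [mul_assoc, h3, h1, h2]
  field_simp
  ring

lemma statB (θ : ℝ) (hθ : 0 ≤ θ) (hP : PP θ) (α p1 R : ℝ) (hα : 1 < α) (hp1 : 0 < p1) (hR : 1 ≤ R) :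
    ∃ C > 0, ∀ σ ∈ Set.Icc (0 : ℝ) 1, ∀ M ≥ 1, ∀ T ≥ 1, ∀ s : Finset ℕ,
    (∀ j ∈ s, p1 * T / M ≤ j + σ ∧ j + σ ≤ R * (p1 * T / M)) → ∀ a : ℕ → ℂ, (∀ j ∈ s, ‖a j‖ ≤ 1) →
    ∫ t in T..2*T, ‖∑ j ∈ s, a j * e (-((α - 1) * ((j + σ) * M / α) ^ (1 + 1 / (α - 1)) * t ^ (-(1 / (α - 1)))))‖ ^ 4
      ≤ C * ((1 + T / M) ^ θ * (T * (T / M) ^ 2 + (T / M) ^ 4) + T) := by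
  set γ := 1 / (α - 1) with hγ
  have hα0 : 0 < α := by linarith
  have hγp : 0 < γ := by rw [hγ]; have : 0 < α - 1 := by linarith
                         positivity
  set κ := (α - 1) * (p1 / α) ^ (1 + γ) with hκ
  have hκp : 0 < κ := by have : 0 < α - 1 := by linarith
                         positivity
  obtain ⟨C1, hC1, hcov⟩ := cov γ κ hγp hκp
  obtain ⟨B, hB, hPB⟩ := hP (1 + γ) (by linarith) R hR
  refine ⟨C1 * B * p1 ^ θ * (κ * p1 ^ 2 + p1 ^ 4) + (R + 1) ^ 4, by positivity, fun σ hσ M hM T hT s hs a ha => ?_⟩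
  have hM0 : 0 < M := by linarith
  have hT0 : 0 < T := by linarith
  set L := p1 * T / M with hL
  have hLp : 0 < L := by positivity
  have hTT : T ≤ 2 * T := by linarith
  rcases le_or_gt 1 L with h1 | h1
  · set G : ℝ → ℝ := fun t => ‖∑ j ∈ s, a j * e (t * ((j + σ) / L) ^ (1 + γ))‖ ^ 4 with hG
    have hGc : Continuous G := by
      refine (continuous_finsetSum _ fun j _ => continuous_const.mul (e_continuous.comp (by fun_prop))).norm.pow 4
    have hphase : ∀ t : ℝ, ∀ j ∈ s, (-((α - 1) * ((j + σ) * M / α) ^ (1 + γ) * t ^ (-γ)))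
        = -(κ * T ^ (1 + γ) * t ^ (-γ)) * ((j + σ) / L) ^ (1 + γ) := by
      intro t j hj
      have h2 : 0 < (j : ℝ) + σ := hLp.trans_le (hs j hj).1
      rw [show ((j : ℝ) + σ) * M / α = p1 / α * T * ((j + σ) / L) by rw [hL]; field_simp,
        Real.mul_rpow (by positivity) (by positivity), Real.mul_rpow (by positivity) (by positivity), hκ]
      ring
    have e1 : ∫ t in T..2*T, ‖∑ j ∈ s, a j * e (-((α - 1) * ((j + σ) * M / α) ^ (1 + γ) * t ^ (-γ)))‖ ^ 4
        = ∫ t in T..2*T, G (-(κ * T ^ (1 + γ) * t ^ (-γ))) := by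
      refine intervalIntegral.integral_congr fun t _ => ?_
      simp only [hG]
      congr 2
      exact Finset.sum_congr rfl fun j hj => by rw [hphase t j hj]
    rw [e1]
    have hk : 0 < κ * T := by positivity
    refine (hcov T hT0 G hGc (fun t => by positivity) (L4_integrable s _ a _ hk)).trans ?_
    have h3 := (L4_le s (fun j => ((j + σ) / L) ^ (1 + γ)) a ha (κ * T) hk).trans (hPB σ hσ L h1 s hs (κ * T) hk)
    have hLθ : L ^ θ ≤ p1 ^ θ * (1 + T / M) ^ θ := by
      rw [← Real.mul_rpow (by positivity) (by positivity), hL, mul_div_assoc]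
      gcongr
      linarith
    calc _ ≤ C1 * (B * L ^ θ * (κ * T * L ^ 2 + L ^ 4)) := by gcongr
      _ ≤ C1 * (B * (p1 ^ θ * (1 + T / M) ^ θ) * (κ * T * L ^ 2 + L ^ 4)) := by gcongr
      _ = C1 * B * p1 ^ θ * ((1 + T / M) ^ θ * (κ * p1 ^ 2 * (T * (T / M) ^ 2) + p1 ^ 4 * (T / M) ^ 4)) := by
          rw [hL]; ring
      _ ≤ C1 * B * p1 ^ θ * ((1 + T / M) ^ θ * ((κ * p1 ^ 2 + p1 ^ 4) * (T * (T / M) ^ 2) + (κ * p1 ^ 2 + p1 ^ 4) * (T / M) ^ 4)) := by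
          gcongr
          · have : 0 < p1 ^ 4 := by positivity
            linarith
          · have : 0 < κ * p1 ^ 2 := by positivity
            linarith
      _ = C1 * B * p1 ^ θ * (κ * p1 ^ 2 + p1 ^ 4) * ((1 + T / M) ^ θ * (T * (T / M) ^ 2 + (T / M) ^ 4)) := by ring
      _ ≤ _ := by
          refine mul_le_mul ?_ ?_ (by positivity) (by positivity)
          · have : 0 ≤ (R + 1) ^ 4 := by positivity
            linarith
          · linarith
  · have hcard : (s.card : ℝ) ≤ R + 1 := by
      have hsub : s ⊆ Finset.range (⌊R⌋₊ + 1) := by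
        intro j hj
        rw [Finset.mem_range, Nat.lt_succ_iff]
        apply Nat.le_floor
        have := (hs j hj).2
        nlinarith [hσ.1]
      have := Finset.card_le_card hsub
      rw [Finset.card_range] at this
      have h2 : (s.card : ℝ) ≤ (⌊R⌋₊ : ℝ) + 1 := by exact_mod_cast this
      linarith [Nat.floor_le (by linarith : 0 ≤ R)]
    have hb : ∀ t ∈ Set.uIoc T (2 * T), ‖‖∑ j ∈ s, a j * e (-((α - 1) * ((j + σ) * M / α) ^ (1 + γ) * t ^ (-γ)))‖ ^ 4‖ ≤ (R + 1) ^ 4 := by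
      intro t _
      rw [norm_pow, norm_norm]
      gcongr
      refine (norm_sum_le_of_le s (f := fun j => a j * e (-((α - 1) * ((j + σ) * M / α) ^ (1 + γ) * t ^ (-γ)))) (n := fun _ => 1) (fun j hj => ?_)).trans ?_
      · rw [norm_mul, e_norm, mul_one]; exact ha j hj
      · rw [Finset.sum_const, nsmul_eq_mul, mul_one]; exact hcard
    have := intervalIntegral.norm_integral_le_of_norm_le_const hb
    refine (Real.le_norm_self _).trans (this.trans ?_)
    rw [show 2 * T - T = T by ring, abs_of_pos hT0]
    refine mul_le_mul ?_ ?_ (by positivity) (by positivity)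
    · have : 0 ≤ C1 * B * p1 ^ θ * (κ * p1 ^ 2 + p1 ^ 4) := by positivity
      linarith
    · have : 0 ≤ (1 + T / M) ^ θ * (T * (T / M) ^ 2 + (T / M) ^ 4) := by positivity
      linarith

set_option maxHeartbeats 3200000 in
lemma core (θ : ℝ) (hθ : 0 ≤ θ) (hP : PP θ) (α : ℝ) (hα : 1 < α) (w : ℝ → ℝ) (hw : ContDiff ℝ 2 w) (a0 b0 : ℝ) (ha0 : 0 < a0)
    (hab : a0 ≤ b0) (hs : tsupport w ⊆ Set.Ioo a0 b0) :
    ∃ C > 0, ∀ σ ∈ Set.Icc (0 : ℝ) 1, ∀ ξ ∈ Set.Icc (0 : ℝ) 1, ∀ M ≥ 1, ∀ T ≥ 1,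
      ∫ t in T..2*T, ‖Ssum α w M σ ξ t‖ ^ 4 ≤ C * ((T ^ 2 + M ^ 2 * T) * (1 + T / M) ^ θ + M ^ 4 / T) := by
  have hα1 : 0 < α - 1 := by linarith
  have hα0 : 0 < α := by linarith
  have hb0 : 0 < b0 := by linarith
  set p1 := α * a0 ^ (α - 1) / 2 with hp1
  set p2 := α * b0 ^ (α - 1) * 2 with hp2
  have hq1 : 0 < α * a0 ^ (α - 1) := by positivity
  have hq2 : 0 < α * b0 ^ (α - 1) := by positivity
  have hp1p : 0 < p1 := by positivity
  have hp2p : 0 < p2 := by positivity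
  have hp12 : p1 ≤ p2 := by
    have : α * a0 ^ (α - 1) ≤ α * b0 ^ (α - 1) := by gcongr
    rw [hp1, hp2]; linarith
  set R := 2 * p2 / p1 with hR
  have hR1 : 1 ≤ R := by rw [hR, le_div_iff₀ hp1p]; linarith
  set γ := 1 / (α - 1) with hγ
  have hγp : 0 < γ := by positivity
  set A0 := (p1 / (2 * α)) ^ γ with hA0
  set B0 := (2 * p2 / α) ^ γ with hB0
  obtain ⟨C1, hC1, hpo⟩ := poissonS α hα w hw a0 b0 p1 p2 ha0 hab hs hp1p (by rw [hp1]; linarith) (by rw [hp2]; linarith)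
  obtain ⟨C2, hC2, hst⟩ := statB θ hθ hP α p1 R hα hp1p hR1
  obtain ⟨C3, hC3, ham1, ham2⟩ := amp_bounds α hα w hw a0 b0 A0 B0 ha0 hab hs (by positivity)
  have hB0p : 0 < B0 := by positivity
  refine ⟨8 * (C3 ^ 4 * (1 + B0) ^ 4 * C2) + 64 * C1 ^ 4, by positivity, fun σ hσ ξ hξ M hM T hT => ?_⟩
  have hM0 : 0 < M := by linarith
  have hT0 : 0 < T := by linarith
  have hTT : T ≤ 2 * T := by linarith
  set L := p1 * T / M with hL
  have hLp : 0 < L := by positivity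
  set J0 := ⌈L - (1 - ξ)⌉₊ with hJ0
  set J1 := ⌊R * L - (1 - ξ) + 1⌋₊ with hJ1
  have hRL : 0 ≤ R * L - (1 - ξ) + 1 := by have : 0 < R * L := by positivity
                                           linarith [hξ.1]
  set σ' := 1 - ξ with hσ'
  have hσ'm : σ' ∈ Set.Icc (0 : ℝ) 1 := ⟨by linarith [hξ.2], by linarith [hξ.1]⟩
  have hmem : ∀ j : ℕ, j ∈ Finset.Ico J0 J1 ↔ L ≤ j + σ' ∧ j + σ' ≤ R * L := by
    intro j
    rw [Finset.mem_Ico, hJ0, Nat.ceil_le, hJ1, ← Nat.add_one_le_iff, Nat.le_floor_iff hRL]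
    push_cast
    constructor
    · rintro ⟨h1, h2⟩; exact ⟨by linarith, by linarith⟩
    · rintro ⟨h1, h2⟩; exact ⟨by linarith, by linarith⟩
  set n := J1 - J0 with hn
  have hmem' : ∀ i < n, L ≤ ((J0 + i : ℕ) : ℝ) + σ' ∧ ((J0 + i : ℕ) : ℝ) + σ' ≤ R * L := by
    intro i hi
    rw [← hmem, Finset.mem_Ico]; omega
  set v : ℝ → ℕ → ℝ := fun t i => ((((J0 + i : ℕ) : ℝ) + σ') * M / (α * t)) ^ γ with hv
  set bb : ℕ → ℝ → ℂ := fun j t => e (((j : ℝ) + 1) * σ) * e (-((α - 1) * ((j + σ') * M / α) ^ (1 + γ) * t ^ (-γ))) with hbb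
  set BB : ℕ → ℝ → ℂ := fun i t => ∑ j ∈ Finset.range (i + 1), bb (J0 + j) t with hBB
  have hvm : ∀ t ∈ Set.Icc T (2 * T), ∀ i < n, v t i ∈ Set.Icc A0 B0 := by
    intro t ht i hi
    obtain ⟨h1, h2⟩ := hmem' i hi
    have ht0 : 0 < t := hT0.trans_le ht.1
    have h3 : 0 < ((J0 + i : ℕ) : ℝ) + σ' := hLp.trans_le h1
    constructor
    · simp only [hv, hA0]
      apply Real.rpow_le_rpow (by positivity) _ hγp.le
      rw [div_le_div_iff₀ (by positivity) (by positivity)]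
      have h4 : p1 * T ≤ (((J0 + i : ℕ) : ℝ) + σ') * M := by
        rw [← div_le_iff₀ hM0]; exact h1
      have := ht.2
      nlinarith [mul_le_mul_of_nonneg_left ht.2 hp1p.le]
    · simp only [hv, hB0]
      apply Real.rpow_le_rpow (by positivity) _ hγp.le
      rw [div_le_div_iff₀ (by positivity) (by positivity)]
      have h4 : (((J0 + i : ℕ) : ℝ) + σ') * M ≤ 2 * p2 * T := by
        calc _ ≤ R * L * M := by gcongr
          _ = _ := by rw [hR, hL]; field_simp
      have := mul_le_mul_of_nonneg_left ht.1 hp2p.le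
      nlinarith
  set ω : ℕ → ℝ := fun i => v T (i + 1) - v T i with hω
  have hvmono : ∀ t, 0 < t → ∀ i, v t i ≤ v t (i + 1) := by
    intro t ht i
    simp only [hv]
    have := hσ'm.1
    apply Real.rpow_le_rpow (by positivity) _ hγp.le
    gcongr
    omega
  have hω0 : ∀ i, 0 ≤ ω i := fun i => by have := hvmono T hT0 i; simp only [hω]; linarith
  have hvscale : ∀ t ∈ Set.Icc T (2 * T), ∀ i, |v t (i + 1) - v t i| ≤ ω i := by
    intro t ht i
    have ht0 : 0 < t := hT0.trans_le ht.1
    have hsc : ∀ i, v t i = (T / t) ^ γ * v T i := by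
      intro i
      simp only [hv]
      have := hσ'm.1
      rw [← Real.mul_rpow (by positivity) (by positivity)]
      congr 1; field_simp
    have h1 : (T / t) ^ γ ≤ 1 := Real.rpow_le_one (by positivity) (by rw [div_le_one ht0]; exact ht.1) hγp.le
    rw [abs_of_nonneg (by linarith [hvmono t ht0 i]), hsc, hsc, ← mul_sub]
    have := hω0 i
    simp only [hω] at this ⊢
    nlinarith
  set ω' : ℕ → ℝ := fun i => if i + 1 < n then ω i else 1 with hω'
  have hω'0 : ∀ i ∈ Finset.range n, 0 ≤ ω' i := fun i _ => by
    simp only [hω']; split_ifs; exacts [hω0 i, zero_le_one]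
  have hω's : ∑ i ∈ Finset.range n, ω' i ≤ 1 + B0 := by
    rcases Nat.eq_zero_or_pos n with h | h
    · rw [h]; simp; linarith
    obtain ⟨m, hm⟩ : ∃ m, n = m + 1 := ⟨n - 1, by omega⟩
    rw [hm, Finset.sum_range_succ]
    have h1 : ω' m = 1 := by simp only [hω']; rw [if_neg (by omega)]
    have h2 : ∑ i ∈ Finset.range m, ω' i = v T m - v T 0 := by
      rw [← Finset.sum_range_sub]
      refine Finset.sum_congr rfl fun i hi => ?_
      rw [Finset.mem_range] at hi
      simp only [hω']; rw [if_pos (by omega)]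
    have h3 := (hvm T ⟨le_refl _, hTT⟩ m (by omega)).2
    have h4 : 0 ≤ v T 0 := by simp only [hv]; have := hσ'm.1; positivity
    rw [h1, h2]; linarith
  have hpt : ∀ t ∈ Set.Icc T (2 * T), ‖Ssum α w M σ ξ t‖ ≤
      M * (C3 * T ^ (-(1 / 2) : ℝ)) * ∑ i ∈ Finset.range n, ω' i * ‖BB i t‖ + C1 * (M / T ^ 2 + 1 / M) := by
    intro t ht
    have ht0 : 0 < t := hT0.trans_le ht.1
    have h1 := hpo M hM0 t ht0 σ ξ hξ ((Finset.Ico J0 J1).image (fun j : ℕ => (j : ℤ) + 1)) (by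
      intro k hk1 hk2
      have hkL : L ≤ k - ξ := by
        rw [hL, div_le_iff₀ hM0]
        refine le_trans ?_ hk1
        have := ht.1
        gcongr
      have hkR : k - ξ ≤ R * L := by
        rw [show R * L = 2 * p2 * T / M by rw [hR, hL]; field_simp, le_div_iff₀ hM0]
        refine hk2.trans ?_
        have := mul_le_mul_of_nonneg_left ht.2 hp2p.le
        linarith
      have hk0 : 0 < k := by
        have : (0 : ℝ) < k := by linarith [hξ.1]
        exact_mod_cast this
      rw [Finset.mem_image]
      refine ⟨(k - 1).toNat, ?_, by omega⟩
      rw [hmem]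
      have : (((k - 1).toNat : ℕ) : ℝ) = k - 1 := by
        have h : (((k - 1).toNat : ℕ) : ℤ) = k - 1 := by omega
        exact_mod_cast congrArg (Int.cast (R := ℝ)) h
      rw [this, hσ']
      exact ⟨by linarith, by linarith⟩)
    rw [Finset.sum_image (fun a _ b _ h => by simpa using h), Finset.sum_Ico_eq_sum_range, ← hn] at h1
    have h2 : ∑ i ∈ Finset.range n, (M : ℂ) * Iosc α a0 b0 w t (((((J0 + i : ℕ) : ℤ) + 1 : ℤ) - ξ) * M) * e (((((J0 + i : ℕ) : ℤ) + 1 : ℤ) : ℝ) * σ)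
        = M * ∑ i ∈ Finset.range n, ampl α a0 b0 w t (v t i) * bb (J0 + i) t := by
      rw [Finset.mul_sum]
      refine Finset.sum_congr rfl fun i hi => ?_
      rw [Finset.mem_range] at hi
      have h3 : 0 < ((J0 + i : ℕ) : ℝ) + σ' := hLp.trans_le (hmem' i hi).1
      have h4 : (((((J0 + i : ℕ) : ℤ) + 1 : ℤ) : ℝ) - ξ) = ((J0 + i : ℕ) : ℝ) + σ' := by
        rw [hσ']; push_cast; ring
      rw [h4, Iosc_stat hα ht0 (by positivity)]
      simp only [hbb, hv]
      push_cast
      ring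
    rw [h2] at h1
    have h5 := abel_norm n (fun i => ampl α a0 b0 w t (v t i)) (fun i => bb (J0 + i) t) (C3 * T ^ (-(1 / 2) : ℝ)) ω
      (fun i hi => (ham1 t (hT.trans ht.1) _ (hvm t ht i hi)).trans 
        (mul_le_mul_of_nonneg_left (Real.rpow_le_rpow_of_nonpos hT0 ht.1 (by norm_num : (-(1 / 2) : ℝ) ≤ 0)) hC3.le))
      (fun i hi => (ham2 t (hT.trans ht.1) _ (hvm t ht _ hi) _ (hvm t ht i (by omega))).trans (by
        have := Real.rpow_le_rpow_of_nonpos hT0 ht.1 (by norm_num : (-(1 / 2) : ℝ) ≤ 0)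
        have := hvscale t ht i
        gcongr))
    have h6 : M / t ^ 2 + 1 / M ≤ M / T ^ 2 + 1 / M := by
      have := ht.1
      gcongr
    calc _ ≤ ‖M * ∑ i ∈ Finset.range n, ampl α a0 b0 w t (v t i) * bb (J0 + i) t‖ + C1 * (M / t ^ 2 + 1 / M) := by
          have := norm_le_norm_add_norm_sub (M * ∑ i ∈ Finset.range n, ampl α a0 b0 w t (v t i) * bb (J0 + i) t) (Ssum α w M σ ξ t)
          rw [norm_sub_rev] at this
          linarith
      _ ≤ _ := by
          rw [norm_mul, Complex.norm_real, Real.norm_eq_abs, abs_of_pos hM0, mul_assoc]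
          gcongr
  have hBint : ∀ i < n, ∫ t in T..2*T, ‖BB i t‖ ^ 4 ≤ C2 * ((1 + T / M) ^ θ * (T * (T / M) ^ 2 + (T / M) ^ 4) + T) := by
    intro i hi
    have := hst σ' hσ'm M hM T hT ((Finset.range (i + 1)).image (fun j => J0 + j)) (by
      intro j hj
      rw [Finset.mem_image] at hj
      obtain ⟨k, hk, rfl⟩ := hj
      rw [Finset.mem_range] at hk
      exact hmem' k (by omega)) (fun j => e (((j : ℝ) + 1) * σ)) (fun j _ => (e_norm _).le)
    have e1 : ∀ t, BB i t = ∑ j ∈ (Finset.range (i + 1)).image (fun j => J0 + j), e (((j : ℝ) + 1) * σ) * e (-((α - 1) * ((j + σ') * M / α) ^ (1 + γ) * t ^ (-γ))) := by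
      intro t
      rw [Finset.sum_image (fun a _ b _ h => by simpa using h)]
    simp_rw [e1]
    exact this
  have hBc : ∀ i, ContinuousOn (fun t => ‖BB i t‖ ^ 4) (Set.Icc T (2 * T)) := by
    intro i
    refine (ContinuousOn.norm ?_).pow 4
    simp only [hBB, hbb]
    refine continuousOn_finsetSum _ fun j _ => continuousOn_const.mul (e_continuous.comp_continuousOn ?_)
    refine (continuousOn_const.mul ?_).neg
    exact ContinuousOn.rpow_const (by fun_prop) fun p hp => Or.inl (ne_of_gt (hT0.trans_le hp.1))
  set E := C1 * (M / T ^ 2 + 1 / M) with hE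
  have hpt4 : ∀ t ∈ Set.Icc T (2 * T), ‖Ssum α w M σ ξ t‖ ^ 4 ≤
      8 * (M ^ 4 * C3 ^ 4 / T ^ 2 * (1 + B0) ^ 3) * ∑ i ∈ Finset.range n, ω' i * ‖BB i t‖ ^ 4 + 8 * E ^ 4 := by
    intro t ht
    have h1 : (M * (C3 * T ^ (-(1 / 2) : ℝ)) * ∑ i ∈ Finset.range n, ω' i * ‖BB i t‖) ^ 4 ≤
        (M ^ 4 * C3 ^ 4 / T ^ 2 * (1 + B0) ^ 3) * ∑ i ∈ Finset.range n, ω' i * ‖BB i t‖ ^ 4 := by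
      have h2 : (T ^ (-(1 / 2) : ℝ)) ^ 4 = 1 / T ^ 2 := by
        rw [← Real.rpow_natCast, ← Real.rpow_mul hT0.le, show (-(1 / 2) : ℝ) * ((4 : ℕ) : ℝ) = -((2 : ℕ) : ℝ) by norm_num,
          Real.rpow_neg hT0.le, Real.rpow_natCast, one_div]
      have h3 := holder4 (Finset.range n) ω' (fun i => ‖BB i t‖) hω'0
      have h4 : (∑ i ∈ Finset.range n, ω' i) ^ 3 ≤ (1 + B0) ^ 3 := by
        have := Finset.sum_nonneg hω'0
        gcongr
      have h5 : 0 ≤ ∑ i ∈ Finset.range n, ω' i * ‖BB i t‖ ^ 4 := Finset.sum_nonneg fun i hi => mul_nonneg (hω'0 i hi) (by positivity)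
      calc _ = M ^ 4 * C3 ^ 4 * (T ^ (-(1 / 2) : ℝ)) ^ 4 * (∑ i ∈ Finset.range n, ω' i * ‖BB i t‖) ^ 4 := by ring
        _ ≤ M ^ 4 * C3 ^ 4 * (1 / T ^ 2) * ((1 + B0) ^ 3 * ∑ i ∈ Finset.range n, ω' i * ‖BB i t‖ ^ 4) := by
            rw [h2]
            have := h3.trans (mul_le_mul_of_nonneg_right h4 h5)
            gcongr
        _ = _ := by ring
    have h2 := hpt t ht
    set x := M * (C3 * T ^ (-(1 / 2) : ℝ)) * ∑ i ∈ Finset.range n, ω' i * ‖BB i t‖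
    calc _ ≤ (x + E) ^ 4 := by gcongr
      _ ≤ 8 * x ^ 4 + 8 * E ^ 4 := by
          nlinarith [sq_nonneg (x - E), sq_nonneg (x + E), sq_nonneg (x ^ 2 - E ^ 2), mul_self_nonneg (x * (x - E)), mul_self_nonneg (E * (x - E)), sq_nonneg ((x-E)^2)]
      _ ≤ _ := by linarith
  have hSc := Ssum_cont (α := α) (ξ := ξ) hM0 ha0 hs hσ
  have hint : ∫ t in T..2*T, ‖Ssum α w M σ ξ t‖ ^ 4 ≤ ∫ t in T..2*T, (8 * (M ^ 4 * C3 ^ 4 / T ^ 2 * (1 + B0) ^ 3) * ∑ i ∈ Finset.range n, ω' i * ‖BB i t‖ ^ 4 + 8 * E ^ 4) := by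
    refine intervalIntegral.integral_mono_on hTT ((hSc.norm.pow 4).intervalIntegrable _ _) ?_ hpt4
    refine ContinuousOn.intervalIntegrable_of_Icc hTT ?_
    exact (continuousOn_const.mul (continuousOn_finsetSum _ fun i _ => continuousOn_const.mul (hBc i))).add continuousOn_const
  refine hint.trans ?_
  have hBi : ∀ i, IntervalIntegrable (fun t => ‖BB i t‖ ^ 4) volume T (2 * T) := fun i => (hBc i).intervalIntegrable_of_Icc hTT
  rw [intervalIntegral.integral_add, intervalIntegral.integral_const_mul, intervalIntegral.integral_finsetSum, intervalIntegral.integral_const]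
  rotate_left
  · exact fun i _ => (hBi i).const_mul _
  · exact (ContinuousOn.intervalIntegrable_of_Icc hTT (continuousOn_const.mul (continuousOn_finsetSum _ fun i _ => continuousOn_const.mul (hBc i))))
  · exact intervalIntegrable_const
  set D := (1 + T / M) ^ θ * (T * (T / M) ^ 2 + (T / M) ^ 4) + T with hD
  have hD0 : 0 < D := by positivity
  have hsum : ∑ i ∈ Finset.range n, ∫ t in T..2*T, ω' i * ‖BB i t‖ ^ 4 ≤ (1 + B0) * (C2 * D) := by
    calc _ ≤ ∑ i ∈ Finset.range n, ω' i * (C2 * D) := by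
          refine Finset.sum_le_sum fun i hi => ?_
          rw [intervalIntegral.integral_const_mul]
          exact mul_le_mul_of_nonneg_left (hBint i (Finset.mem_range.1 hi)) (hω'0 i hi)
      _ ≤ _ := by rw [← Finset.sum_mul]; gcongr
  have hE4 : (2 * T - T) * (8 * E ^ 4) ≤ 64 * C1 ^ 4 * (T ^ 2 + M ^ 4 / T) := by
    have h1 : (M / T ^ 2 + 1 / M) ^ 4 ≤ 8 * ((M / T ^ 2) ^ 4 + (1 / M) ^ 4) := by
      set x := M / T ^ 2
      set y := 1 / M
      nlinarith [sq_nonneg (x - y), sq_nonneg (x + y), sq_nonneg (x ^ 2 - y ^ 2), mul_self_nonneg (x * (x - y)), mul_self_nonneg (y * (x - y)), sq_nonneg ((x-y)^2)]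
    have h2 : T * (M / T ^ 2) ^ 4 ≤ M ^ 4 / T := by
      rw [div_pow, ← mul_div_assoc, div_le_div_iff₀ (by positivity) hT0]
      have : T ^ 2 ≤ (T ^ 2) ^ 4 := by
        rw [← pow_mul]; exact pow_le_pow_right₀ hT (by norm_num)
      calc _ = M ^ 4 * T ^ 2 := by ring
        _ ≤ _ := by gcongr
    have h3 : T * (1 / M) ^ 4 ≤ T ^ 2 := by
      have : (1 / M) ^ 4 ≤ 1 := pow_le_one₀ (by positivity) (by rw [div_le_one hM0]; exact hM)
      nlinarith
    calc _ = 8 * C1 ^ 4 * (T * (M / T ^ 2 + 1 / M) ^ 4) := by rw [hE]; ring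
      _ ≤ 8 * C1 ^ 4 * (T * (8 * ((M / T ^ 2) ^ 4 + (1 / M) ^ 4))) := by gcongr
      _ = 64 * C1 ^ 4 * (T * (1 / M) ^ 4 + T * (M / T ^ 2) ^ 4) := by ring
      _ ≤ _ := by gcongr
  have hY1 : 1 ≤ (1 + T / M) ^ θ := Real.one_le_rpow (by have : 0 < T / M := by positivity
                                                         linarith) hθ
  calc _ ≤ 8 * (M ^ 4 * C3 ^ 4 / T ^ 2 * (1 + B0) ^ 3) * ((1 + B0) * (C2 * D)) + 64 * C1 ^ 4 * (T ^ 2 + M ^ 4 / T) := by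
        rw [smul_eq_mul]
        gcongr
    _ = 8 * (C3 ^ 4 * (1 + B0) ^ 4 * C2) * ((T ^ 2 + M ^ 2 * T) * (1 + T / M) ^ θ + M ^ 4 / T) + 64 * C1 ^ 4 * (T ^ 2 + M ^ 4 / T) := by
        rw [hD]; field_simp; ring
    _ ≤ 8 * (C3 ^ 4 * (1 + B0) ^ 4 * C2) * ((T ^ 2 + M ^ 2 * T) * (1 + T / M) ^ θ + M ^ 4 / T) + 64 * C1 ^ 4 * ((T ^ 2 + M ^ 2 * T) * (1 + T / M) ^ θ + M ^ 4 / T) := by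
        gcongr
        have : 0 ≤ M ^ 2 * T := by positivity
        nlinarith
    _ = _ := by ring

noncomputable def bump (R v : ℝ) : ℝ := Real.smoothTransition (4 * v - 3) * Real.smoothTransition (2 * R + 1 - 2 * v)

lemma bump_contDiff (R : ℝ) : ContDiff ℝ 2 (bump R) := by
  unfold bump
  have h : ContDiff ℝ 2 Real.smoothTransition := Real.smoothTransition.contDiff (n := 2)
  exact (h.comp (by fun_prop : ContDiff ℝ 2 fun v : ℝ => 4 * v - 3)).mul (h.comp (by fun_prop : ContDiff ℝ 2 fun v : ℝ => 2 * R + 1 - 2 * v))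

lemma bump_supp (R : ℝ) : tsupport (bump R) ⊆ Set.Ioo (1 / 2) (R + 1) := by
  have : tsupport (bump R) ⊆ Set.Icc (3 / 4) (R + 1 / 2) := by
    refine closure_minimal ?_ isClosed_Icc
    intro v hv
    by_contra h
    apply hv
    rw [Set.mem_Icc, not_and_or] at h
    push Not at h
    unfold bump
    rcases h with h | h
    · rw [Real.smoothTransition.zero_of_nonpos (by linarith), zero_mul]
    · rw [Real.smoothTransition.zero_of_nonpos (x := 2 * R + 1 - 2 * v) (by linarith), mul_zero]
  exact this.trans fun v hv => ⟨by linarith [hv.1], by linarith [hv.2]⟩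

lemma bump_nonneg (R v : ℝ) : 0 ≤ bump R v := mul_nonneg (Real.smoothTransition.nonneg _) (Real.smoothTransition.nonneg _)

lemma bump_le_one (R v : ℝ) : bump R v ≤ 1 :=
  mul_le_one₀ (Real.smoothTransition.le_one _) (Real.smoothTransition.nonneg _) (Real.smoothTransition.le_one _)

lemma bump_one {R v : ℝ} (h1 : 1 ≤ v) (h2 : v ≤ R) : bump R v = 1 := by
  unfold bump
  rw [Real.smoothTransition.one_of_one_le (by linarith), Real.smoothTransition.one_of_one_le (by linarith), one_mul]

lemma PP_of (θ : ℝ) (h : ∀ α : ℝ, 1 < α → ∀ R : ℝ, 1 ≤ R → ∃ B > 0, ∀ σ ∈ Set.Icc (0 : ℝ) 1, ∀ M : ℝ, 1 ≤ M → ∀ s : Finset ℕ,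
  (∀ k ∈ s, M ≤ k + σ ∧ k + σ ≤ R * M) → M ^ 2 * Q4 s (fun k => ((k + σ) / M) ^ α) (M ^ 2) ≤ B * M ^ θ * M ^ 4) : PP θ := by
  intro α hα R hR
  obtain ⟨B, hB, hB'⟩ := h α hα R hR
  refine ⟨B, hB, fun σ hσ M hM s hs T hT => ?_⟩
  have h1 := hB' σ hσ M hM s hs
  have hM0 : 0 < M := by linarith
  have hMθ : 0 < M ^ θ := by positivity
  rcases le_total T (M ^ 2) with h2 | h2
  · refine (TQ2_mono _ _ hT h2).trans (h1.trans ?_)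
    have : 0 ≤ B * M ^ θ * (T * M ^ 2) := by positivity
    rw [mul_add]; linarith
  · have h3 := Q2_anti (s ×ˢ s) (fun p => ((p.1 + σ) / M) ^ α + ((p.2 + σ) / M) ^ α) (by positivity) h2
    have h4 : Q4 s (fun k => ((k + σ) / M) ^ α) (M ^ 2) ≤ B * M ^ θ * M ^ 2 := by
      have : 0 < M ^ 2 := by positivity
      refine le_of_mul_le_mul_left (h1.trans (le_of_eq (by ring))) this
    calc T * Q4 s (fun k => ((k + σ) / M) ^ α) T ≤ T * (B * M ^ θ * M ^ 2) := by
          gcongr; exact h3.trans h4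
      _ ≤ _ := by
          have : 0 ≤ B * M ^ θ * M ^ 4 := by positivity
          nlinarith

lemma PP_two : PP 2 := by
  refine PP_of 2 fun α hα R hR => ⟨(R + 1) ^ 4, by positivity, fun σ hσ M hM s hs => ?_⟩
  have hcard : (s.card : ℝ) ≤ (R + 1) * M := by
    have hsub : s ⊆ Finset.range (⌊R * M⌋₊ + 1) := by
      intro j hj
      rw [Finset.mem_range, Nat.lt_succ_iff]
      apply Nat.le_floor
      have := (hs j hj).2
      linarith [hσ.1]
    have := Finset.card_le_card hsub
    rw [Finset.card_range] at this
    have h2 : (s.card : ℝ) ≤ (⌊R * M⌋₊ : ℝ) + 1 := by exact_mod_cast this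
    have := Nat.floor_le (by positivity : 0 ≤ R * M)
    nlinarith
  have hq : Q4 s (fun k => ((k + σ) / M) ^ α) (M ^ 2) ≤ (s.card : ℝ) ^ 4 := by
    unfold Q4 Q2
    refine (Finset.sum_le_sum fun i _ => Finset.sum_le_sum fun j _ => (Real.exp_le_one_iff.2 ?_ : _ ≤ (1 : ℝ))).trans ?_
    · have : 0 ≤ Real.pi * (M ^ 2) ^ 2 * (((i.1 : ℝ) + σ) / M) ^ α := by have := hσ.1; positivity
      rw [neg_mul, neg_mul, Left.neg_nonpos_iff]; positivity
    · simp only [Finset.sum_const, Finset.card_product, nsmul_eq_mul]; push_cast; apply le_of_eq; ring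
  have hM0 : 0 < M := by linarith
  calc _ ≤ M ^ 2 * ((R + 1) * M) ^ 4 := by
        have : (s.card : ℝ) ^ 4 ≤ ((R + 1) * M) ^ 4 := by gcongr
        have := hq.trans this
        gcongr
    _ = _ := by rw [Real.rpow_two]; ring

lemma exp_poly {u : ℝ} (hu : 0 ≤ u) : (u + u ^ 2) * (1 + u) ^ 2 * Real.exp (-Real.pi * u ^ 2) ≤
    448 * (2 * u / (1 + 2 * u) - u / (1 + u)) := by
  have h1 : Real.exp (-Real.pi * u ^ 2) ≤ (Real.exp (u ^ 2))⁻¹ := by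
    rw [← Real.exp_neg, Real.exp_le_exp]
    have := Real.pi_gt_three
    nlinarith [sq_nonneg u]
  have h2 : 1 + u ^ 6 / 6 ≤ Real.exp (u ^ 2) := by
    have := Real.sum_le_exp_of_nonneg (sq_nonneg u) 4
    simp only [Finset.sum_range_succ, Finset.sum_range_zero, Nat.factorial] at this
    norm_num at this
    nlinarith [sq_nonneg u, sq_nonneg (u ^ 2)]
  have h3 : (1 + u) ^ 4 * (1 + 2 * u) ≤ 448 * Real.exp (u ^ 2) := by
    refine le_trans ?_ (mul_le_mul_of_nonneg_left h2 (by norm_num))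
    have h5 : (1 + u) ^ 4 * (1 + 2 * u) ≤ 64 * (1 + u ^ 6) := by
      rcases le_total u 1 with h | h
      · have a : (1 + u) ^ 4 ≤ 2 ^ 4 := by gcongr; linarith
        have b : 0 ≤ u ^ 6 := by positivity
        nlinarith
      · have a : (1 + u) ^ 4 ≤ (2 * u) ^ 4 := by gcongr; linarith
        have b : u ^ 5 ≤ u ^ 6 := pow_le_pow_right₀ h (by norm_num)
        calc _ ≤ (2 * u) ^ 4 * (3 * u) := by gcongr; linarith
          _ = 48 * u ^ 5 := by ring
          _ ≤ _ := by nlinarith [pow_nonneg hu 5]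
    have : 0 ≤ u ^ 6 := by positivity
    linarith
  have h4 : (1 + u) ^ 4 * (1 + 2 * u) * Real.exp (-Real.pi * u ^ 2) ≤ 448 := by
    calc _ ≤ (1 + u) ^ 4 * (1 + 2 * u) * (Real.exp (u ^ 2))⁻¹ := by gcongr
      _ ≤ 448 := by rw [← div_eq_mul_inv, div_le_iff₀ (Real.exp_pos _)]; exact h3
  have h5 : 2 * u / (1 + 2 * u) - u / (1 + u) = u / ((1 + u) * (1 + 2 * u)) := by
    field_simp; ring
  rw [h5, ← mul_div_assoc, le_div_iff₀ (by positivity)]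
  calc _ = u * ((1 + u) ^ 4 * (1 + 2 * u) * Real.exp (-Real.pi * u ^ 2)) := by ring
    _ ≤ u * 448 := by gcongr
    _ = _ := by ring

set_option maxHeartbeats 1600000 in
lemma Pstep (θ ρ : ℝ) (hθ0 : 0 ≤ θ) (hθ2 : θ ≤ 2) (hρ0 : 0 < ρ) (hρ1 : ρ ≤ 1) (hθρ : θ * (1 - ρ) ≤ ρ) (hP : PP θ) : PP ρ := by
  refine PP_of ρ fun α hα R hR => ?_
  obtain ⟨C, hC, hcore⟩ := core θ hθ0 hP α hα (bump R) (bump_contDiff R) (1 / 2) (R + 1) (by norm_num) (by linarith) (bump_supp R)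
  refine ⟨2 * ((R + 2) ^ 4 + C * (448 + 2)), by positivity, fun σ hσ M hM s hs => ?_⟩
  have hM0 : 0 < M := by linarith
  set T := M ^ (2 - ρ) with hT
  have hTp : 0 < T := by positivity
  have hTM : T ≤ M ^ 2 := by
    rw [← Real.rpow_two]; exact Real.rpow_le_rpow_of_exponent_le hM (by linarith)
  have hMT : M ^ 2 = M ^ ρ * T := by
    rw [hT, ← Real.rpow_add hM0, ← Real.rpow_two]; congr 1; ring
  set N := ⌈(R + 1) * M⌉₊ with hN
  set f : ℝ → ℝ := fun t => Real.exp (-Real.pi * t ^ 2 / T ^ 2) * ‖Ssum α (bump R) M σ 0 t‖ ^ 4 with hf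
  have hSe : ∀ t, Ssum α (bump R) M σ 0 t = ∑ j ∈ Finset.range N, (bump R ((j + σ) / M) : ℂ) * e (t * ((j + σ) / M) ^ α) := by
    intro t
    rw [Ssum_fin hM0 (by norm_num) (bump_supp R) hσ N (Nat.le_ceil _)]
    refine Finset.sum_congr rfl fun j _ => ?_
    unfold fS
    rw [zero_mul, add_zero, add_comm σ]
  have hint : Integrable f := by
    simp only [hf, hSe]
    exact L4_integrable _ _ _ T hTp
  have hfc : Continuous f := by
    have := Ssum_cont (α := α) (ξ := 0) hM0 (by norm_num) (bump_supp R) hσ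
    simp only [hf]
    fun_prop
  have hge : T * Q4 s (fun k => ((k + σ) / M) ^ α) T ≤ ∫ t, f t := by
    simp only [hf, hSe]
    refine L4_ge (Finset.range N) s ?_ (fun k => ((k + σ) / M) ^ α) (fun k => bump R ((k + σ) / M)) (fun _ _ => bump_nonneg _ _) ?_ T hTp
    · intro k hk
      rw [Finset.mem_range, hN, Nat.lt_ceil]
      have := (hs k hk).2
      linarith [hσ.1]
    · intro k hk
      rw [bump_one]
      · rw [le_div_iff₀ hM0, one_mul]; exact (hs k hk).1
      · rw [div_le_iff₀ hM0]; exact (hs k hk).2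
  have heven : ∀ t, f (-t) = f t := by
    intro t
    simp only [hf]
    rw [neg_sq]
    congr 2
    rw [hSe, hSe, ← Complex.norm_conj, map_sum]
    congr 1
    refine Finset.sum_congr rfl fun j _ => ?_
    rw [map_mul, Complex.conj_ofReal, e_neg_conj]
    congr 2; ring
  have hf01 : ∫ t in (0:ℝ)..1, f t ≤ (R + 2) ^ 4 * M ^ 4 := by
    have hb : ∀ t ∈ Set.uIoc (0 : ℝ) 1, ‖f t‖ ≤ (R + 2) ^ 4 * M ^ 4 := by
      intro t _
      simp only [hf]
      have h1 : ‖Ssum α (bump R) M σ 0 t‖ ≤ (R + 2) * M := by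
        rw [hSe]
        refine (norm_sum_le_of_le _ (n := fun _ => 1) (fun j hj => ?_)).trans ?_
        · rw [norm_mul, e_norm, mul_one, Complex.norm_real, Real.norm_eq_abs, abs_of_nonneg (bump_nonneg _ _)]; exact bump_le_one _ _
        · rw [Finset.sum_const, nsmul_eq_mul, mul_one, Finset.card_range]
          have := Nat.ceil_lt_add_one (by positivity : 0 ≤ (R + 1) * M)
          linarith
      have h2 : Real.exp (-Real.pi * t ^ 2 / T ^ 2) ≤ 1 := by
        rw [Real.exp_le_one_iff, neg_mul, neg_div, Left.neg_nonpos_iff]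
        have := Real.pi_pos; positivity
      rw [Real.norm_eq_abs, abs_of_nonneg (by positivity), ← mul_pow]
      calc _ ≤ 1 * ((R + 2) * M) ^ 4 := by gcongr
        _ = _ := one_mul _
    have := intervalIntegral.norm_integral_le_of_norm_le_const hb
    rw [sub_zero, abs_one, mul_one] at this
    exact (Real.le_norm_self _).trans this
  have hdy : ∀ i : ℕ, ∫ t in (2 : ℝ) ^ i..(2 : ℝ) ^ (i + 1), f t ≤ C * M ^ 4 *
      (448 * (2 ^ (i + 1) / T / (1 + 2 ^ (i + 1) / T) - 2 ^ i / T / (1 + 2 ^ i / T)) + (-2 / 2 ^ (i + 1) - (-2 / 2 ^ i))) := by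
    intro i
    set T' : ℝ := 2 ^ i with hT'
    have hT'1 : 1 ≤ T' := one_le_pow₀ (by norm_num)
    have hT'0 : 0 < T' := by linarith
    rw [show (2 : ℝ) ^ (i + 1) = 2 * T' by rw [pow_succ]; ring]
    have hTT : T' ≤ 2 * T' := by linarith
    set u := T' / T with hu
    have hup : 0 < u := by positivity
    have h1 : ∫ t in T'..2*T', f t ≤ ∫ t in T'..2*T', Real.exp (-Real.pi * u ^ 2) * ‖Ssum α (bump R) M σ 0 t‖ ^ 4 := by
      refine intervalIntegral.integral_mono_on hTT (hfc.intervalIntegrable _ _) ?_ fun t ht => ?_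
      · exact (continuous_const.mul ((Ssum_cont (α := α) (ξ := 0) hM0 (by norm_num) (bump_supp R) hσ).norm.pow 4)).intervalIntegrable _ _
      · simp only [hf]
        gcongr
        rw [mul_div_assoc, ← div_pow, neg_mul, neg_mul, neg_le_neg_iff]
        have := ht.1
        gcongr
        rw [hu]; gcongr
    rw [intervalIntegral.integral_const_mul] at h1
    have h2 := hcore σ hσ 0 (by simp) M hM T' hT'1
    have h3 : (T' ^ 2 + M ^ 2 * T') * (1 + T' / M) ^ θ ≤ (u + u ^ 2) * (1 + u) ^ 2 * M ^ 4 := by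
      have a1 : T' = u * T := by rw [hu]; field_simp
      have a2 : T' / M = u * M ^ (1 - ρ) := by
        rw [a1, hT, mul_div_assoc, show (1 - ρ) = (2 - ρ) - 1 by ring, Real.rpow_sub_one hM0.ne']
      have hM1 : 1 ≤ M ^ (1 - ρ) := Real.one_le_rpow hM (by linarith)
      have a3 : (1 + T' / M) ^ θ ≤ (1 + u) ^ 2 * M ^ ρ := by
        calc _ ≤ ((1 + u) * M ^ (1 - ρ)) ^ θ := by
              rw [a2]; gcongr; nlinarith
          _ = (1 + u) ^ θ * M ^ (θ * (1 - ρ)) := by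
              rw [Real.mul_rpow (by positivity) (by positivity), ← Real.rpow_mul hM0.le, mul_comm θ]
          _ ≤ (1 + u) ^ (2 : ℝ) * M ^ ρ := by
              gcongr
              · linarith
          _ = _ := by rw [Real.rpow_two]
      have a4 : T * M ^ ρ = M ^ 2 := by rw [hMT, mul_comm]
      calc _ ≤ (T' ^ 2 + M ^ 2 * T') * ((1 + u) ^ 2 * M ^ ρ) := by gcongr
        _ = (u ^ 2 * T * (T * M ^ ρ) + M ^ 2 * u * (T * M ^ ρ)) * (1 + u) ^ 2 := by rw [a1]; ring
        _ ≤ (u ^ 2 * M ^ 2 * (T * M ^ ρ) + M ^ 2 * u * (T * M ^ ρ)) * (1 + u) ^ 2 := by gcongr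
        _ = _ := by rw [a4]; ring
    have h4 := exp_poly hup.le
    have h5 : Real.exp (-Real.pi * u ^ 2) ≤ 1 := by
      rw [Real.exp_le_one_iff, neg_mul, Left.neg_nonpos_iff]
      have := Real.pi_pos; positivity
    calc _ ≤ Real.exp (-Real.pi * u ^ 2) * (C * ((T' ^ 2 + M ^ 2 * T') * (1 + T' / M) ^ θ + M ^ 4 / T')) := by
          refine h1.trans ?_; gcongr
      _ ≤ Real.exp (-Real.pi * u ^ 2) * (C * ((u + u ^ 2) * (1 + u) ^ 2 * M ^ 4 + M ^ 4 / T')) := by gcongr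
      _ = C * M ^ 4 * ((u + u ^ 2) * (1 + u) ^ 2 * Real.exp (-Real.pi * u ^ 2) + Real.exp (-Real.pi * u ^ 2) * (1 / T')) := by ring
      _ ≤ C * M ^ 4 * (448 * (2 * u / (1 + 2 * u) - u / (1 + u)) + 1 * (1 / T')) := by gcongr
      _ = _ := by
          rw [show 2 * T' / T = 2 * u by rw [hu]; ring]
          congr 2
          field_simp; norm_num
  have hpart : ∀ n : ℕ, ∫ t in (-(2 : ℝ) ^ n)..(2 : ℝ) ^ n, f t ≤ 2 * ((R + 2) ^ 4 + C * (448 + 2)) * M ^ 4 := by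
    intro n
    have hii : ∀ a b : ℝ, IntervalIntegrable f volume a b := fun a b => hfc.intervalIntegrable a b
    have h1 : ∫ t in (-(2 : ℝ) ^ n)..0, f t = ∫ t in (0 : ℝ)..(2 : ℝ) ^ n, f t := by
      have := intervalIntegral.integral_comp_neg f (a := 0) (b := (2 : ℝ) ^ n)
      rw [neg_zero] at this
      rw [← this]
      exact intervalIntegral.integral_congr fun t _ => heven t
    rw [← intervalIntegral.integral_add_adjacent_intervals (hii _ 0) (hii 0 _), h1,
      ← intervalIntegral.integral_add_adjacent_intervals (hii 0 1) (hii 1 _)]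
    have h2 := intervalIntegral.sum_integral_adjacent_intervals (f := f) (μ := volume) (a := fun i : ℕ => (2 : ℝ) ^ i) (n := n) (fun k _ => hii _ _)
    rw [pow_zero] at h2
    rw [← h2]
    have h3 := Finset.sum_le_sum (s := Finset.range n) fun i _ => hdy i
    rw [← Finset.mul_sum, Finset.sum_add_distrib, ← Finset.mul_sum, Finset.sum_range_sub (fun i : ℕ => (2 : ℝ) ^ i / T / (1 + 2 ^ i / T)),
      Finset.sum_range_sub (fun i : ℕ => -2 / (2 : ℝ) ^ i)] at h3
    have h4 : (2 : ℝ) ^ n / T / (1 + 2 ^ n / T) - 2 ^ 0 / T / (1 + 2 ^ 0 / T) ≤ 1 := by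
      have a : (2 : ℝ) ^ n / T / (1 + 2 ^ n / T) ≤ 1 := by
        rw [div_le_one (by positivity)]; linarith
      have b : 0 ≤ (2 : ℝ) ^ 0 / T / (1 + 2 ^ 0 / T) := by positivity
      linarith
    have h5 : -2 / (2 : ℝ) ^ n - -2 / 2 ^ 0 ≤ 2 := by
      have : 0 ≤ 2 / (2 : ℝ) ^ n := by positivity
      rw [neg_div, neg_div, pow_zero]; linarith
    have h6 : C * M ^ 4 * (448 * ((2 : ℝ) ^ n / T / (1 + 2 ^ n / T) - 2 ^ 0 / T / (1 + 2 ^ 0 / T)) + (-2 / (2 : ℝ) ^ n - -2 / 2 ^ 0)) ≤ C * M ^ 4 * (448 + 2) := by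
      gcongr
      linarith
    calc _ ≤ 2 * ((R + 2) ^ 4 * M ^ 4 + C * M ^ 4 * (448 + 2)) := by linarith [h3.trans h6]
      _ = _ := by ring
  have hlim := intervalIntegral_tendsto_integral (μ := volume) hint (a := fun n : ℕ => -(2 : ℝ) ^ n) (b := fun n : ℕ => (2 : ℝ) ^ n) (l := Filter.atTop)
    (Filter.tendsto_neg_atTop_atBot.comp (tendsto_pow_atTop_atTop_of_one_lt (by norm_num))) (tendsto_pow_atTop_atTop_of_one_lt (by norm_num))
  have hfin : ∫ t, f t ≤ 2 * ((R + 2) ^ 4 + C * (448 + 2)) * M ^ 4 := le_of_tendsto' hlim hpart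
  have hq := Q2_anti (s ×ˢ s) (fun p => ((p.1 + σ) / M) ^ α + ((p.2 + σ) / M) ^ α) hTp.le hTM
  calc M ^ 2 * Q4 s (fun k => ((k + σ) / M) ^ α) (M ^ 2) ≤ M ^ 2 * Q4 s (fun k => ((k + σ) / M) ^ α) T := by
        gcongr; exact hq
    _ = M ^ ρ * (T * Q4 s (fun k => ((k + σ) / M) ^ α) T) := by rw [hMT]; ring
    _ ≤ M ^ ρ * (2 * ((R + 2) ^ 4 + C * (448 + 2)) * M ^ 4) := mul_le_mul_of_nonneg_left (hge.trans hfin) (by positivity)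
    _ = _ := by ring

lemma PP_n (n : ℕ) : PP (2 / (n + 1)) := by
  induction n with
  | zero => simpa using PP_two
  | succ n ih =>
    have h : (0 : ℝ) ≤ n := n.cast_nonneg
    refine Pstep _ _ (by positivity) ?_ (by positivity) ?_ ?_ ih
    · rw [div_le_iff₀ (by positivity)]; linarith
    · push_cast; rw [div_le_iff₀ (by positivity)]; linarith
    · push_cast
      rw [show (2 : ℝ) / (n + 1) * (1 - 2 / (n + 1 + 1)) = 2 / (n + 1 + 1) * (n / (n + 1)) by field_simp; ring]
      have : (n : ℝ) / (n + 1) ≤ 1 := by rw [div_le_one (by positivity)]; linarith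
      have h2 : (0 : ℝ) ≤ 2 / (n + 1 + 1) := by positivity
      nlinarith

lemma PP_all (θ : ℝ) (hθ : 0 < θ) : PP θ := by
  obtain ⟨n, hn⟩ := exists_nat_gt (2 / θ)
  intro α hα R hR
  obtain ⟨B, hB, h⟩ := PP_n n α hα R hR
  refine ⟨B, hB, fun σ hσ M hM s hs T hT => (h σ hσ M hM s hs T hT).trans ?_⟩
  gcongr
  rw [div_le_iff₀ (by positivity)]
  rw [div_lt_iff₀ hθ] at hn
  linarith

lemma gshift_int (p : ℝ) : Integrable (fun r : ℝ => Real.exp (-Real.pi * (r - p) ^ 2)) := by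
  have := (gauss_integrable 1 one_pos).comp_sub_right p
  simpa using this

lemma gshift_val (p : ℝ) : ∫ r : ℝ, Real.exp (-Real.pi * (r - p) ^ 2) = 1 := by
  have h := gauss_fourier 1 one_pos 0
  rw [integral_sub_right_eq_self (fun r : ℝ => Real.exp (-Real.pi * r ^ 2)) p]
  have h1 : ((∫ r : ℝ, Real.exp (-Real.pi * r ^ 2) : ℝ) : ℂ) = 1 := by
    rw [← integral_complex_ofReal]
    simpa [e_zero] using h
  exact_mod_cast h1

lemma gshift_e (p v : ℝ) : ∫ r : ℝ, (Real.exp (-Real.pi * (r - p) ^ 2) : ℂ) * e (r * v)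
    = e (p * v) * (Real.exp (-Real.pi * v ^ 2) : ℂ) := by
  have h := gauss_fourier 1 one_pos v
  have h1 := integral_sub_right_eq_self (fun r : ℝ => (Real.exp (-Real.pi * r ^ 2) : ℂ) * e ((r + p) * v)) p (μ := volume)
  simp only [sub_add_cancel] at h1
  rw [h1]
  have h2 : ∀ r : ℝ, (Real.exp (-Real.pi * r ^ 2) : ℂ) * e ((r + p) * v) =
      e (p * v) * ((Real.exp (-Real.pi * r ^ 2 / 1 ^ 2) : ℂ) * e (r * v)) := by
    intro r; rw [add_mul, e_add]; norm_num; ring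
  simp_rw [h2]
  rw [integral_const_mul, h]; norm_num

lemma dls {ι κ : Type*} (I : Finset ι) (J : Finset κ) (u : ι → ℝ) (v : κ → ℝ) (a : ι → ℂ) (b : κ → ℂ)
    (V : ℝ) (hu : ∀ i ∈ I, |u i| ≤ V) (hv : ∀ j ∈ J, |v j| ≤ V) (ha : ∀ i ∈ I, ‖a i‖ ≤ 1)
    (hb : ∀ j ∈ J, ‖b j‖ ≤ 1) (F : ℝ) (hF : 2 ≤ F) :
    ‖∑ i ∈ I, ∑ j ∈ J, a i * b j * e (F * u i * v j)‖ ^ 2 ≤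
      Real.exp (2 * Real.pi * V ^ 2) ^ 2 * (F * Q2 I u (F / 2) * Q2 J v F) := by
  have hF0 : 0 < F := by linarith
  have hpi := Real.pi_pos
  set E := Real.exp (2 * Real.pi * V ^ 2) with hE
  set G : ℝ → ℂ := fun r => ∑ i ∈ I, a i * (Real.exp (-Real.pi * (r - F * u i) ^ 2) : ℂ) with hG
  set b' : κ → ℂ := fun j => b j * (Real.exp (Real.pi * v j ^ 2) : ℂ) with hb'
  set H : ℝ → ℂ := fun r => ∑ j ∈ J, b' j * e (r * v j) with hH
  have hsum : ∑ i ∈ I, ∑ j ∈ J, a i * b j * e (F * u i * v j) = ∫ r : ℝ, G r * H r := by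
    have h1 : ∀ r, G r * H r = ∑ i ∈ I, ∑ j ∈ J, (a i * b' j) * ((Real.exp (-Real.pi * (r - F * u i) ^ 2) : ℂ) * e (r * v j)) := by
      intro r
      simp only [hG, hH, Finset.sum_mul_sum]
      refine Finset.sum_congr rfl fun i _ => Finset.sum_congr rfl fun j _ => by ring
    have hint : ∀ i j, Integrable (fun r : ℝ => (a i * b' j) * ((Real.exp (-Real.pi * (r - F * u i) ^ 2) : ℂ) * e (r * v j))) := by
      intro i j
      refine Integrable.const_mul ?_ _
      refine (gshift_int (F * u i)).mono' ?_ (Filter.Eventually.of_forall fun r => ?_)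
      · have := e_continuous
        exact Continuous.aestronglyMeasurable (by fun_prop)
      · rw [norm_mul, e_norm, mul_one, Complex.norm_real, Real.norm_of_nonneg (Real.exp_pos _).le]
    simp_rw [h1]
    rw [integral_finsetSum _ fun i _ => integrable_finsetSum _ fun j _ => hint i j]
    refine Finset.sum_congr rfl fun i _ => ?_
    rw [integral_finsetSum _ fun j _ => hint i j]
    refine Finset.sum_congr rfl fun j _ => ?_
    rw [integral_const_mul, gshift_e]
    simp only [hb']
    have : (Real.exp (Real.pi * v j ^ 2) : ℂ) * (Real.exp (-Real.pi * v j ^ 2) : ℂ) = 1 := by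
      rw [← Complex.ofReal_mul, ← Real.exp_add]; simp
    linear_combination (- a i * b j * e (F * u i * v j)) * this
  set g : ℝ → ℝ := fun r => ∑ i ∈ I, ∑ j ∈ I, E * Real.exp (-Real.pi * (F / 2) ^ 2 * (u i - u j) ^ 2) *
      Real.exp (-Real.pi * (r - F * ((u i + u j) / 2)) ^ 2) with hg
  have hgint : Integrable g := integrable_finsetSum _ fun i _ => integrable_finsetSum _ fun j _ =>
      (gshift_int _).const_mul _
  have hgval : ∫ r, g r = E * Q2 I u (F / 2) := by
    rw [hg, integral_finsetSum _ fun i _ => integrable_finsetSum _ fun j _ => (gshift_int _).const_mul _]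
    unfold Q2
    rw [Finset.mul_sum]
    refine Finset.sum_congr rfl fun i _ => ?_
    rw [integral_finsetSum _ fun j _ => (gshift_int _).const_mul _, Finset.mul_sum]
    refine Finset.sum_congr rfl fun j _ => ?_
    rw [integral_const_mul, gshift_val, mul_one]
  have hGg : ∀ r, ‖G r‖ ^ 2 * Real.exp (Real.pi * r ^ 2 / F ^ 2) ≤ g r := by
    intro r
    have h1 : ‖G r‖ ≤ ∑ i ∈ I, Real.exp (-Real.pi * (r - F * u i) ^ 2) := by
      refine (norm_sum_le _ _).trans (Finset.sum_le_sum fun i hi => ?_)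
      rw [norm_mul, Complex.norm_real, Real.norm_of_nonneg (Real.exp_pos _).le]
      exact mul_le_of_le_one_left (Real.exp_pos _).le (ha i hi)
    have h2 : ‖G r‖ ^ 2 ≤ (∑ i ∈ I, Real.exp (-Real.pi * (r - F * u i) ^ 2)) ^ 2 := by gcongr
    refine (mul_le_mul_of_nonneg_right h2 (Real.exp_pos _).le).trans ?_
    rw [sq, Finset.sum_mul_sum, Finset.sum_mul]
    refine Finset.sum_le_sum fun i hi => ?_
    rw [Finset.sum_mul]
    refine Finset.sum_le_sum fun j hj => ?_
    rw [hE, ← Real.exp_add, ← Real.exp_add, ← Real.exp_add, ← Real.exp_add, Real.exp_le_exp]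
    have hui := abs_le.mp (hu i hi)
    have huj := abs_le.mp (hu j hj)
    set m := (u i + u j) / 2 with hm
    have hm2 : m ^ 2 ≤ V ^ 2 := sq_le_sq' (by linarith) (by linarith)
    have h3 : r ^ 2 / F ^ 2 ≤ (r - F * m) ^ 2 + 2 * V ^ 2 := by
      rw [div_le_iff₀ (by positivity)]
      have h4 : (2 : ℝ) ≤ F ^ 2 := by nlinarith
      nlinarith [sq_nonneg (r - F * m - F * m), mul_le_mul_of_nonneg_left hm2 (sq_nonneg F),
        mul_le_mul_of_nonneg_right h4 (sq_nonneg (r - F * m))]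
    have h5 : Real.pi * r ^ 2 / F ^ 2 = Real.pi * (r ^ 2 / F ^ 2) := by ring
    rw [h5]
    have h6 : (r - F * u i) ^ 2 + (r - F * u j) ^ 2 = 2 * (r - F * m) ^ 2 + 2 * (F / 2) ^ 2 * (u i - u j) ^ 2 := by
      rw [hm]; ring
    have h7 : 0 ≤ (F / 2) ^ 2 * (u i - u j) ^ 2 := by positivity
    have h8 : -((r - F * u i) ^ 2 + (r - F * u j) ^ 2) + r ^ 2 / F ^ 2 ≤ 2 * V ^ 2 - (F / 2) ^ 2 * (u i - u j) ^ 2 - (r - F * m) ^ 2 := by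
      rw [h6]; linarith
    have := mul_le_mul_of_nonneg_left h8 hpi.le
    linarith
  set h : ℝ → ℝ := fun r => Real.exp (-Real.pi * r ^ 2 / F ^ 2) * ‖H r‖ ^ 2 with hh
  have hhint : Integrable h := L2_integrable J v b' F hF0
  have hhval : ∫ r, h r ≤ E * (F * Q2 J v F) := by
    have := L2_le J v b' (Real.exp (Real.pi * V ^ 2)) (fun j hj => ?_) F hF0
    · rwa [← Real.exp_nat_mul, show ((2 : ℕ) : ℝ) * (Real.pi * V ^ 2) = 2 * Real.pi * V ^ 2 by push_cast; ring] at this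
    · rw [norm_mul, Complex.norm_real, Real.norm_of_nonneg (Real.exp_pos _).le]
      refine (mul_le_of_le_one_left (Real.exp_pos _).le (hb j hj)).trans ?_
      rw [Real.exp_le_exp]
      have : v j ^ 2 ≤ V ^ 2 := sq_le_sq' (abs_le.mp (hv j hj)).1 (abs_le.mp (hv j hj)).2
      gcongr
  set Z := ‖∑ i ∈ I, ∑ j ∈ J, a i * b j * e (F * u i * v j)‖ with hZ
  have hQu := Q2_nonneg I u (F / 2)
  have hQv := Q2_nonneg J v F
  have key : ∀ l : ℝ, 0 < l → 2 * Z * l ≤ l ^ 2 * (E * Q2 I u (F / 2)) + E * (F * Q2 J v F) := by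
    intro l hl
    have h1 : Z ≤ ∫ r, (l / 2 * g r + 1 / (2 * l) * h r) := by
      rw [hZ, hsum]
      refine norm_integral_le_of_norm_le ((hgint.const_mul _).add (hhint.const_mul _)) (Filter.Eventually.of_forall fun r => ?_)
      rw [norm_mul]
      have h2 := hGg r
      have h3 : Real.exp (-Real.pi * r ^ 2 / F ^ 2) * Real.exp (Real.pi * r ^ 2 / F ^ 2) = 1 := by
        rw [← Real.exp_add, ← Real.exp_zero]; congr 1; ring
      set W := Real.exp (Real.pi * r ^ 2 / F ^ 2)
      set W' := Real.exp (-Real.pi * r ^ 2 / F ^ 2) with hW'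
      have hWp : 0 < W := Real.exp_pos _
      have hhr : h r = W' * ‖H r‖ ^ 2 := rfl
      have hW'e : W' = 1 / W := by field_simp; exact h3
      have h4 : l / 2 * (‖G r‖ ^ 2 * W) + 1 / (2 * l) * (1 / W * ‖H r‖ ^ 2) - ‖G r‖ * ‖H r‖
        = 1 / (2 * l * W) * (l * W * ‖G r‖ - ‖H r‖) ^ 2 := by field_simp; ring
      have h5 : 0 ≤ 1 / (2 * l * W) * (l * W * ‖G r‖ - ‖H r‖) ^ 2 := by positivity
      have h6 : l / 2 * (‖G r‖ ^ 2 * W) ≤ l / 2 * g r := by gcongr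
      rw [hhr, hW'e]; linarith
    rw [integral_add (hgint.const_mul _) (hhint.const_mul _), integral_const_mul, integral_const_mul, hgval] at h1
    have h2 : 1 / (2 * l) * ∫ r, h r ≤ 1 / (2 * l) * (E * (F * Q2 J v F)) := by gcongr
    have h3 := mul_le_mul_of_nonneg_right (h1.trans (add_le_add_right h2 _)) (by positivity : 0 ≤ 2 * l)
    calc 2 * Z * l = Z * (2 * l) := by ring
      _ ≤ _ := h3
      _ = _ := by field_simp
  have hEp : 0 < E := Real.exp_pos _
  have hd := discrim_le_zero (a := E * Q2 I u (F / 2)) (b := - 2 * Z) (c := E * (F * Q2 J v F)) (fun l => by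
    rcases lt_or_ge 0 l with hl | hl
    · nlinarith [key l hl]
    · have : 0 ≤ Z := norm_nonneg _
      have h1 : 0 ≤ Z * (-l) := mul_nonneg this (by linarith)
      have h2 : 0 ≤ E * Q2 I u (F / 2) * (l * l) := mul_nonneg (by positivity) (mul_self_nonneg l)
      have h3 : 0 ≤ E * (F * Q2 J v F) := by positivity
      linarith)
  unfold discrim at hd
  nlinarith

lemma Q2_diff (s : Finset ℕ) (φ : ℕ → ℝ) (T : ℝ) :
    Q2 (s ×ˢ s) (fun p => φ p.1 - φ p.2) T = Q4 s φ T := by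
  unfold Q4 Q2
  simp only [Finset.sum_product]
  refine Finset.sum_congr rfl fun a _ => ?_
  have h1 : ∀ f : ℕ → ℕ → ℕ → ℝ, ∑ x ∈ s, ∑ y ∈ s, ∑ z ∈ s, f x y z = ∑ x ∈ s, ∑ y ∈ s, ∑ z ∈ s, f z x y := by
    intro f
    rw [Finset.sum_comm]
    refine (Finset.sum_congr rfl fun y _ => Finset.sum_comm).trans ?_
    rfl
  conv_rhs => rw [h1]
  refine Finset.sum_congr rfl fun b _ => Finset.sum_congr rfl fun c _ => Finset.sum_congr rfl fun d _ => ?_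
  congr 2; ring

lemma normsq_expand {ι : Type*} (s : Finset ι) (z : ι → ℂ) :
    ((‖∑ i ∈ s, z i‖ ^ 2 : ℝ) : ℂ) = ∑ p ∈ s ×ˢ s, z p.1 * (starRingEnd ℂ) (z p.2) := by
  simp only [Finset.sum_product]
  rw [← Finset.sum_mul_sum, ← map_sum, Complex.mul_conj, Complex.normSq_eq_norm_sq]

lemma bilin8 (s r : Finset ℕ) (a b : ℕ → ℂ) (ha : ∀ m ∈ s, ‖a m‖ ≤ 1) (hb : ∀ n ∈ r, ‖b n‖ ≤ 1)
    (F : ℝ) (μ ν : ℕ → ℝ) :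
    ‖∑ m ∈ s, ∑ n ∈ r, a m * b n * e (F * μ m * ν n)‖ ^ 8 ≤ (s.card : ℝ) ^ 4 * (r.card : ℝ) ^ 4 *
      ‖∑ q ∈ s ×ˢ s, ∑ p ∈ r ×ˢ r, (1 : ℂ) * 1 * e (F * (μ q.1 - μ q.2) * (ν p.1 - ν p.2))‖ ^ 2 := by
  set Z := ‖∑ m ∈ s, ∑ n ∈ r, a m * b n * e (F * μ m * ν n)‖ with hZ
  set Y := ∑ m ∈ s, ‖∑ n ∈ r, b n * e (F * μ m * ν n)‖ ^ 2 with hY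
  set W := ‖∑ q ∈ s ×ˢ s, ∑ p ∈ r ×ˢ r, (1 : ℂ) * 1 * e (F * (μ q.1 - μ q.2) * (ν p.1 - ν p.2))‖ with hW
  have h1 : Z ^ 2 ≤ s.card * Y := by
    have : Z ≤ ∑ m ∈ s, ‖∑ n ∈ r, b n * e (F * μ m * ν n)‖ := by
      refine (norm_sum_le _ _).trans (Finset.sum_le_sum fun m hm => ?_)
      have : ∑ n ∈ r, a m * b n * e (F * μ m * ν n) = a m * ∑ n ∈ r, b n * e (F * μ m * ν n) := by
        rw [Finset.mul_sum]; exact Finset.sum_congr rfl fun n _ => by ring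
      rw [this, norm_mul]
      exact mul_le_of_le_one_left (norm_nonneg _) (ha m hm)
    exact (pow_le_pow_left₀ (norm_nonneg _) this 2).trans sq_sum_le_card_mul_sum_sq
  set A : ℕ × ℕ → ℂ := fun p => ∑ m ∈ s, e (F * μ m * (ν p.1 - ν p.2)) with hA
  have h2 : Y ≤ ∑ p ∈ r ×ˢ r, ‖A p‖ := by
    have : (Y : ℂ) = ∑ p ∈ r ×ˢ r, b p.1 * (starRingEnd ℂ) (b p.2) * A p := by
      rw [hY, Complex.ofReal_sum]
      simp_rw [normsq_expand, hA, Finset.mul_sum]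
      rw [Finset.sum_comm]
      refine Finset.sum_congr rfl fun p _ => Finset.sum_congr rfl fun m _ => ?_
      rw [mul_sub, e_sub, map_mul]; ring
    have h3 : Y ≤ ‖(Y : ℂ)‖ := by rw [Complex.norm_real]; exact le_abs_self _
    refine h3.trans ?_
    rw [this]
    refine (norm_sum_le _ _).trans (Finset.sum_le_sum fun p hp => ?_)
    rw [Finset.mem_product] at hp
    rw [norm_mul, norm_mul, RCLike.norm_conj]
    refine mul_le_of_le_one_left (norm_nonneg _) (mul_le_one₀ (hb _ hp.1) (norm_nonneg _) (hb _ hp.2))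
  have hY0 : 0 ≤ Y := Finset.sum_nonneg fun _ _ => by positivity
  have h3 : Y ^ 2 ≤ (r.card : ℝ) ^ 2 * ∑ p ∈ r ×ˢ r, ‖A p‖ ^ 2 := by
    refine (pow_le_pow_left₀ hY0 h2 2).trans (sq_sum_le_card_mul_sum_sq.trans (le_of_eq ?_))
    rw [Finset.card_product]; push_cast; ring
  have h4 : ∑ p ∈ r ×ˢ r, ‖A p‖ ^ 2 ≤ W := by
    have : ((∑ p ∈ r ×ˢ r, ‖A p‖ ^ 2 : ℝ) : ℂ) = ∑ q ∈ s ×ˢ s, ∑ p ∈ r ×ˢ r, (1 : ℂ) * 1 * e (F * (μ q.1 - μ q.2) * (ν p.1 - ν p.2)) := by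
      rw [Complex.ofReal_sum, Finset.sum_comm]
      refine Finset.sum_congr rfl fun p _ => ?_
      rw [hA, normsq_expand]
      refine Finset.sum_congr rfl fun q _ => ?_
      rw [← e_sub, one_mul, one_mul]; congr 1; ring
    rw [hW, ← this, Complex.norm_real]; exact le_abs_self _
  have hZ0 : 0 ≤ Z := norm_nonneg _
  have h5 : Z ^ 4 ≤ (s.card : ℝ) ^ 2 * ((r.card : ℝ) ^ 2 * W) := by
    calc Z ^ 4 = (Z ^ 2) ^ 2 := by ring
      _ ≤ (s.card * Y) ^ 2 := by gcongr
      _ = (s.card : ℝ) ^ 2 * Y ^ 2 := by ring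
      _ ≤ _ := by gcongr; exact h3.trans (by gcongr)
  calc Z ^ 8 = (Z ^ 4) ^ 2 := by ring
    _ ≤ ((s.card : ℝ) ^ 2 * ((r.card : ℝ) ^ 2 * W)) ^ 2 := by gcongr
    _ = _ := by ring

lemma typeII (c : ℝ) (hc : 1 < c) (θ : ℝ) (hθ : 0 < θ) : ∃ C > 0, ∀ M N : ℕ, 1 ≤ M → 1 ≤ N →
    ∀ s r : Finset ℕ, s ⊆ Finset.Ico M (2 * M) → r ⊆ Finset.Ico N (2 * N) → ∀ a b : ℕ → ℂ,
    (∀ m ∈ s, ‖a m‖ ≤ 1) → (∀ n ∈ r, ‖b n‖ ≤ 1) → ∀ x : ℝ, ∀ F : ℝ, F = x * ((M : ℝ) * N) ^ c → 2 ≤ F →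
    ‖∑ m ∈ s, ∑ n ∈ r, a m * b n * e (((m : ℝ) * n) ^ c * x)‖ ^ 8 ≤
      C * (((M : ℝ) * N) ^ (6 + θ) * (F + (M : ℝ) ^ 2 + (N : ℝ) ^ 2 + ((M : ℝ) * N) ^ 2 / F)) := by
  obtain ⟨B, hB, hP⟩ := PP_all θ hθ c hc 2 (by norm_num)
  set V : ℝ := 2 ^ c with hV
  refine ⟨Real.exp (2 * Real.pi * V ^ 2) ^ 2 * (2 * B ^ 2), by positivity, ?_⟩
  intro M N hM hN s r hs hr a b ha hb x F hF hF2
  have hF0 : 0 < F := by linarith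
  have hM' : (1 : ℝ) ≤ M := by exact_mod_cast hM
  have hN' : (1 : ℝ) ≤ N := by exact_mod_cast hN
  have hM0 : (0 : ℝ) < M := by linarith
  have hN0 : (0 : ℝ) < N := by linarith
  have hcard : ∀ (K : ℕ) (s : Finset ℕ), s ⊆ Finset.Ico K (2 * K) → (s.card : ℝ) ≤ K := by
    intro K s hs
    have := Finset.card_le_card hs
    rw [Nat.card_Ico] at this
    exact_mod_cast this.trans (by omega)
  have hran : ∀ (K : ℕ) (s : Finset ℕ), s ⊆ Finset.Ico K (2 * K) → ∀ k ∈ s, (K : ℝ) ≤ k ∧ (k : ℝ) ≤ 2 * K := by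
    intro K s hs k hk
    have := Finset.mem_Ico.mp (hs hk)
    exact ⟨by exact_mod_cast this.1, by exact_mod_cast this.2.le⟩
  have hsc := hcard M s hs
  have hrc := hcard N r hr
  have hbd : ∀ (K : ℕ) (s : Finset ℕ), 1 ≤ K → s ⊆ Finset.Ico K (2 * K) → ∀ p ∈ s ×ˢ s,
     |((p.1 : ℝ) / K) ^ c - ((p.2 : ℝ) / K) ^ c| ≤ V := by
    intro K s hK hs p hp
    rw [Finset.mem_product] at hp
    have hK0 : (0 : ℝ) < K := by exact_mod_cast hK
    have h : ∀ k ∈ s, 0 ≤ ((k : ℝ) / K) ^ c ∧ ((k : ℝ) / K) ^ c ≤ V := by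
      intro k hk
      have := hran K s hs k hk
      refine ⟨by positivity, Real.rpow_le_rpow (by positivity) ?_ (by linarith)⟩
      rw [div_le_iff₀ hK0]; exact this.2
    have h1 := h _ hp.1
    have h2 := h _ hp.2
    rw [abs_le]; constructor <;> linarith
  have hPs := hP 0 ⟨le_rfl, zero_le_one⟩ M hM' s (by simpa using hran M s hs) (F / 2) (by positivity)
  have hPr := hP 0 ⟨le_rfl, zero_le_one⟩ N hN' r (by simpa using hran N r hr) F hF0
  simp only [add_zero] at hPs hPr
  have hphase : ∀ m n : ℕ, ((m : ℝ) * n) ^ c * x = F * ((m : ℝ) / M) ^ c * ((n : ℝ) / N) ^ c := by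
    intro m n
    rw [hF, Real.mul_rpow (by positivity) (by positivity), Real.mul_rpow (by positivity) (by positivity),
      Real.div_rpow (by positivity) (by positivity), Real.div_rpow (by positivity) (by positivity)]
    have h1 : (0 : ℝ) < (M : ℝ) ^ c := by positivity
    have h2 : (0 : ℝ) < (N : ℝ) ^ c := by positivity
    field_simp
  simp_rw [hphase]
  refine (bilin8 s r a b ha hb F (fun m => ((m : ℝ) / M) ^ c) (fun n => ((n : ℝ) / N) ^ c)).trans ?_
  have hd := dls (s ×ˢ s) (r ×ˢ r) (fun q => ((q.1 : ℝ) / M) ^ c - ((q.2 : ℝ) / M) ^ c)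
    (fun q => ((q.1 : ℝ) / N) ^ c - ((q.2 : ℝ) / N) ^ c) (fun _ => 1) (fun _ => 1) V (hbd M s hM hs) (hbd N r hN hr)
    (by simp) (by simp) F hF2
  rw [Q2_diff s (fun m => ((m : ℝ) / M) ^ c), Q2_diff r (fun m => ((m : ℝ) / N) ^ c)] at hd
  have h1 : Q4 s (fun m => ((m : ℝ) / M) ^ c) (F / 2) ≤ 2 * B * (M : ℝ) ^ θ * ((M : ℝ) ^ 2 + (M : ℝ) ^ 4 / F) := by
    rw [← le_div_iff₀' (by positivity)] at hPs
    refine hPs.trans ?_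
    rw [div_le_iff₀ (by positivity)]
    have : 2 * B * (M : ℝ) ^ θ * ((M : ℝ) ^ 2 + (M : ℝ) ^ 4 / F) * (F / 2) - B * (M : ℝ) ^ θ * (F / 2 * (M : ℝ) ^ 2 + (M : ℝ) ^ 4)
      = B * (M : ℝ) ^ θ * (F / 2 * (M : ℝ) ^ 2) := by field_simp; ring
    have : 0 ≤ B * (M : ℝ) ^ θ * (F / 2 * (M : ℝ) ^ 2) := by positivity
    linarith
  have h2 : Q4 r (fun m => ((m : ℝ) / N) ^ c) F ≤ B * (N : ℝ) ^ θ * ((N : ℝ) ^ 2 + (N : ℝ) ^ 4 / F) := by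
    rw [← le_div_iff₀' (by positivity)] at hPr
    refine hPr.trans (le_of_eq ?_)
    field_simp
  have hq1 : 0 ≤ Q4 s (fun m => ((m : ℝ) / M) ^ c) (F / 2) := Q2_nonneg _ _ _
  have hq2 : 0 ≤ Q4 r (fun m => ((m : ℝ) / N) ^ c) F := Q2_nonneg _ _ _
  calc _ ≤ (M : ℝ) ^ 4 * (N : ℝ) ^ 4 * (Real.exp (2 * Real.pi * V ^ 2) ^ 2 * (F * (2 * B * (M : ℝ) ^ θ * ((M : ℝ) ^ 2 + (M : ℝ) ^ 4 / F)) *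
      (B * (N : ℝ) ^ θ * ((N : ℝ) ^ 2 + (N : ℝ) ^ 4 / F)))) := by
        refine mul_le_mul (by gcongr) (hd.trans (by gcongr)) (by positivity) (by positivity)
    _ = _ := by
        rw [Real.rpow_add (by positivity), Real.mul_rpow (x := (M : ℝ)) (z := θ) (by positivity) (by positivity)]
        rw [show (6 : ℝ) = ((6 : ℕ) : ℝ) by norm_num, Real.rpow_natCast]
        field_simp
        ring

lemma e_sub_one_ge (θ : ℝ) (h0 : 0 ≤ θ) (h1 : θ ≤ 1) : 4 * (θ * (1 - θ)) ≤ ‖e θ - 1‖ := by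
  have hpi := Real.pi_pos
  have h2 : ‖e θ - 1‖ = ‖2 * Real.sin (Real.pi * θ)‖ := by
    have := Complex.norm_exp_I_mul_ofReal_sub_one (2 * Real.pi * θ)
    rw [show 2 * Real.pi * θ / 2 = Real.pi * θ by ring] at this
    rw [← this]; unfold e; congr 3; push_cast; ring
  have h3 : 2 * (θ * (1 - θ)) ≤ Real.sin (Real.pi * θ) := by
    rcases le_total θ (1 / 2) with h | h
    · have := Real.mul_le_sin (x := Real.pi * θ) (by positivity) (by nlinarith)
      rw [show 2 / Real.pi * (Real.pi * θ) = 2 * θ by field_simp] at this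
      nlinarith
    · have := Real.mul_le_sin (x := Real.pi * (1 - θ)) (mul_nonneg hpi.le (by linarith)) (by nlinarith)
      rw [show 2 / Real.pi * (Real.pi * (1 - θ)) = 2 * (1 - θ) by field_simp,
        show Real.pi * (1 - θ) = Real.pi - Real.pi * θ by ring, Real.sin_pi_sub] at this
      nlinarith
  rw [h2]
  refine le_trans ?_ (le_abs_self _)
  linarith

lemma e_nat_mul (k : ℕ) (θ : ℝ) : e (k * θ) = e θ ^ k := by
  induction k with
  | zero => simp [e_zero]
  | succ n ih => rw [pow_succ, ← ih, ← e_add]; congr 1; push_cast; ring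

lemma e_ne_one (θ : ℝ) (h0 : 0 < θ) (h1 : θ < 1) : e θ ≠ 1 := by
  intro h
  have := e_sub_one_ge θ h0.le h1.le
  rw [h, sub_self, norm_zero] at this
  have : 0 < θ * (1 - θ) := mul_pos h0 (by linarith)
  linarith

lemma e_orth (q n k : ℕ) (hn : n < q) (hk : k < q) :
    ∑ h ∈ Finset.range q, e ((h : ℝ) * ((n - k : ℝ) / q)) = if k = n then (q : ℂ) else 0 := by
  have hq : (0 : ℝ) < q := by exact_mod_cast (by omega : 0 < q)
  split_ifs with hkn
  · subst hkn; simp [e_zero]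
  · simp_rw [e_nat_mul]
    have hne : e ((n - k : ℝ) / q) ≠ 1 := by
      rcases lt_or_gt_of_ne hkn with h | h
      · have h' : (k : ℝ) < n := by exact_mod_cast h
        have hn' : (n : ℝ) < q := by exact_mod_cast hn
        refine e_ne_one _ (div_pos (by linarith) hq) ?_
        rw [div_lt_one hq]; linarith [(Nat.cast_nonneg k : (0 : ℝ) ≤ k)]
      · have h' : (n : ℝ) < k := by exact_mod_cast h
        have hn' : (k : ℝ) < q := by exact_mod_cast hk
        have := e_ne_one (-((n - k : ℝ) / q)) (by rw [← neg_div]; exact div_pos (by linarith) hq) (by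
          rw [← neg_div, div_lt_one hq]; linarith [(Nat.cast_nonneg n : (0 : ℝ) ≤ n)])
        intro h0
        apply this
        rw [← e_neg_conj, h0, map_one]
    have h1 := geom_sum_mul (e ((n - k : ℝ) / q)) q
    have h2 : e ((n - k : ℝ) / q) ^ q = 1 := by
      rw [← e_nat_mul, mul_div_cancel₀ _ hq.ne']
      have := e_int ((n : ℤ) - k)
      push_cast at this; exact this
    rw [h2, sub_self, mul_eq_zero] at h1
    exact h1.resolve_right (sub_ne_zero.mpr hne)

noncomputable def kap (q h : ℕ) : ℝ := if h = 0 then 1 else (1 / (h : ℝ) + 1 / ((q : ℝ) - h)) / 2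

lemma kap_pos (q h : ℕ) (hh : h < q) : 0 < kap q h := by
  unfold kap
  split_ifs with h0
  · exact one_pos
  · have h1 : (0 : ℝ) < h := by exact_mod_cast Nat.pos_of_ne_zero h0
    have h2 : (0 : ℝ) < (q : ℝ) - h := by rw [sub_pos]; exact_mod_cast hh
    positivity

lemma kap_sum (q : ℕ) (hq : 1 ≤ q) : ∑ h ∈ Finset.range q, kap q h ≤ 2 + Real.log q := by
  obtain ⟨p, rfl⟩ : ∃ p, q = p + 1 := ⟨q - 1, by omega⟩
  rw [Finset.sum_range_succ']
  have h1 : ∑ k ∈ Finset.range p, kap (p + 1) (k + 1) = ∑ k ∈ Finset.range p, 1 / ((k : ℝ) + 1) := by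
    have h2 : ∑ k ∈ Finset.range p, 1 / ((p : ℝ) - k) = ∑ k ∈ Finset.range p, 1 / ((k : ℝ) + 1) := by
      rw [← Finset.sum_range_reflect]
      refine Finset.sum_congr rfl fun k hk => ?_
      rw [Finset.mem_range] at hk
      rw [Nat.cast_sub (by omega), Nat.cast_sub (by omega)]; congr 1; push_cast; ring
    have h3 : ∀ k ∈ Finset.range p, kap (p + 1) (k + 1) = 1 / ((k : ℝ) + 1) / 2 + 1 / ((p : ℝ) - k) / 2 := by
      intro k _
      unfold kap
      rw [if_neg (by omega)]; push_cast
      rw [show (p : ℝ) + 1 - (k + 1) = p - k by ring]; ring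
    rw [Finset.sum_congr rfl h3, Finset.sum_add_distrib, ← Finset.sum_div, ← Finset.sum_div, h2]; ring
  have h4 := harmonic_le_one_add_log p
  have h5 : ((harmonic p : ℚ) : ℝ) = ∑ k ∈ Finset.range p, 1 / ((k : ℝ) + 1) := by
    unfold harmonic; push_cast; simp
  rw [h1, ← h5]
  have h6 : Real.log p ≤ Real.log ((p + 1 : ℕ) : ℝ) := by
    rcases Nat.eq_zero_or_pos p with rfl | hp
    · simp
    · exact Real.log_le_log (by exact_mod_cast hp) (by push_cast; linarith)
  have : kap (p + 1) 0 = 1 := by simp [kap]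
  linarith

lemma cut (q : ℕ) (hq : 1 ≤ q) (A B : ℕ) : ∃ z : ℕ → ℂ, (∀ h < q, ‖z h‖ ≤ kap q h) ∧
    ∀ n < q, ∑ h ∈ Finset.range q, z h * e ((h : ℝ) / q * n) = if A ≤ n ∧ n < B then 1 else 0 := by
  have hq0 : (0 : ℝ) < q := by exact_mod_cast hq
  have hqc : (q : ℂ) ≠ 0 := by exact_mod_cast hq0.ne'
  set B' := min B q with hB'
  refine ⟨fun h => (1 / (q : ℂ)) * ∑ k ∈ Finset.Ico A B', e (-((h : ℝ) / q * k)), ?_, ?_⟩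
  · intro h hh
    rw [norm_mul, norm_div, norm_one, Complex.norm_natCast]
    unfold kap
    split_ifs with h0
    · subst h0
      rw [one_div_mul_eq_div, div_le_one hq0]
      refine (norm_sum_le _ _).trans ?_
      simp only [e_norm, Finset.sum_const, Nat.card_Ico, nsmul_eq_mul, mul_one]
      exact_mod_cast (by omega : B' - A ≤ q)
    · have h1 : (0 : ℝ) < h := by exact_mod_cast Nat.pos_of_ne_zero h0
      have h2 : (h : ℝ) < q := by exact_mod_cast hh
      have hconj : ∑ k ∈ Finset.Ico A B', e (-((h : ℝ) / q * k)) = (starRingEnd ℂ) (∑ k ∈ Finset.Ico A B', e ((h : ℝ) / q) ^ k) := by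
        rw [map_sum]
        refine Finset.sum_congr rfl fun k _ => ?_
        rw [← e_nat_mul, e_neg_conj, mul_comm]
      rw [hconj, RCLike.norm_conj]
      have h3 := e_sub_one_ge ((h : ℝ) / q) (by positivity) ((div_le_one hq0).mpr h2.le)
      have h3' : 0 < 4 * ((h : ℝ) / q * (1 - (h : ℝ) / q)) := by
        have : 0 < 1 - (h : ℝ) / q := by rw [sub_pos, div_lt_one hq0]; exact h2
        positivity
      have hgeo : ‖∑ k ∈ Finset.Ico A B', e ((h : ℝ) / q) ^ k‖ * ‖e ((h : ℝ) / q) - 1‖ ≤ 2 := by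
        rcases le_or_gt A B' with hAB | hAB
        · rw [← norm_mul, geom_sum_Ico_mul _ hAB]
          refine (norm_sub_le _ _).trans ?_
          rw [norm_pow, norm_pow, e_norm]; norm_num
        · rw [Finset.Ico_eq_empty (by omega)]; simp
      have h4 : ‖∑ k ∈ Finset.Ico A B', e ((h : ℝ) / q) ^ k‖ ≤ 2 / (4 * ((h : ℝ) / q * (1 - (h : ℝ) / q))) := by
        rw [le_div_iff₀ h3']
        exact (mul_le_mul_of_nonneg_left h3 (norm_nonneg _)).trans hgeo
      refine (mul_le_mul_of_nonneg_left h4 (by positivity)).trans (le_of_eq ?_)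
      have h5 : (q : ℝ) - h ≠ 0 := by linarith
      have h6 : 1 - (h : ℝ) / q = (q - h) / q := by field_simp
      rw [h6]
      field_simp
      ring
  · intro n hn
    have h1 : ∑ h ∈ Finset.range q, (1 / (q : ℂ)) * (∑ k ∈ Finset.Ico A B', e (-((h : ℝ) / q * k))) * e ((h : ℝ) / q * n)
      = (1 / (q : ℂ)) * ∑ k ∈ Finset.Ico A B', ∑ h ∈ Finset.range q, e ((h : ℝ) * ((n - k : ℝ) / q)) := by
      rw [Finset.sum_comm, Finset.mul_sum]
      refine Finset.sum_congr rfl fun h _ => ?_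
      rw [mul_assoc, Finset.sum_mul]
      congr 1
      refine Finset.sum_congr rfl fun k _ => ?_
      rw [← e_add]; congr 1; ring
    rw [h1]
    have h2 : ∀ k ∈ Finset.Ico A B', ∑ h ∈ Finset.range q, e ((h : ℝ) * ((n - k : ℝ) / q)) = if k = n then (q : ℂ) else 0 := by
      intro k hk
      rw [Finset.mem_Ico] at hk
      exact e_orth q n k hn (by omega)
    rw [Finset.sum_congr rfl h2, Finset.sum_ite_eq' ]
    simp only [Finset.mem_Ico, hB', lt_min_iff, hn, and_true]
    split_ifs
    · field_simp
    · simp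

noncomputable def fX (X c x : ℝ) (n : ℕ) : ℂ := if X / 2 < (n : ℝ) ∧ (n : ℝ) ≤ X then e ((n : ℝ) ^ c * x) else 0

lemma fX_mul_cut (X c x : ℝ) (hX : 0 ≤ X) (m n : ℕ) (hm : 1 ≤ m) : fX X c x (m * n) =
    (if ⌊X / 2 / m⌋₊ + 1 ≤ n ∧ n < ⌊X / m⌋₊ + 1 then 1 else 0) * e (((m : ℝ) * n) ^ c * x) := by
  have hm0 : (0 : ℝ) < m := by exact_mod_cast hm
  unfold fX
  have h1 : (⌊X / 2 / m⌋₊ + 1 ≤ n ∧ n < ⌊X / m⌋₊ + 1) ↔ (X / 2 < ((m * n : ℕ) : ℝ) ∧ ((m * n : ℕ) : ℝ) ≤ X) := by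
    rw [Nat.add_one_le_iff, Nat.floor_lt (by positivity), Nat.lt_add_one_iff, Nat.le_floor_iff (by positivity),
      div_lt_iff₀ hm0, le_div_iff₀ hm0]
    push_cast
    rw [mul_comm (m : ℝ)]
  simp only [h1]
  push_cast
  split_ifs <;> simp

lemma boxII (c : ℝ) (hc : 1 < c) (θ : ℝ) (hθ : 0 < θ) : ∃ C > 0, ∀ M N : ℕ, 1 ≤ M → 1 ≤ N →
    ∀ a b : ℕ → ℂ, (∀ m, ‖a m‖ ≤ 1) → (∀ n, ‖b n‖ ≤ 1) → ∀ X x : ℝ, 0 ≤ X → ∀ F : ℝ, F = x * ((M : ℝ) * N) ^ c → 2 ≤ F →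
    ‖∑ m ∈ Finset.Ico M (2 * M), ∑ n ∈ Finset.Ico N (2 * N), a m * b n * fX X c x (m * n)‖ ≤
      (2 + Real.log (2 * N)) * (C * (((M : ℝ) * N) ^ (6 + θ) * (F + (M : ℝ) ^ 2 + (N : ℝ) ^ 2 + ((M : ℝ) * N) ^ 2 / F))) ^ (1 / 8 : ℝ) := by
  obtain ⟨C, hC, H⟩ := typeII c hc θ hθ
  refine ⟨C, hC, ?_⟩
  intro M N hM hN a b ha hb X x hX F hF hF2
  have hF0 : 0 < F := by linarith
  set Dd := C * (((M : ℝ) * N) ^ (6 + θ) * (F + (M : ℝ) ^ 2 + (N : ℝ) ^ 2 + ((M : ℝ) * N) ^ 2 / F)) with hD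
  have hDd : 0 ≤ Dd := by positivity
  have hcut := fun m : ℕ => cut (2 * N) (by omega) (⌊X / 2 / m⌋₊ + 1) (⌊X / m⌋₊ + 1)
  choose z hz1 hz2 using hcut
  have h1 : ∑ m ∈ Finset.Ico M (2 * M), ∑ n ∈ Finset.Ico N (2 * N), a m * b n * fX X c x (m * n) =
      ∑ h ∈ Finset.range (2 * N), (kap (2 * N) h : ℂ) * ∑ m ∈ Finset.Ico M (2 * M), ∑ n ∈ Finset.Ico N (2 * N),
        (a m * (z m h / kap (2 * N) h)) * (b n * e ((h : ℝ) / (2 * N : ℕ) * n)) * e (((m : ℝ) * n) ^ c * x) := by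
    simp_rw [Finset.mul_sum]
    conv_rhs => rw [Finset.sum_comm]
    refine Finset.sum_congr rfl fun m hm => ?_
    conv_rhs => rw [Finset.sum_comm]
    refine Finset.sum_congr rfl fun n hn => ?_
    rw [Finset.mem_Ico] at hm hn
    rw [fX_mul_cut X c x hX m n (by omega), ← hz2 m n (by omega), Finset.sum_mul, Finset.mul_sum]
    refine Finset.sum_congr rfl fun h hh => ?_
    have := kap_pos _ _ (Finset.mem_range.mp hh)
    have h0 : (kap (2 * N) h : ℂ) ≠ 0 := by exact_mod_cast this.ne'
    field_simp
  rw [h1]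
  have h2 : ∀ h ∈ Finset.range (2 * N), ‖(kap (2 * N) h : ℂ) * ∑ m ∈ Finset.Ico M (2 * M), ∑ n ∈ Finset.Ico N (2 * N),
        (a m * (z m h / kap (2 * N) h)) * (b n * e ((h : ℝ) / (2 * N : ℕ) * n)) * e (((m : ℝ) * n) ^ c * x)‖ ≤
        kap (2 * N) h * Dd ^ (1 / 8 : ℝ) := by
    intro h hh
    have hk := kap_pos _ _ (Finset.mem_range.mp hh)
    rw [norm_mul, Complex.norm_real, Real.norm_of_nonneg hk.le]
    refine mul_le_mul_of_nonneg_left ?_ hk.le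
    have := H M N hM hN _ _ subset_rfl subset_rfl (fun m => a m * (z m h / kap (2 * N) h)) (fun n => b n * e ((h : ℝ) / (2 * N : ℕ) * n))
      (fun m _ => ?_) (fun n _ => ?_) x F hF hF2
    · rw [one_div, Real.le_rpow_inv_iff_of_pos (norm_nonneg _) hDd (by norm_num)]
      rw [show (8 : ℝ) = ((8 : ℕ) : ℝ) by norm_num, Real.rpow_natCast]
      exact this
    · rw [norm_mul, norm_div, Complex.norm_real, Real.norm_of_nonneg hk.le]
      refine mul_le_one₀ (ha m) (by positivity) ?_
      rw [div_le_one hk]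
      exact hz1 m h (Finset.mem_range.mp hh)
    · rw [norm_mul, e_norm, mul_one]; exact hb n
  refine (norm_sum_le _ _).trans ((Finset.sum_le_sum h2).trans ?_)
  rw [← Finset.sum_mul]
  refine mul_le_mul_of_nonneg_right ?_ (by positivity)
  have := kap_sum (2 * N) (by omega)
  push_cast at this
  exact this

lemma dyad1 {E : Type*} [AddCommMonoid E] (g : ℕ → E) (D : ℕ) : ∑ n ∈ Finset.range (2 ^ D), g n =
    g 0 + ∑ i ∈ Finset.range D, ∑ n ∈ Finset.Ico (2 ^ i) (2 * 2 ^ i), g n := by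
  induction D with
  | zero => simp
  | succ D ih =>
    rw [Finset.sum_range_succ, ← add_assoc, ← ih, Finset.range_eq_Ico, Finset.range_eq_Ico, pow_succ',
      Finset.sum_Ico_consecutive _ (Nat.zero_le _) (by have := Nat.one_le_two_pow (n := D); omega)]

lemma dyad2 (G : ℕ → ℕ → ℂ) (D : ℕ) (h1 : ∀ n, G 0 n = 0) (h2 : ∀ m, G m 0 = 0) :
    ∑ m ∈ Finset.range (2 ^ D), ∑ n ∈ Finset.range (2 ^ D), G m n =
    ∑ i ∈ Finset.range D, ∑ j ∈ Finset.range D, ∑ m ∈ Finset.Ico (2 ^ i) (2 * 2 ^ i), ∑ n ∈ Finset.Ico (2 ^ j) (2 * 2 ^ j), G m n := by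
  rw [dyad1]
  simp only [h1, Finset.sum_const_zero, zero_add]
  refine Finset.sum_congr rfl fun i _ => ?_
  rw [Finset.sum_comm]
  rw [dyad1]
  simp only [h2, Finset.sum_const_zero, zero_add]
  refine Finset.sum_congr rfl fun j _ => Finset.sum_comm

lemma dyad2_le (G : ℕ → ℕ → ℂ) (D : ℕ) (h1 : ∀ n, G 0 n = 0) (h2 : ∀ m, G m 0 = 0) (B : ℝ)
    (hB : ∀ M N : ℕ, 1 ≤ M → 1 ≤ N → ‖∑ m ∈ Finset.Ico M (2 * M), ∑ n ∈ Finset.Ico N (2 * N), G m n‖ ≤ B) :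
    ‖∑ m ∈ Finset.range (2 ^ D), ∑ n ∈ Finset.range (2 ^ D), G m n‖ ≤ (D : ℝ) ^ 2 * B := by
  rw [dyad2 G D h1 h2]
  refine (norm_sum_le _ _).trans ((Finset.sum_le_sum fun i _ => (norm_sum_le _ _).trans
    (Finset.sum_le_sum fun j _ => hB _ _ Nat.one_le_two_pow Nat.one_le_two_pow)).trans (le_of_eq ?_))
  simp; ring

lemma logpow (ε : ℝ) (hε : 0 < ε) (k : ℕ) : ∃ C > 0, ∀ X : ℝ, 1 ≤ X → (3 + 2 * Real.log X) ^ k ≤ C * X ^ ε := by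
  set ε' := ε / (k + 1) with hε'
  have h0 : 0 < ε' := by positivity
  refine ⟨(3 + 2 / ε') ^ k, by positivity, fun X hX => ?_⟩
  have h1 := Real.log_le_rpow_div (show 0 ≤ X by linarith) h0
  have h2 : 1 ≤ X ^ ε' := Real.one_le_rpow hX h0.le
  have h3 : 3 + 2 * Real.log X ≤ (3 + 2 / ε') * X ^ ε' := by
    have : (3 + 2 / ε') * X ^ ε' = 3 * X ^ ε' + 2 * (X ^ ε' / ε') := by ring
    linarith
  have h4 : 0 ≤ 3 + 2 * Real.log X := by linarith [Real.log_nonneg hX]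
  refine (pow_le_pow_left₀ h4 h3 k).trans ?_
  rw [mul_pow, ← Real.rpow_natCast (X ^ ε'), ← Real.rpow_mul (by linarith)]
  refine mul_le_mul_of_nonneg_left (Real.rpow_le_rpow_of_exponent_le hX ?_) (by positivity)
  rw [hε', div_mul_eq_mul_div, div_le_iff₀ (by positivity)]
  nlinarith

lemma D_le (X : ℝ) (hX : 1 ≤ X) (D : ℕ) (h : (2 : ℝ) ^ D ≤ 2 * X) : (D : ℝ) ≤ 3 + 2 * Real.log X := by
  have h1 := Real.log_le_log (by positivity) h
  rw [Real.log_pow, Real.log_mul (by norm_num) (by linarith)] at h1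
  have h2 := Real.log_two_gt_d9
  have h3 := Real.log_nonneg hX
  nlinarith [Real.log_two_lt_d9]

lemma fX_ne (X c x : ℝ) (n : ℕ) (h : fX X c x n ≠ 0) : X / 2 < (n : ℝ) ∧ (n : ℝ) ≤ X := by
  unfold fX at h; by_contra h'; exact h (if_neg h')

lemma fX_zero (X c x : ℝ) (hX : 0 ≤ X) : fX X c x 0 = 0 := by
  unfold fX; rw [if_neg]; push_cast; intro h; linarith [h.1]

lemma two_log_le (X : ℝ) (hX : 1 ≤ X) (N : ℕ) (hN : 1 ≤ N) (h : (N : ℝ) ≤ X) :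
    2 + Real.log (2 * N) ≤ 3 + 2 * Real.log X := by
  have hN0 : (0 : ℝ) < N := by exact_mod_cast hN
  have h1 := Real.log_le_log hN0 h
  rw [Real.log_mul (by norm_num) hN0.ne']
  linarith [Real.log_two_lt_d9, Real.log_nonneg hX]

/-- size of `F` -/
lemma F_bounds (c η : ℝ) (hc : 1 < c) (hc2 : c < 2) (hη0 : 0 < η) (hη : η ≤ 1 / 2) (X : ℝ) (hX : 16384 ≤ X) (x : ℝ)
    (hx : X ^ (1 - c - η) ≤ x) (hx2 : x ≤ Real.log X ^ 5) (Y : ℝ) (hY1 : X / 8 ≤ Y) (hY2 : Y ≤ X) :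
    X ^ (1 - η) / 64 ≤ x * Y ^ c ∧ 2 ≤ X ^ (1 - η) / 64 ∧ x * Y ^ c ≤ (3 + 2 * Real.log X) ^ 5 * X ^ c := by
  have hX0 : 0 < X := by linarith
  have hY0 : 0 < Y := by linarith
  have hl : 0 ≤ Real.log X := Real.log_nonneg (by linarith)
  have hxp : 0 ≤ x := le_trans (by positivity) hx
  refine ⟨?_, ?_, ?_⟩
  · have h1 : (X / 8) ^ c ≤ Y ^ c := Real.rpow_le_rpow (by positivity) hY1 (by linarith)
    have h2 : X ^ c / 64 ≤ (X / 8) ^ c := by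
      rw [Real.div_rpow hX0.le (by norm_num)]
      have : (8 : ℝ) ^ c ≤ 8 ^ (2 : ℝ) := Real.rpow_le_rpow_of_exponent_le (by norm_num) hc2.le
      gcongr
      refine this.trans (le_of_eq ?_)
      rw [show (2 : ℝ) = ((2 : ℕ) : ℝ) by norm_num, Real.rpow_natCast]; norm_num
    calc X ^ (1 - η) / 64 = X ^ (1 - c - η) * (X ^ c / 64) := by
          rw [← mul_div_assoc, ← Real.rpow_add hX0]; congr 2; ring
      _ ≤ x * Y ^ c := mul_le_mul hx (h2.trans h1) (by positivity) hxp
  · have h1 : X ^ (1 / 2 : ℝ) ≤ X ^ (1 - η) := Real.rpow_le_rpow_of_exponent_le (by linarith) (by linarith)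
    have h2 : (128 : ℝ) ≤ X ^ (1 / 2 : ℝ) := by
      rw [← Real.sqrt_eq_rpow]; apply Real.le_sqrt_of_sq_le; norm_num; exact hX
    linarith
  · have h1 : Y ^ c ≤ X ^ c := Real.rpow_le_rpow hY0.le hY2 (by linarith)
    have h2 : Real.log X ^ 5 ≤ (3 + 2 * Real.log X) ^ 5 := pow_le_pow_left₀ hl (by linarith) 5
    exact mul_le_mul (hx2.trans h2) h1 (by positivity) (by positivity)

lemma box_cases (M N : ℕ) (G : ℕ → ℕ → ℂ)
    (h : (∑ m ∈ Finset.Ico M (2 * M), ∑ n ∈ Finset.Ico N (2 * N), G m n) ≠ 0) :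
    ∃ m n : ℕ, M ≤ m ∧ m < 2 * M ∧ N ≤ n ∧ n < 2 * N ∧ G m n ≠ 0 := by
  obtain ⟨m, hm, h1⟩ := Finset.exists_ne_zero_of_sum_ne_zero h
  obtain ⟨n, hn, h2⟩ := Finset.exists_ne_zero_of_sum_ne_zero h1
  rw [Finset.mem_Ico] at hm hn
  exact ⟨m, n, hm.1, hm.2, hn.1, hn.2, h2⟩

lemma box_size (X : ℝ) (M N m n : ℕ) (h1 : M ≤ m) (h2 : m < 2 * M) (h3 : N ≤ n) (h4 : n < 2 * N)
    (h5 : X / 2 < ((m * n : ℕ) : ℝ)) (h6 : ((m * n : ℕ) : ℝ) ≤ X) :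
    X / 8 ≤ (M : ℝ) * N ∧ (M : ℝ) * N ≤ X ∧ (M : ℝ) ≤ X ∧ (N : ℝ) ≤ X := by
  have hM : 1 ≤ M := by omega
  have hN : 1 ≤ N := by omega
  have h7 : M * N ≤ m * n := Nat.mul_le_mul h1 h3
  have h8 : m * n ≤ (2 * M) * (2 * N) := Nat.mul_le_mul h2.le h4.le
  have h7' : (M : ℝ) * N ≤ ((m * n : ℕ) : ℝ) := by exact_mod_cast h7
  have h8' : ((m * n : ℕ) : ℝ) ≤ (2 * M) * (2 * N) := by exact_mod_cast h8
  have hM' : (1 : ℝ) ≤ M := by exact_mod_cast hM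
  have hN' : (1 : ℝ) ≤ N := by exact_mod_cast hN
  refine ⟨by linarith, by linarith, by nlinarith, by nlinarith⟩

set_option maxHeartbeats 1600000 in
lemma II_global (c δ η : ℝ) (hc : 1 < c) (hδ : 0 < δ) (hδ1 : δ ≤ 1 / 15) (hcδ : c ≤ 2 - 8 * δ) (hη : 0 < η) (hηδ : η ≤ δ) :
    ∃ C > 0, ∀ X : ℝ, 16384 ≤ X → ∀ x : ℝ, X ^ (1 - c - η) ≤ x → x ≤ Real.log X ^ 5 → ∀ α β : ℕ → ℂ,
    (∀ m, ‖α m‖ ≤ 1) → (∀ n, ‖β n‖ ≤ 1) → (∀ m : ℕ, (m : ℝ) ≤ X ^ (4 * δ) → α m = 0) →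
    (∀ m : ℕ, (m : ℝ) ≤ X ^ (4 * δ) → β m = 0) → ∀ D : ℕ, (2 : ℝ) ^ D ≤ 2 * X →
    ‖∑ m ∈ Finset.range (2 ^ D), ∑ n ∈ Finset.range (2 ^ D), α m * β n * fX X c x (m * n)‖ ≤ C * X ^ (1 - δ + η / 2) := by
  obtain ⟨C, hC, H⟩ := boxII c hc η hη
  obtain ⟨C1, hC1, HL5⟩ := logpow η hη 5
  obtain ⟨C2, hC2, HL3⟩ := logpow (η / 4) (by positivity) 3
  refine ⟨C2 * (C * (C1 + 72)) ^ (1 / 8 : ℝ), by positivity, ?_⟩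
  intro X hX x hx hx2 α β hα hβ hα0 hβ0 D hD
  have hX0 : 0 < X := by linarith
  have hX1 : 1 ≤ X := by linarith
  have hl : 0 ≤ Real.log X := Real.log_nonneg hX1
  set L := 3 + 2 * Real.log X with hL
  have hL0 : 0 ≤ L := by linarith
  have hDL := D_le X hX1 D hD
  have hbox := dyad2_le (fun m n => α m * β n * fX X c x (m * n)) D (by simp [fX_zero X c x hX0.le])
    (by simp [fX_zero X c x hX0.le]) (L * (C * ((C1 + 72) * X ^ (8 - 8 * δ + 2 * η))) ^ (1 / 8 : ℝ)) ?_
  · refine hbox.trans ?_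
    have h1 : (C * ((C1 + 72) * X ^ (8 - 8 * δ + 2 * η))) ^ (1 / 8 : ℝ) = (C * (C1 + 72)) ^ (1 / 8 : ℝ) * X ^ (1 - δ + η / 4) := by
      rw [← mul_assoc, Real.mul_rpow (by positivity) (by positivity), ← Real.rpow_mul hX0.le]
      congr 2; ring
    rw [h1]
    calc (D : ℝ) ^ 2 * (L * ((C * (C1 + 72)) ^ (1 / 8 : ℝ) * X ^ (1 - δ + η / 4)))
        ≤ L ^ 2 * (L * ((C * (C1 + 72)) ^ (1 / 8 : ℝ) * X ^ (1 - δ + η / 4))) := by gcongr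
      _ = L ^ 3 * ((C * (C1 + 72)) ^ (1 / 8 : ℝ) * X ^ (1 - δ + η / 4)) := by ring
      _ ≤ (C2 * X ^ (η / 4)) * ((C * (C1 + 72)) ^ (1 / 8 : ℝ) * X ^ (1 - δ + η / 4)) := by
          gcongr; exact HL3 X hX1
      _ = C2 * (C * (C1 + 72)) ^ (1 / 8 : ℝ) * (X ^ (η / 4) * X ^ (1 - δ + η / 4)) := by ring
      _ = _ := by rw [← Real.rpow_add hX0]; congr 2; ring
  · intro M N hM hN
    by_cases hz : (∑ m ∈ Finset.Ico M (2 * M), ∑ n ∈ Finset.Ico N (2 * N), α m * β n * fX X c x (m * n)) = 0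
    · rw [hz, norm_zero]; positivity
    obtain ⟨m, n, hm1, hm2, hn1, hn2, hne⟩ := box_cases M N _ hz
    have hf := fX_ne X c x (m * n) (right_ne_zero_of_mul hne)
    have hαm : X ^ (4 * δ) < m := by
      by_contra h; exact (left_ne_zero_of_mul (left_ne_zero_of_mul hne)) (hα0 m (not_lt.mp h))
    have hβn : X ^ (4 * δ) < n := by
      by_contra h; exact (right_ne_zero_of_mul (left_ne_zero_of_mul hne)) (hβ0 n (not_lt.mp h))
    obtain ⟨hs1, hs2, hs3, hs4⟩ := box_size X M N m n hm1 hm2 hn1 hn2 hf.1 hf.2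
    obtain ⟨hF1, hF2, hF3⟩ := F_bounds c η hc (by linarith) hη (by linarith) X hX x hx hx2 _ hs1 hs2
    refine (H M N hM hN α β hα hβ X x hX0.le _ rfl (hF2.trans hF1)).trans ?_
    set F := x * ((M : ℝ) * N) ^ c with hF
    have hF0 : 0 < F := by linarith
    have hM0 : (0 : ℝ) < M := by exact_mod_cast hM
    have hN0 : (0 : ℝ) < N := by exact_mod_cast hN
    refine mul_le_mul (two_log_le X hX1 N hN hs4) ?_ (by positivity) hL0
    refine Real.rpow_le_rpow (by positivity) ?_ (by norm_num)
    refine mul_le_mul_of_nonneg_left ?_ hC.le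
    have hP0 : 0 < X ^ (4 * δ) := by positivity
    have hm2' : (m : ℝ) < 2 * M := by exact_mod_cast hm2
    have hn2' : (n : ℝ) < 2 * N := by exact_mod_cast hn2
    have hXX : X ^ (2 - 8 * δ) * (X ^ (4 * δ)) ^ 2 = X ^ 2 := by
      rw [← Real.rpow_natCast (X ^ (4 * δ)), ← Real.rpow_mul hX0.le, ← Real.rpow_add hX0, ← Real.rpow_natCast]
      congr 1; push_cast; ring
    have hsq : ∀ u v : ℝ, 0 < u → 0 < v → u * v ≤ X → X ^ (4 * δ) < 2 * v → u ^ 2 ≤ 4 * X ^ (2 - 8 * δ) := by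
      intro u v hu hv huv hv2
      have h1 : u * X ^ (4 * δ) ≤ 2 * X := by nlinarith
      have h2 : (u * X ^ (4 * δ)) ^ 2 ≤ (2 * X) ^ 2 := by gcongr
      rw [mul_pow, mul_pow, ← hXX] at h2
      have h3 : 0 < (X ^ (4 * δ)) ^ 2 := by positivity
      nlinarith
    have hM2 := hsq M N hM0 hN0 hs2 (by linarith)
    have hN2 := hsq N M hN0 hM0 (by linarith) (by linarith)
    have hge : X ^ (2 - 8 * δ) ≤ X ^ (2 - 8 * δ + η) := Real.rpow_le_rpow_of_exponent_le hX1 (by linarith)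
    have hFu : F ≤ C1 * X ^ (2 - 8 * δ + η) := by
      refine hF3.trans ((mul_le_mul_of_nonneg_right (HL5 X hX1) (by positivity)).trans ?_)
      rw [mul_assoc, ← Real.rpow_add hX0]
      refine mul_le_mul_of_nonneg_left (Real.rpow_le_rpow_of_exponent_le hX1 (by linarith)) hC1.le
    have hlast : ((M : ℝ) * N) ^ 2 / F ≤ 64 * X ^ (2 - 8 * δ + η) := by
      calc ((M : ℝ) * N) ^ 2 / F ≤ X ^ 2 / (X ^ (1 - η) / 64) := by gcongr
        _ = 64 * X ^ (1 + η) := by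
            rw [div_div_eq_mul_div, div_eq_iff (by positivity), mul_assoc, ← Real.rpow_add hX0]
            rw [mul_comm, ← Real.rpow_natCast]; congr 2; push_cast; ring
        _ ≤ _ := by
            refine mul_le_mul_of_nonneg_left (Real.rpow_le_rpow_of_exponent_le hX1 (by linarith)) (by norm_num)
    have h1 : ((M : ℝ) * N) ^ (6 + η) ≤ X ^ (6 + η) := Real.rpow_le_rpow (by positivity) hs2 (by linarith)
    have h2 : F + (M : ℝ) ^ 2 + (N : ℝ) ^ 2 + ((M : ℝ) * N) ^ 2 / F ≤ (C1 + 72) * X ^ (2 - 8 * δ + η) := by linarith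
    refine (mul_le_mul h1 h2 (by positivity) (by positivity)).trans (le_of_eq ?_)
    rw [mul_left_comm, ← Real.rpow_add hX0]; congr 2; ring

lemma mulw_contDiff (w g : ℝ → ℝ) (hw : ContDiff ℝ 2 w) (hs : tsupport w ⊆ Set.Ioo (1 / 2) 3)
    (hg : ∀ v : ℝ, v ≠ 0 → ContDiffAt ℝ 2 g v) : ContDiff ℝ 2 (fun v => w v * g v) := by
  rw [contDiff_iff_contDiffAt]
  intro v
  by_cases hv : v = 0
  · have h1 : v ∉ tsupport (fun v => w v * g v) := by
      intro h
      have := hs (tsupport_mul_subset_left h)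
      rw [hv] at this; norm_num at this
    rw [notMem_tsupport_iff_eventuallyEq] at h1
    exact contDiffAt_const.congr_of_eventuallyEq h1
  · exact hw.contDiffAt.mul (hg v hv)

lemma mulw_supp (w g : ℝ → ℝ) (hs : tsupport w ⊆ Set.Ioo (1 / 2) 3) :
    tsupport (fun v => w v * g v) ⊆ Set.Ioo (1 / 2) 3 :=
  (tsupport_mul_subset_left (f := w) (g := g)).trans hs

lemma Ssum_deriv (c : ℝ) (w : ℝ → ℝ) (hs : tsupport w ⊆ Set.Ioo (1 / 2) 3) (N : ℝ) (hN : 1 ≤ N) (ξ t : ℝ) :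
    HasDerivAt (Ssum c w N 0 ξ) (2 * Real.pi * Complex.I * Ssum c (fun v => w v * v ^ c) N 0 ξ t) t := by
  obtain ⟨K, hK⟩ := exists_nat_ge (3 * N)
  have h1 : Ssum c w N 0 ξ = fun t => ∑ j ∈ Finset.range K, fS c w N ξ t (0 + j) := by
    funext t
    exact Ssum_fin (by linarith) (by norm_num) hs ⟨le_rfl, zero_le_one⟩ K hK t
  rw [h1, Ssum_fin (by linarith) (by norm_num) (mulw_supp w (fun v => v ^ c) hs) ⟨le_rfl, zero_le_one⟩ K hK t, Finset.mul_sum]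
  refine HasDerivAt.fun_sum fun j _ => ?_
  unfold fS
  have h2 : HasDerivAt (fun t : ℝ => t * ((0 + j) / N) ^ c + ξ * (0 + j)) (1 * ((0 + j) / N) ^ c) t :=
    ((hasDerivAt_id t).mul_const _).add_const _
  have h3 := ((e_hasDerivAt _).scomp t h2).const_mul (w ((0 + j) / N) : ℂ)
  refine HasDerivAt.congr_deriv h3 ?_
  simp only [Complex.real_smul]
  push_cast
  ring

lemma sob (f f' : ℝ → ℂ) (hf : ∀ t, HasDerivAt f (f' t) t) (hc : Continuous f') (t : ℝ) :
    ‖f t‖ ≤ ∫ u in t..(t + 1), (‖f u‖ + ‖f' u‖) := by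
  have hfc : Continuous f := continuous_iff_continuousAt.mpr fun t => (hf t).continuousAt
  have h1 : ∀ u : ℝ, HasDerivAt (fun u : ℝ => (((t + 1 - u : ℝ)) : ℂ) * f u) (-f u + ((t + 1 - u : ℝ) : ℂ) * f' u) u := by
    intro u
    have h2 : HasDerivAt (fun u : ℝ => ((t + 1 - u : ℝ) : ℂ)) (((0 - 1 : ℝ)) : ℂ) u :=
      HasDerivAt.ofReal_comp ((hasDerivAt_const u (t + 1)).sub (hasDerivAt_id u))
    refine HasDerivAt.congr_deriv (h2.mul (hf u)) ?_
    push_cast; ring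
  have h3 := intervalIntegral.integral_eq_sub_of_hasDerivAt (a := t) (b := t + 1) (fun u _ => h1 u) (by
    apply Continuous.intervalIntegrable; fun_prop)
  simp only [sub_self, Complex.ofReal_zero, zero_mul, zero_sub, add_sub_cancel_left, Complex.ofReal_one, one_mul] at h3
  rw [← norm_neg, ← h3]
  refine intervalIntegral.norm_integral_le_of_norm_le (by linarith) (Filter.Eventually.of_forall fun u hu => ?_) (by
    apply Continuous.intervalIntegrable; fun_prop)
  refine (norm_add_le _ _).trans ?_
  rw [norm_neg, norm_mul, Complex.norm_real]
  gcongr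
  refine mul_le_of_le_one_left (norm_nonneg _) ?_
  rw [Set.mem_Ioc] at hu
  rw [Real.norm_eq_abs, abs_le]; constructor <;> linarith

lemma young4 (g l : ℝ) (hg : 0 ≤ g) (hl : 0 < l) : g ≤ g ^ 4 / l ^ 3 + l := by
  rcases le_or_gt g l with h | h
  · have : 0 ≤ g ^ 4 / l ^ 3 := by positivity
    linarith
  · have : g ≤ g ^ 4 / l ^ 3 := by
      rw [le_div_iff₀ (by positivity)]
      have : l ^ 3 ≤ g ^ 3 := by gcongr
      nlinarith
    linarith

noncomputable def Wf (θ N T : ℝ) : ℝ := (T ^ 2 + N ^ 2 * T) * (1 + T / N) ^ θ + N ^ 4 / T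

lemma Wf_two (θ N T : ℝ) (hθ : 0 ≤ θ) (hN : 0 < N) (hT : 0 < T) : Wf θ N (2 * T) ≤ (4 * 2 ^ θ) * Wf θ N T := by
  unfold Wf
  have h1 : (1 + 2 * T / N) ^ θ ≤ 2 ^ θ * (1 + T / N) ^ θ := by
    rw [← Real.mul_rpow (by norm_num) (by positivity)]
    refine Real.rpow_le_rpow (by positivity) ?_ hθ
    rw [mul_add, mul_div_assoc]; linarith
  have h2 : (1 : ℝ) ≤ 2 ^ θ := Real.one_le_rpow (by norm_num) hθ
  have h3 : ((2 * T) ^ 2 + N ^ 2 * (2 * T)) * (1 + 2 * T / N) ^ θ ≤ (4 * (T ^ 2 + N ^ 2 * T)) * (2 ^ θ * (1 + T / N) ^ θ) := by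
    refine mul_le_mul ?_ h1 (by positivity) (by positivity)
    nlinarith [mul_pos (pow_pos hN 2) hT]
  have h4 : N ^ 4 / (2 * T) ≤ (4 * 2 ^ θ) * (N ^ 4 / T) := by
    have : N ^ 4 / (2 * T) = (1 / 2) * (N ^ 4 / T) := by field_simp
    rw [this]
    refine mul_le_mul_of_nonneg_right (by linarith) (by positivity)
  linarith

lemma core2 (θ : ℝ) (hθ : 0 < θ) (c : ℝ) (hc : 1 < c) (w : ℝ → ℝ) (hw : ContDiff ℝ 2 w)
    (hs : tsupport w ⊆ Set.Ioo (1 / 2) 3) : ∃ C > 0, ∀ ξ ∈ Set.Icc (0 : ℝ) 1, ∀ N : ℝ, 1 ≤ N → ∀ T : ℝ, 1 ≤ T →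
    ∫ t in T..4 * T, ‖Ssum c w N 0 ξ t‖ ^ 4 ≤ C * Wf θ N T := by
  obtain ⟨C, hC, H⟩ := core θ hθ.le (PP_all θ hθ) c hc w hw (1 / 2) 3 (by norm_num) (by norm_num) hs
  refine ⟨C * (1 + 4 * 2 ^ θ), by positivity, fun ξ hξ N hN T hT => ?_⟩
  have hcont : Continuous (fun t => ‖Ssum c w N 0 ξ t‖ ^ 4) :=
    (Ssum_cont (α := c) (ξ := ξ) (by linarith) (by norm_num) hs ⟨le_rfl, zero_le_one⟩).norm.pow 4
  have h1 := H 0 ⟨le_rfl, zero_le_one⟩ ξ hξ N hN T hT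
  have h2 := H 0 ⟨le_rfl, zero_le_one⟩ ξ hξ N hN (2 * T) (by linarith)
  rw [← intervalIntegral.integral_add_adjacent_intervals (b := 2 * T) (hcont.intervalIntegrable _ _) (hcont.intervalIntegrable _ _)]
  rw [show 2 * (2 * T) = 4 * T by ring] at h2
  have h3 := mul_le_mul_of_nonneg_left (Wf_two θ N T hθ.le (by linarith) (by linarith)) hC.le
  unfold Wf at *
  linarith

lemma typeI (θ : ℝ) (hθ : 0 < θ) (c : ℝ) (hc : 1 < c) (hc2 : c < 2) (w : ℝ → ℝ) (hw : ContDiff ℝ 2 w)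
    (hs : tsupport w ⊆ Set.Ioo (1 / 2) 3) : ∃ C > 0, ∀ ξ ∈ Set.Icc (0 : ℝ) 1, ∀ N : ℝ, 1 ≤ N → ∀ M : ℕ, 1 ≤ M →
    ∀ T : ℝ, (M : ℝ) ≤ T → ∑ m ∈ Finset.Ico M (2 * M), ‖Ssum c w N 0 ξ (T * ((m : ℝ) / M) ^ c)‖ ≤
      C * (M * (Wf θ N T / M) ^ (1 / 4 : ℝ)) := by
  have hgc : ∀ v : ℝ, v ≠ 0 → ContDiffAt ℝ 2 (fun v : ℝ => v ^ c) v := fun v hv =>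
    Real.contDiffAt_rpow_const_of_ne hv
  have hs1 := mulw_supp w (fun v => v ^ c) hs
  obtain ⟨C0, hC0, H0⟩ := core2 θ hθ c hc w hw hs
  obtain ⟨C1, hC1, H1⟩ := core2 θ hθ c hc _ (mulw_contDiff w (fun v => v ^ c) hw hs hgc) hs1
  refine ⟨2 + C0 + (2 * Real.pi) ^ 4 * C1, by positivity, fun ξ hξ N hN M hM T hT => ?_⟩
  have hM' : (1 : ℝ) ≤ M := by exact_mod_cast hM
  have hM0 : (0 : ℝ) < M := by linarith
  have hT0 : 0 < T := by linarith
  have hN0 : 0 < N := by linarith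
  have hW0 : 0 < Wf θ N T := by unfold Wf; positivity
  set l := (Wf θ N T / M) ^ (1 / 4 : ℝ) with hl
  have hl0 : 0 < l := by positivity
  have hl4 : Wf θ N T = l ^ 4 * M := by
    rw [hl, ← Real.rpow_natCast, ← Real.rpow_mul (by positivity)]; norm_num; field_simp
  set f := Ssum c w N 0 ξ with hf
  set f1 := Ssum c (fun v => w v * v ^ c) N 0 ξ with hf1
  have hfc : Continuous f := Ssum_cont hN0 (by norm_num) hs ⟨le_rfl, zero_le_one⟩
  have hf1c : Continuous f1 := Ssum_cont hN0 (by norm_num) hs1 ⟨le_rfl, zero_le_one⟩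
  set g : ℝ → ℝ := fun u => ‖f u‖ ^ 4 + (2 * Real.pi) ^ 4 * ‖f1 u‖ ^ 4 with hg
  have hgcn : Continuous g := by fun_prop
  have hg0 : ∀ u, 0 ≤ g u := fun u => by positivity
  have hpt : ∀ t, ‖f t‖ ≤ 2 * l + (∫ u in t..(t + 1), g u) / l ^ 3 := by
    intro t
    refine (sob f (fun t => 2 * Real.pi * Complex.I * f1 t) (fun t => Ssum_deriv c w hs N hN ξ t) (by fun_prop) t).trans ?_
    have h1 : ∫ u in t..(t + 1), (‖f u‖ + ‖2 * Real.pi * Complex.I * f1 u‖) ≤ ∫ u in t..(t + 1), (2 * l + g u / l ^ 3) := by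
      refine intervalIntegral.integral_mono_on (by linarith) (by apply Continuous.intervalIntegrable; fun_prop)
        (by apply Continuous.intervalIntegrable; fun_prop) fun u _ => ?_
      have h2 := young4 ‖f u‖ l (norm_nonneg _) hl0
      have h3 := young4 ‖2 * Real.pi * Complex.I * f1 u‖ l (norm_nonneg _) hl0
      have h4 : ‖2 * Real.pi * Complex.I * f1 u‖ ^ 4 = (2 * Real.pi) ^ 4 * ‖f1 u‖ ^ 4 := by
        rw [norm_mul, mul_pow]; congr 2
        simp [abs_of_pos Real.pi_pos]
      rw [h4] at h3
      simp only [hg, add_div]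
      linarith
    refine h1.trans (le_of_eq ?_)
    rw [intervalIntegral.integral_add (by simp) (by apply Continuous.intervalIntegrable; fun_prop)]
    simp
  set τ : ℕ → ℝ := fun m => T * ((m : ℝ) / M) ^ c with hτ
  have hstep : ∀ m ≥ M, τ m + 1 ≤ τ (m + 1) := by
    intro m hm
    have hm' : (M : ℝ) ≤ m := by exact_mod_cast hm
    have hm0 : (0 : ℝ) < m := by linarith
    have h1 : ((m + 1 : ℕ) : ℝ) / M = (m : ℝ) / M * (1 + 1 / m) := by push_cast; field_simp
    have h2 : (1 : ℝ) ≤ m / M := (one_le_div hM0).mpr hm'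
    have h3 : (m : ℝ) / M ≤ ((m : ℝ) / M) ^ c := by
      conv_lhs => rw [← Real.rpow_one ((m : ℝ) / M)]
      exact Real.rpow_le_rpow_of_exponent_le h2 hc.le
    have h4 : 1 + 1 / (m : ℝ) ≤ (1 + 1 / (m : ℝ)) ^ c := by
      conv_lhs => rw [← Real.rpow_one (1 + 1 / (m : ℝ))]
      exact Real.rpow_le_rpow_of_exponent_le (by simp) hc.le
    simp only [hτ]
    rw [h1, Real.mul_rpow (by positivity) (by positivity)]
    have h5 : ((m : ℝ) / M) ^ c * (1 + 1 / m) ≤ ((m : ℝ) / M) ^ c * (1 + 1 / (m : ℝ)) ^ c := by gcongr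
    have h6 : 1 / (M : ℝ) ≤ ((m : ℝ) / M) ^ c * (1 / m) := by
      refine le_trans (le_of_eq ?_) (mul_le_mul_of_nonneg_right h3 (by positivity))
      field_simp
    have h7 : ((m : ℝ) / M) ^ c + 1 / M ≤ ((m : ℝ) / M) ^ c * (1 + 1 / (m : ℝ)) ^ c := by linarith
    have h8 := mul_le_mul_of_nonneg_left h7 hT0.le
    have h9 : 1 ≤ T * (1 / M) := by rw [mul_one_div, one_le_div hM0]; exact hT
    linarith
  have hpt2 : ∀ m ∈ Finset.Ico M (2 * M), ‖f (τ m)‖ ≤ 2 * l + (∫ u in τ m..τ (m + 1), g u) / l ^ 3 := by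
    intro m hm
    refine (hpt (τ m)).trans ?_
    have := intervalIntegral.integral_mono_interval le_rfl (by linarith : τ m ≤ τ m + 1) (hstep m (Finset.mem_Ico.mp hm).1)
      (Filter.Eventually.of_forall hg0) (hgcn.intervalIntegrable (μ := volume) (τ m) (τ (m + 1)))
    gcongr
  have hsum : ∑ m ∈ Finset.Ico M (2 * M), ∫ u in τ m..τ (m + 1), g u = ∫ u in τ M..τ (2 * M), g u :=
    intervalIntegral.sum_integral_adjacent_intervals_Ico (by omega) fun k _ => hgcn.intervalIntegrable _ _
  have hτM : τ M = T := by simp only [hτ]; rw [div_self hM0.ne', Real.one_rpow, mul_one]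
  have hτ2M : τ (2 * M) ≤ 4 * T := by
    simp only [hτ]
    push_cast
    rw [mul_div_assoc, div_self hM0.ne', mul_one]
    have : (2 : ℝ) ^ c ≤ 2 ^ (2 : ℝ) := Real.rpow_le_rpow_of_exponent_le (by norm_num) hc2.le
    have h4 : (2 : ℝ) ^ (2 : ℝ) = 4 := by norm_num
    nlinarith
  have hτ2M' : T ≤ τ (2 * M) := by
    simp only [hτ]
    push_cast
    rw [mul_div_assoc, div_self hM0.ne', mul_one]
    have : (1 : ℝ) ≤ 2 ^ c := Real.one_le_rpow (by norm_num) (by linarith)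
    nlinarith
  have hint : ∫ u in τ M..τ (2 * M), g u ≤ (C0 + (2 * Real.pi) ^ 4 * C1) * Wf θ N T := by
    rw [hτM]
    have h1 := intervalIntegral.integral_mono_interval le_rfl hτ2M' hτ2M
      (Filter.Eventually.of_forall hg0) (hgcn.intervalIntegrable (μ := volume) T (4 * T))
    refine h1.trans ?_
    rw [hg, intervalIntegral.integral_add (by apply Continuous.intervalIntegrable; fun_prop) (by apply Continuous.intervalIntegrable; fun_prop),
      intervalIntegral.integral_const_mul, add_mul, mul_assoc]
    exact add_le_add (H0 ξ hξ N hN T (by linarith)) (mul_le_mul_of_nonneg_left (H1 ξ hξ N hN T (by linarith)) (by positivity))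
  refine (Finset.sum_le_sum hpt2).trans ?_
  rw [Finset.sum_add_distrib, ← Finset.sum_div, hsum, Finset.sum_const, Nat.card_Ico, nsmul_eq_mul,
    show 2 * M - M = M by omega]
  have h1 : (∫ u in τ M..τ (2 * M), g u) / l ^ 3 ≤ (C0 + (2 * Real.pi) ^ 4 * C1) * (l * M) := by
    rw [div_le_iff₀ (by positivity)]
    refine hint.trans (le_of_eq ?_)
    rw [hl4]; ring
  linarith

lemma boxI (θ : ℝ) (hθ : 0 < θ) (c : ℝ) (hc : 1 < c) (hc2 : c < 2) (g : ℝ → ℝ)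
    (hg : ∀ v : ℝ, v ≠ 0 → ContDiffAt ℝ 2 g v) : ∃ C > 0, ∀ M N : ℕ, 1 ≤ M → 1 ≤ N → ∀ a : ℕ → ℂ, (∀ m, ‖a m‖ ≤ 1) →
    ∀ X x : ℝ, 0 ≤ X → ∀ T : ℝ, T = x * ((M : ℝ) * N) ^ c → (M : ℝ) ≤ T →
    ‖∑ m ∈ Finset.Ico M (2 * M), ∑ n ∈ Finset.Ico N (2 * N), a m * (g (n / N) : ℂ) * fX X c x (m * n)‖ ≤
      (2 + Real.log (4 * N)) * (C * (M * (Wf θ N T / M) ^ (1 / 4 : ℝ))) := by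
  have hs0 : tsupport (bump 2) ⊆ Set.Ioo (1 / 2) 3 := (bump_supp 2).trans (by norm_num)
  have hs := mulw_supp (bump 2) g hs0
  obtain ⟨C, hC, H⟩ := typeI θ hθ c hc hc2 _ (mulw_contDiff (bump 2) g (bump_contDiff 2) hs0 hg) hs
  refine ⟨C, hC, fun M N hM hN a ha X x hX T hT hMT => ?_⟩
  have hN' : (1 : ℝ) ≤ N := by exact_mod_cast hN
  have hN0 : (0 : ℝ) < N := by linarith
  have hM0 : (0 : ℝ) < M := by exact_mod_cast hM
  set w : ℝ → ℝ := fun v => bump 2 v * g v with hw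
  set q := 4 * N with hq
  have hq0 : (0 : ℝ) < q := by exact_mod_cast (by omega : 0 < q)
  have hcut := fun m : ℕ => cut q (by omega) (max (⌊X / 2 / m⌋₊ + 1) N) (min (⌊X / m⌋₊ + 1) (2 * N))
  choose z hz1 hz2 using hcut
  have hinner : ∀ m ∈ Finset.Ico M (2 * M), ∑ n ∈ Finset.Ico N (2 * N), a m * (g (n / N) : ℂ) * fX X c x (m * n) =
      a m * ∑ h ∈ Finset.range q, z m h * Ssum c w N 0 ((h : ℝ) / q) (T * ((m : ℝ) / M) ^ c) := by
    intro m hm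
    rw [Finset.mem_Ico] at hm
    have hphase : ∀ n : ℕ, ((m : ℝ) * n) ^ c * x = T * ((m : ℝ) / M) ^ c * ((n : ℝ) / N) ^ c := by
      intro n
      rw [hT, Real.mul_rpow (by positivity) (by positivity), Real.mul_rpow (by positivity) (by positivity),
        Real.div_rpow (by positivity) (by positivity), Real.div_rpow (by positivity) (by positivity)]
      have h1 : (0 : ℝ) < (M : ℝ) ^ c := by positivity
      have h2 : (0 : ℝ) < (N : ℝ) ^ c := by positivity
      field_simp
    have h1 : ∑ h ∈ Finset.range q, z m h * Ssum c w N 0 ((h : ℝ) / q) (T * ((m : ℝ) / M) ^ c) =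
       ∑ n ∈ Finset.range q, (if max (⌊X / 2 / m⌋₊ + 1) N ≤ n ∧ n < min (⌊X / m⌋₊ + 1) (2 * N) then (1 : ℂ) else 0) *
         ((w (n / N) : ℂ) * e (((m : ℝ) * n) ^ c * x)) := by
      have h2 : ∀ n ∈ Finset.range q, (if max (⌊X / 2 / m⌋₊ + 1) N ≤ n ∧ n < min (⌊X / m⌋₊ + 1) (2 * N) then (1 : ℂ) else 0) *
         ((w (n / N) : ℂ) * e (((m : ℝ) * n) ^ c * x)) = ∑ h ∈ Finset.range q, z m h * fS c w N ((h : ℝ) / q) (T * ((m : ℝ) / M) ^ c) (0 + n) := by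
        intro n hn
        rw [← hz2 m n (Finset.mem_range.mp hn), Finset.sum_mul]
        refine Finset.sum_congr rfl fun h _ => ?_
        unfold fS
        rw [zero_add, e_add, hphase n]; ring
      rw [Finset.sum_congr rfl h2, Finset.sum_comm]
      refine Finset.sum_congr rfl fun h _ => ?_
      rw [Ssum_fin hN0 (by norm_num) hs ⟨le_rfl, zero_le_one⟩ q (by rw [hq]; push_cast; linarith), Finset.mul_sum]
    rw [h1, Finset.mul_sum]
    have hsub : Finset.Ico N (2 * N) ⊆ Finset.range q := by
      intro n hn; rw [Finset.mem_Ico] at hn; rw [Finset.mem_range]; omega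
    rw [← Finset.sum_subset hsub]
    · refine Finset.sum_congr rfl fun n hn => ?_
      rw [Finset.mem_Ico] at hn
      rw [fX_mul_cut X c x hX m n (by omega)]
      have hb : bump 2 ((n : ℝ) / N) = 1 := by
        have h3 : (N : ℝ) ≤ n := by exact_mod_cast hn.1
        have h4 : (n : ℝ) ≤ 2 * N := by exact_mod_cast hn.2.le
        exact bump_one ((one_le_div hN0).mpr h3) ((div_le_iff₀ hN0).mpr h4)
      have hiff : (max (⌊X / 2 / m⌋₊ + 1) N ≤ n ∧ n < min (⌊X / m⌋₊ + 1) (2 * N)) ↔ (⌊X / 2 / m⌋₊ + 1 ≤ n ∧ n < ⌊X / m⌋₊ + 1) := by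
        rw [max_le_iff, lt_min_iff]; tauto
      simp only [hiff, hw, hb, one_mul]
      ring
    · intro n _ hn
      rw [Finset.mem_Ico] at hn
      rw [if_neg]
      · simp
      · rw [max_le_iff, lt_min_iff]; tauto
  rw [Finset.sum_congr rfl hinner]
  have h2 : ∀ m ∈ Finset.Ico M (2 * M), ‖a m * ∑ h ∈ Finset.range q, z m h * Ssum c w N 0 ((h : ℝ) / q) (T * ((m : ℝ) / M) ^ c)‖ ≤
      ∑ h ∈ Finset.range q, kap q h * ‖Ssum c w N 0 ((h : ℝ) / q) (T * ((m : ℝ) / M) ^ c)‖ := by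
    intro m _
    rw [norm_mul]
    refine (mul_le_of_le_one_left (norm_nonneg _) (ha m)).trans ((norm_sum_le _ _).trans (Finset.sum_le_sum fun h hh => ?_))
    rw [norm_mul]
    exact mul_le_mul_of_nonneg_right (hz1 m h (Finset.mem_range.mp hh)) (norm_nonneg _)
  refine (norm_sum_le _ _).trans ((Finset.sum_le_sum h2).trans ?_)
  rw [Finset.sum_comm]
  have hT0 : 0 < T := by linarith
  have hW0 : 0 < Wf θ N T := by unfold Wf; positivity
  have h3 : ∀ h ∈ Finset.range q, ∑ m ∈ Finset.Ico M (2 * M), kap q h * ‖Ssum c w N 0 ((h : ℝ) / q) (T * ((m : ℝ) / M) ^ c)‖ ≤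
      kap q h * (C * (M * (Wf θ N T / M) ^ (1 / 4 : ℝ))) := by
    intro h hh
    rw [Finset.mem_range] at hh
    rw [← Finset.mul_sum]
    refine mul_le_mul_of_nonneg_left (H _ ⟨by positivity, ?_⟩ N hN' M hM T hMT) (kap_pos q h hh).le
    rw [div_le_one hq0]; exact_mod_cast hh.le
  refine (Finset.sum_le_sum h3).trans ?_
  rw [← Finset.sum_mul]
  refine mul_le_mul_of_nonneg_right ?_ (by positivity)
  have := kap_sum q (by omega)
  rw [hq] at this
  push_cast at this
  exact this

lemma boxI2 (θ : ℝ) (hθ : 0 < θ) (c : ℝ) (hc : 1 < c) (hc2 : c < 2) : ∃ C > 0, ∀ M N : ℕ, 1 ≤ M → 1 ≤ N →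
    ∀ a b : ℕ → ℂ, (∀ m, ‖a m‖ ≤ 1) → (b = (fun _ => 1) ∨ b = (fun n : ℕ => (Real.log n : ℂ))) →
    ∀ X x : ℝ, 1 ≤ X → (N : ℝ) ≤ X → ∀ T : ℝ, T = x * ((M : ℝ) * N) ^ c → (M : ℝ) ≤ T →
    ‖∑ m ∈ Finset.Ico M (2 * M), ∑ n ∈ Finset.Ico N (2 * N), a m * b n * fX X c x (m * n)‖ ≤
      (4 + 2 * Real.log X) ^ 2 * (C * (M * (Wf θ N T / M) ^ (1 / 4 : ℝ))) := by
  obtain ⟨C1, hC1, H1⟩ := boxI θ hθ c hc hc2 (fun _ => 1) (fun v _ => contDiffAt_const)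
  obtain ⟨C2, hC2, H2⟩ := boxI θ hθ c hc hc2 Real.log (fun v hv => Real.contDiffAt_log.mpr hv)
  refine ⟨C1 + C2, by positivity, fun M N hM hN a b ha hb X x hX hNX T hT hMT => ?_⟩
  have hN' : (1 : ℝ) ≤ N := by exact_mod_cast hN
  have hN0 : (0 : ℝ) < N := by linarith
  have hM0 : (0 : ℝ) < M := by exact_mod_cast hM
  have hT0 : 0 < T := by linarith
  have hW0 : 0 < Wf θ N T := by unfold Wf; positivity
  set Y := (M : ℝ) * (Wf θ N T / M) ^ (1 / 4 : ℝ) with hY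
  have hY0 : 0 < Y := by positivity
  have h1 := H1 M N hM hN a ha X x (by linarith) T hT hMT
  have h2 := H2 M N hM hN a ha X x (by linarith) T hT hMT
  have hlN : 0 ≤ Real.log N := Real.log_nonneg hN'
  have hlNX : Real.log N ≤ Real.log X := Real.log_le_log hN0 hNX
  have hl4 : Real.log (4 * N) = 2 * Real.log 2 + Real.log N := by
    rw [Real.log_mul (by norm_num) hN0.ne', show (4 : ℝ) = 2 ^ 2 by norm_num, Real.log_pow]; push_cast; ring
  have hl2 := Real.log_two_lt_d9
  have hl2' := Real.log_two_gt_d9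
  set L := 4 + 2 * Real.log X with hL
  have hq : 2 + Real.log (4 * N) ≤ L := by linarith
  have hq0 : 0 ≤ 2 + Real.log (4 * N) := by linarith
  have hL1 : 1 ≤ L := by linarith
  rcases hb with rfl | rfl
  · simp only [Complex.ofReal_one] at h1
    refine h1.trans ?_
    calc (2 + Real.log (4 * N)) * (C1 * Y) ≤ L * ((C1 + C2) * Y) := by gcongr; linarith
      _ = L * 1 * ((C1 + C2) * Y) := by ring
      _ ≤ L * L * ((C1 + C2) * Y) := by gcongr
      _ = _ := by ring
  · have hsplit : ∑ m ∈ Finset.Ico M (2 * M), ∑ n ∈ Finset.Ico N (2 * N), a m * (Real.log n : ℂ) * fX X c x (m * n) =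
      (Real.log N : ℂ) * (∑ m ∈ Finset.Ico M (2 * M), ∑ n ∈ Finset.Ico N (2 * N), a m * ((1 : ℝ) : ℂ) * fX X c x (m * n)) +
      ∑ m ∈ Finset.Ico M (2 * M), ∑ n ∈ Finset.Ico N (2 * N), a m * (Real.log (n / N) : ℂ) * fX X c x (m * n) := by
      simp_rw [Finset.mul_sum]
      rw [← Finset.sum_add_distrib]
      refine Finset.sum_congr rfl fun m _ => ?_
      rw [← Finset.sum_add_distrib]
      refine Finset.sum_congr rfl fun n hn => ?_
      rw [Finset.mem_Ico] at hn
      have hn0 : (n : ℝ) ≠ 0 := by exact_mod_cast (by omega : n ≠ 0)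
      rw [Real.log_div hn0 hN0.ne']
      push_cast; ring
    rw [hsplit]
    refine (norm_add_le _ _).trans ?_
    rw [norm_mul, Complex.norm_real, Real.norm_of_nonneg hlN]
    calc _ ≤ Real.log N * ((2 + Real.log (4 * N)) * (C1 * Y)) + (2 + Real.log (4 * N)) * (C2 * Y) := by gcongr
      _ ≤ L * (L * (C1 * Y)) + L * (C2 * Y) := by gcongr; linarith
      _ = L * (L * (C1 * Y)) + L * (1 * (C2 * Y)) := by ring
      _ ≤ L * (L * (C1 * Y)) + L * (L * (C2 * Y)) := by gcongr
      _ = _ := by ring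

lemma rpow_le_of_le' {X a b : ℝ} (hX : 1 ≤ X) (h : a ≤ b) : X ^ a ≤ X ^ b := Real.rpow_le_rpow_of_exponent_le hX h

/-- the main numerical estimate for the type I boxes -/
lemma I_num (c δ η : ℝ) (hc : 1 < c) (hδ : 0 < δ) (hδ1 : δ ≤ 1 / 15) (hcδ : c ≤ 2 - 8 * δ) (hη : 0 < η) (hηδ : η ≤ δ) :
    ∃ C > 0, ∀ X : ℝ, 16384 ≤ X → ∀ M N T : ℝ, 1 ≤ M → 1 ≤ N → M * N ≤ X → M ≤ X ^ (4 * δ) → X ^ (1 - η) / 64 ≤ T →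
      2 ≤ X ^ (1 - η) / 64 → T ≤ (3 + 2 * Real.log X) ^ 5 * X ^ c →
      M * (Wf (η / 4) N T / M) ^ (1 / 4 : ℝ) ≤ C * X ^ (1 - δ + 3 * η / 8) := by
  obtain ⟨C1, hC1, HL⟩ := logpow (η / 4) (by positivity) 5
  set A := (1 + C1) ^ (η / 4) with hA
  have hA0 : 0 < A := by positivity
  set C := (C1 ^ 2 + C1) * A + 64 with hCd
  refine ⟨C ^ (1 / 4 : ℝ), by positivity, ?_⟩
  intro X hX M N T hM hN hMN hMP hT1 hT2 hT3
  have hX0 : 0 < X := by linarith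
  have hX1 : 1 ≤ X := by linarith
  have hM0 : 0 < M := by linarith
  have hN0 : 0 < N := by linarith
  have hT0 : 0 < T := by linarith
  have hTu : T ≤ C1 * X ^ (2 - 8 * δ + η / 4) := by
    refine hT3.trans ((mul_le_mul_of_nonneg_right (HL X hX1) (by positivity)).trans ?_)
    rw [mul_assoc, ← Real.rpow_add hX0]
    exact mul_le_mul_of_nonneg_left (rpow_le_of_le' hX1 (by linarith)) hC1.le
  have hth : (1 + T / N) ^ (η / 4) ≤ A * X ^ (3 * η / 4) := by
    have h1 : 1 + T / N ≤ (1 + C1) * X ^ (3 : ℝ) := by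
      have h2 : T / N ≤ T := div_le_self hT0.le hN
      have h3 : T ≤ C1 * X ^ (3 : ℝ) := hTu.trans (mul_le_mul_of_nonneg_left (rpow_le_of_le' hX1 (by linarith)) hC1.le)
      have h4 : 1 ≤ X ^ (3 : ℝ) := Real.one_le_rpow hX1 (by norm_num)
      linarith
    refine (Real.rpow_le_rpow (by positivity) h1 (by positivity)).trans (le_of_eq ?_)
    rw [Real.mul_rpow (by positivity) (by positivity), ← Real.rpow_mul hX0.le]
    congr 2; ring
  have hM3 : M ^ 3 ≤ X ^ (12 * δ) := by
    calc M ^ 3 ≤ (X ^ (4 * δ)) ^ 3 := by gcongr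
      _ = _ := by rw [← Real.rpow_natCast, ← Real.rpow_mul hX0.le]; congr 1; push_cast; ring
  have e1 : M ^ 3 * T ^ 2 ≤ C1 ^ 2 * X ^ (4 - 4 * δ + η / 2) := by
    calc M ^ 3 * T ^ 2 ≤ X ^ (12 * δ) * (C1 * X ^ (2 - 8 * δ + η / 4)) ^ 2 := by gcongr
      _ = C1 ^ 2 * (X ^ (12 * δ) * (X ^ (2 - 8 * δ + η / 4)) ^ 2) := by ring
      _ = _ := by
        rw [← Real.rpow_natCast (X ^ (2 - 8 * δ + η / 4)), ← Real.rpow_mul hX0.le, ← Real.rpow_add hX0]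
        congr 2; push_cast; ring
  have e2 : M ^ 3 * (N ^ 2 * T) ≤ C1 * X ^ (4 - 4 * δ + η / 2) := by
    calc M ^ 3 * (N ^ 2 * T) = M * (M * N) ^ 2 * T := by ring
      _ ≤ X ^ (4 * δ) * X ^ 2 * (C1 * X ^ (2 - 8 * δ + η / 4)) := by gcongr
      _ = C1 * (X ^ (4 * δ) * X ^ (2 : ℝ) * X ^ (2 - 8 * δ + η / 4)) := by
        rw [show (2 : ℝ) = ((2 : ℕ) : ℝ) by norm_num, Real.rpow_natCast]; push_cast; ring
      _ = C1 * X ^ (4 - 4 * δ + η / 4) := by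
        rw [← Real.rpow_add hX0, ← Real.rpow_add hX0]; congr 2; ring
      _ ≤ _ := mul_le_mul_of_nonneg_left (rpow_le_of_le' hX1 (by linarith)) hC1.le
  have e3 : M ^ 3 * (N ^ 4 / T) ≤ 64 * X ^ (4 - 4 * δ + 5 * η / 4) := by
    have hNX : N ≤ X := by nlinarith
    calc M ^ 3 * (N ^ 4 / T) = (M * N) ^ 3 * N / T := by ring
      _ ≤ X ^ 3 * X / (X ^ (1 - η) / 64) := by gcongr
      _ = 64 * X ^ (3 + η) := by
        rw [div_div_eq_mul_div, div_eq_iff (by positivity), mul_assoc (64 : ℝ), ← Real.rpow_add hX0,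
          show 3 + η + (1 - η) = ((4 : ℕ) : ℝ) by push_cast; ring, Real.rpow_natCast]; ring
      _ ≤ _ := mul_le_mul_of_nonneg_left (rpow_le_of_le' hX1 (by linarith)) (by norm_num)
  have hW : M ^ 3 * Wf (η / 4) N T ≤ C * X ^ (4 - 4 * δ + 5 * η / 4) := by
    unfold Wf
    calc M ^ 3 * ((T ^ 2 + N ^ 2 * T) * (1 + T / N) ^ (η / 4) + N ^ 4 / T)
        = (M ^ 3 * T ^ 2 + M ^ 3 * (N ^ 2 * T)) * (1 + T / N) ^ (η / 4) + M ^ 3 * (N ^ 4 / T) := by ring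
      _ ≤ (C1 ^ 2 * X ^ (4 - 4 * δ + η / 2) + C1 * X ^ (4 - 4 * δ + η / 2)) * (A * X ^ (3 * η / 4)) +
          64 * X ^ (4 - 4 * δ + 5 * η / 4) := by gcongr
      _ = (C1 ^ 2 + C1) * A * (X ^ (4 - 4 * δ + η / 2) * X ^ (3 * η / 4)) + 64 * X ^ (4 - 4 * δ + 5 * η / 4) := by ring
      _ = _ := by
        rw [← Real.rpow_add hX0, show 4 - 4 * δ + η / 2 + 3 * η / 4 = 4 - 4 * δ + 5 * η / 4 by ring, hCd]; ring
  have hW0 : 0 < Wf (η / 4) N T := by unfold Wf; positivity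
  have h1 : M * (Wf (η / 4) N T / M) ^ (1 / 4 : ℝ) = (M ^ 3 * Wf (η / 4) N T) ^ (1 / 4 : ℝ) := by
    have : M = (M ^ 4) ^ (1 / 4 : ℝ) := by
      rw [← Real.rpow_natCast, ← Real.rpow_mul hM0.le]; norm_num
    calc M * (Wf (η / 4) N T / M) ^ (1 / 4 : ℝ) = (M ^ 4) ^ (1 / 4 : ℝ) * (Wf (η / 4) N T / M) ^ (1 / 4 : ℝ) := by rw [← this]
      _ = (M ^ 4 * (Wf (η / 4) N T / M)) ^ (1 / 4 : ℝ) := by rw [← Real.mul_rpow (by positivity) (by positivity)]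
      _ = _ := by congr 1; field_simp
  rw [h1]
  refine (Real.rpow_le_rpow (by positivity) hW (by norm_num)).trans ?_
  rw [Real.mul_rpow (by positivity) (by positivity), ← Real.rpow_mul hX0.le]
  refine mul_le_mul_of_nonneg_left (rpow_le_of_le' hX1 (by linarith)) (by positivity)

set_option maxHeartbeats 1600000 in
lemma I_global (c δ η : ℝ) (hc : 1 < c) (hδ : 0 < δ) (hδ1 : δ ≤ 1 / 15) (hcδ : c ≤ 2 - 8 * δ) (hη : 0 < η) (hηδ : η ≤ δ) :
    ∃ C > 0, ∀ X : ℝ, 16384 ≤ X → ∀ x : ℝ, X ^ (1 - c - η) ≤ x → x ≤ Real.log X ^ 5 → ∀ α β : ℕ → ℂ,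
    (∀ m, ‖α m‖ ≤ 1) → (β = (fun _ => 1) ∨ β = (fun n : ℕ => (Real.log n : ℂ))) →
    (∀ m : ℕ, X ^ (4 * δ) < (m : ℝ) → α m = 0) → ∀ D : ℕ, (2 : ℝ) ^ D ≤ 2 * X →
    ‖∑ m ∈ Finset.range (2 ^ D), ∑ n ∈ Finset.range (2 ^ D), α m * β n * fX X c x (m * n)‖ ≤ C * X ^ (1 - δ + η / 2) := by
  obtain ⟨C, hC, H⟩ := boxI2 (η / 4) (by positivity) c hc (by linarith)
  obtain ⟨C1, hC1, HN⟩ := I_num c δ η hc hδ hδ1 hcδ hη hηδ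
  obtain ⟨C2, hC2, HL⟩ := logpow (η / 8) (by positivity) 4
  refine ⟨16 * C2 * (C * C1), by positivity, ?_⟩
  intro X hX x hx hx2 α β hα hβ hα0 D hD
  have hX0 : 0 < X := by linarith
  have hX1 : 1 ≤ X := by linarith
  have hl : 0 ≤ Real.log X := Real.log_nonneg hX1
  set L := 4 + 2 * Real.log X with hL
  have hL0 : 0 ≤ L := by linarith
  have hDL := D_le X hX1 D hD
  have hbox := dyad2_le (fun m n => α m * β n * fX X c x (m * n)) D (by simp [fX_zero X c x hX0.le])
    (by simp [fX_zero X c x hX0.le]) (L ^ 2 * (C * (C1 * X ^ (1 - δ + 3 * η / 8)))) ?_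
  · refine hbox.trans ?_
    have hL2 : L ≤ 2 * (3 + 2 * Real.log X) := by linarith
    calc (D : ℝ) ^ 2 * (L ^ 2 * (C * (C1 * X ^ (1 - δ + 3 * η / 8))))
        ≤ (2 * (3 + 2 * Real.log X)) ^ 2 * ((2 * (3 + 2 * Real.log X)) ^ 2 * (C * (C1 * X ^ (1 - δ + 3 * η / 8)))) := by
          gcongr; linarith
      _ = 16 * (3 + 2 * Real.log X) ^ 4 * (C * (C1 * X ^ (1 - δ + 3 * η / 8))) := by ring
      _ ≤ 16 * (C2 * X ^ (η / 8)) * (C * (C1 * X ^ (1 - δ + 3 * η / 8))) := by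
          gcongr; exact HL X hX1
      _ = 16 * C2 * (C * C1) * (X ^ (η / 8) * X ^ (1 - δ + 3 * η / 8)) := by ring
      _ = _ := by rw [← Real.rpow_add hX0]; congr 2; ring
  · intro M N hM hN
    by_cases hz : (∑ m ∈ Finset.Ico M (2 * M), ∑ n ∈ Finset.Ico N (2 * N), α m * β n * fX X c x (m * n)) = 0
    · rw [hz, norm_zero]; positivity
    obtain ⟨m, n, hm1, hm2, hn1, hn2, hne⟩ := box_cases M N _ hz
    have hf := fX_ne X c x (m * n) (right_ne_zero_of_mul hne)
    have hαm : (m : ℝ) ≤ X ^ (4 * δ) := by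
      by_contra h; exact (left_ne_zero_of_mul (left_ne_zero_of_mul hne)) (hα0 m (not_le.mp h))
    obtain ⟨hs1, hs2, hs3, hs4⟩ := box_size X M N m n hm1 hm2 hn1 hn2 hf.1 hf.2
    obtain ⟨hF1, hF2, hF3⟩ := F_bounds c η hc (by linarith) hη (by linarith) X hX x hx hx2 _ hs1 hs2
    have hMm : (M : ℝ) ≤ m := by exact_mod_cast hm1
    have hMP : (M : ℝ) ≤ X ^ (4 * δ) := hMm.trans hαm
    have hMT : (M : ℝ) ≤ x * ((M : ℝ) * N) ^ c := by
      refine hMP.trans (le_trans ?_ hF1)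
      rw [le_div_iff₀ (by norm_num)]
      have h1 : (64 : ℝ) ≤ X ^ (1 / 2 : ℝ) := by
        rw [← Real.sqrt_eq_rpow]; apply Real.le_sqrt_of_sq_le; linarith
      calc X ^ (4 * δ) * 64 ≤ X ^ (4 * δ) * X ^ (1 / 2 : ℝ) := by gcongr
        _ = X ^ (4 * δ + 1 / 2) := by rw [← Real.rpow_add hX0]
        _ ≤ _ := rpow_le_of_le' hX1 (by linarith)
    refine (H M N hM hN α β hα hβ X x hX1 hs4 _ rfl hMT).trans ?_
    have := HN X hX M N _ (by exact_mod_cast hM) (by exact_mod_cast hN) hs2 hMP hF1 hF2 hF3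
    gcongr

/-- truncation of an arithmetic function -/
noncomputable def lo (f : ArithmeticFunction ℝ) (P : ℝ) : ArithmeticFunction ℝ :=
  ⟨fun n => if (n : ℝ) ≤ P then f n else 0, by simp⟩

noncomputable def hi (f : ArithmeticFunction ℝ) (P : ℝ) : ArithmeticFunction ℝ :=
  ⟨fun n => if (n : ℝ) ≤ P then 0 else f n, by simp⟩

lemma lo_apply (f : ArithmeticFunction ℝ) (P : ℝ) (n : ℕ) : lo f P n = if (n : ℝ) ≤ P then f n else 0 := rfl
lemma hi_apply (f : ArithmeticFunction ℝ) (P : ℝ) (n : ℕ) : hi f P n = if (n : ℝ) ≤ P then 0 else f n := rfl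

lemma lo_add_hi (f : ArithmeticFunction ℝ) (P : ℝ) : lo f P + hi f P = f := by
  ext n
  rw [ArithmeticFunction.add_apply, lo_apply, hi_apply]; split_ifs <;> simp

noncomputable def mu : ArithmeticFunction ℝ := ((ArithmeticFunction.moebius : ArithmeticFunction ℤ) : ArithmeticFunction ℝ)
noncomputable def zt : ArithmeticFunction ℝ := ((ArithmeticFunction.zeta : ArithmeticFunction ℕ) : ArithmeticFunction ℝ)
noncomputable abbrev La : ArithmeticFunction ℝ := ArithmeticFunction.vonMangoldt

lemma vaughan (P : ℝ) : La = lo La P + lo mu P * ArithmeticFunction.log - (lo mu P * lo La P) * zt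
    + hi mu P * (zt * hi La P) := by
  have h1 : mu * zt = 1 := ArithmeticFunction.coe_moebius_mul_coe_zeta
  have h2 : La * zt = ArithmeticFunction.log := ArithmeticFunction.vonMangoldt_mul_zeta
  have h3 := lo_add_hi La P
  have h4 := lo_add_hi mu P
  rw [← h2]
  set a := lo La P
  set b := hi La P
  set u := lo mu P
  set v := hi mu P
  rw [← h4] at h1
  rw [← h3]
  linear_combination (-b) * h1

lemma conv_sum (α β : ArithmeticFunction ℝ) (f : ℕ → ℂ) (K : ℕ) (h0 : f 0 = 0) (hK : ∀ n, K ≤ n → f n = 0) :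
    ∑ n ∈ Finset.range K, ((α * β) n : ℂ) * f n =
    ∑ d ∈ Finset.range K, ∑ k ∈ Finset.range K, (α d : ℂ) * (β k : ℂ) * f (d * k) := by
  rw [← Finset.sum_product']
  have h1 : ∀ n ∈ Finset.range K, ((α * β) n : ℂ) * f n = ∑ p ∈ Finset.range K ×ˢ Finset.range K,
      if p.1 * p.2 = n then (α p.1 : ℂ) * (β p.2 : ℂ) * f (p.1 * p.2) else 0 := by
    intro n hn
    rw [Finset.mem_range] at hn
    rcases Nat.eq_zero_or_pos n with rfl | hn0
    · rw [h0, mul_zero]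
      symm
      refine Finset.sum_eq_zero fun p _ => ?_
      split_ifs with h
      · rw [h, h0, mul_zero]
      · rfl
    · rw [← Finset.sum_filter]
      have : n.divisorsAntidiagonal = (Finset.range K ×ˢ Finset.range K).filter (fun p => p.1 * p.2 = n) := by
        ext p
        rw [Nat.mem_divisorsAntidiagonal, Finset.mem_filter, Finset.mem_product, Finset.mem_range, Finset.mem_range]
        constructor
        · rintro ⟨h, _⟩
          have h1 : p.1 ≠ 0 := by rintro h1; rw [h1, zero_mul] at h; omega
          have h2 : p.2 ≠ 0 := by rintro h1; rw [h1, mul_zero] at h; omega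
          have h3 : p.1 ≤ n := by rw [← h]; exact Nat.le_mul_of_pos_right _ (Nat.pos_of_ne_zero h2)
          have h4 : p.2 ≤ n := by rw [← h]; exact Nat.le_mul_of_pos_left _ (Nat.pos_of_ne_zero h1)
          exact ⟨⟨by omega, by omega⟩, h⟩
        · rintro ⟨_, h⟩; exact ⟨h, by omega⟩
      rw [ArithmeticFunction.mul_apply, this, Complex.ofReal_sum, Finset.sum_mul]
      refine Finset.sum_congr rfl fun p hp => ?_
      rw [(Finset.mem_filter.mp hp).2]; push_cast; ring
  rw [Finset.sum_congr rfl h1, Finset.sum_comm]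
  refine Finset.sum_congr rfl fun p _ => ?_
  rw [Finset.sum_ite_eq]
  split_ifs with h
  · rfl
  · rw [hK _ (by rw [Finset.mem_range] at h; omega), mul_zero]

lemma conv_bound (α β : ArithmeticFunction ℝ) (h : ∀ d k, |α d * β k| ≤ La k) (n : ℕ) : |(α * β) n| ≤ Real.log n := by
  rw [ArithmeticFunction.mul_apply]
  refine (Finset.abs_sum_le_sum_abs _ _).trans ((Finset.sum_le_sum fun p _ => h p.1 p.2).trans (le_of_eq ?_))
  rw [Nat.sum_divisorsAntidiagonal' (fun _ k => La k)]
  exact ArithmeticFunction.vonMangoldt_sum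

lemma mu_le (n : ℕ) : |mu n| ≤ 1 := by
  unfold mu
  rw [ArithmeticFunction.intCoe_apply]
  have := ArithmeticFunction.abs_moebius_le_one (n := n)
  exact_mod_cast this

lemma lo_mu_le (P : ℝ) (n : ℕ) : |lo mu P n| ≤ 1 := by
  rw [lo_apply]; split_ifs
  · exact mu_le n
  · simp

lemma hi_mu_le (P : ℝ) (n : ℕ) : |hi mu P n| ≤ 1 := by
  rw [hi_apply]; split_ifs
  · simp
  · exact mu_le n

lemma zt_apply (n : ℕ) (hn : n ≠ 0) : zt n = 1 := by
  unfold zt; rw [ArithmeticFunction.natCoe_apply, ArithmeticFunction.zeta_apply, if_neg hn]; simp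

lemma zt_le (n : ℕ) : |zt n| ≤ 1 := by
  rcases Nat.eq_zero_or_pos n with rfl | h
  · simp
  · rw [zt_apply n h.ne']; simp

lemma La_nonneg (n : ℕ) : 0 ≤ La n := ArithmeticFunction.vonMangoldt_nonneg

lemma lo_La_abs (P : ℝ) (n : ℕ) : |lo La P n| ≤ La n := by
  rw [lo_apply]; split_ifs
  · rw [abs_of_nonneg (La_nonneg n)]
  · simpa using La_nonneg n

lemma hi_La_abs (P : ℝ) (n : ℕ) : |hi La P n| ≤ La n := by
  rw [hi_apply]; split_ifs
  · simpa using La_nonneg n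
  · rw [abs_of_nonneg (La_nonneg n)]

lemma gam_bound (P : ℝ) (n : ℕ) : |(lo mu P * lo La P) n| ≤ Real.log n :=
  conv_bound _ _ (fun d k => by
    rw [abs_mul]
    exact (mul_le_of_le_one_left (abs_nonneg _) (lo_mu_le P d)).trans (lo_La_abs P k)) n

lemma del_bound (P : ℝ) (n : ℕ) : |(zt * hi La P) n| ≤ Real.log n :=
  conv_bound _ _ (fun d k => by
    rw [abs_mul]
    exact (mul_le_of_le_one_left (abs_nonneg _) (zt_le d)).trans (hi_La_abs P k)) n

lemma gam_supp (P : ℝ) (n : ℕ) (h : (lo mu P * lo La P) n ≠ 0) : (n : ℝ) ≤ P * P := by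
  rw [ArithmeticFunction.mul_apply] at h
  obtain ⟨p, hp, h1⟩ := Finset.exists_ne_zero_of_sum_ne_zero h
  rw [Nat.mem_divisorsAntidiagonal] at hp
  have h2 := left_ne_zero_of_mul h1
  have h3 := right_ne_zero_of_mul h1
  rw [lo_apply] at h2 h3
  have h2' : (p.1 : ℝ) ≤ P := by by_contra h; exact h2 (if_neg h)
  have h3' : (p.2 : ℝ) ≤ P := by by_contra h; exact h3 (if_neg h)
  rw [← hp.1]; push_cast
  exact mul_le_mul h2' h3' (by positivity) (le_trans (by positivity) h2')

lemma del_supp (P : ℝ) (n : ℕ) (hn : (n : ℝ) ≤ P) : (zt * hi La P) n = 0 := by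
  by_contra h
  rw [ArithmeticFunction.mul_apply] at h
  obtain ⟨p, hp, h1⟩ := Finset.exists_ne_zero_of_sum_ne_zero h
  rw [Nat.mem_divisorsAntidiagonal] at hp
  have h3 := right_ne_zero_of_mul h1
  rw [hi_apply] at h3
  apply h3
  rw [if_pos]
  refine le_trans ?_ hn
  have : p.2 ≤ n := Nat.le_of_dvd (Nat.pos_of_ne_zero hp.2) ⟨p.1, by rw [← hp.1, mul_comm]⟩
  exact_mod_cast this

lemma vsum_aux (X c x P B L : ℝ) (K : ℕ) (hX : 16384 ≤ X) (hXK : X < (K : ℝ))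
    (hL : 0 < L) (hLK : ∀ n : ℕ, n < K → Real.log n ≤ L) (hP1 : 1 ≤ P) (hP3 : P * P * P ≤ X / 2)
    (hI : ∀ α β : ℕ → ℂ, (∀ m, ‖α m‖ ≤ 1) → (β = (fun _ => 1) ∨ β = (fun n : ℕ => (Real.log n : ℂ))) →
      (∀ m : ℕ, P < (m : ℝ) → α m = 0) →
      ‖∑ m ∈ Finset.range K, ∑ n ∈ Finset.range K, α m * β n * fX X c x (m * n)‖ ≤ B)
    (hII : ∀ α β : ℕ → ℂ, (∀ m, ‖α m‖ ≤ 1) → (∀ n, ‖β n‖ ≤ 1) → (∀ m : ℕ, (m : ℝ) ≤ P → α m = 0) →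
      (∀ m : ℕ, (m : ℝ) ≤ P → β m = 0) →
      ‖∑ m ∈ Finset.range K, ∑ n ∈ Finset.range K, α m * β n * fX X c x (m * n)‖ ≤ B) :
    ‖∑ n ∈ Finset.range K, (La n : ℂ) * fX X c x n‖ ≤ (1 + 3 * L) * B := by
  have hf0 : fX X c x 0 = 0 := fX_zero X c x (by linarith)
  have hfK : ∀ n, K ≤ n → fX X c x n = 0 := by
    intro n hn
    by_contra h
    have h1 := (fX_ne X c x n h).2
    have h2 : (K : ℝ) ≤ n := by exact_mod_cast hn
    linarith
  have hPX : P ≤ X / 2 := by nlinarith [mul_self_nonneg (P - 1)]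
  have hsmall : ∀ n : ℕ, (n : ℝ) ≤ X / 2 → fX X c x n = 0 := by
    intro n hn
    by_contra h
    have h1 := (fX_ne X c x n h).1
    linarith
  have hV : ∑ n ∈ Finset.range K, (La n : ℂ) * fX X c x n =
      ∑ n ∈ Finset.range K, ((lo La P n : ℝ) : ℂ) * fX X c x n
      + ∑ n ∈ Finset.range K, (((lo mu P * ArithmeticFunction.log) n : ℝ) : ℂ) * fX X c x n
      - ∑ n ∈ Finset.range K, ((((lo mu P * lo La P) * zt) n : ℝ) : ℂ) * fX X c x n
      + ∑ n ∈ Finset.range K, (((hi mu P * (zt * hi La P)) n : ℝ) : ℂ) * fX X c x n := by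
    rw [← Finset.sum_add_distrib, ← Finset.sum_sub_distrib, ← Finset.sum_add_distrib]
    refine Finset.sum_congr rfl fun n _ => ?_
    have h : La n = lo La P n + (lo mu P * ArithmeticFunction.log) n - ((lo mu P * lo La P) * zt) n
        + (hi mu P * (zt * hi La P)) n := by
      conv_lhs => rw [vaughan P]
      rw [sub_eq_add_neg, sub_eq_add_neg]
      simp only [ArithmeticFunction.add_apply, ArithmeticFunction.neg_apply]
    rw [h]; push_cast; ring
  have hT0 : ∑ n ∈ Finset.range K, ((lo La P n : ℝ) : ℂ) * fX X c x n = 0 := by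
    refine Finset.sum_eq_zero fun n _ => ?_
    rw [lo_apply]
    split_ifs with h
    · rw [hsmall n (h.trans hPX), mul_zero]
    · simp
  have hT1 : ‖∑ n ∈ Finset.range K, (((lo mu P * ArithmeticFunction.log) n : ℝ) : ℂ) * fX X c x n‖ ≤ B := by
    rw [conv_sum _ _ _ K hf0 hfK]
    refine hI (fun m => ((lo mu P m : ℝ) : ℂ)) (fun n : ℕ => (Real.log n : ℂ)) ?_ (Or.inr rfl) ?_
    · intro m; rw [Complex.norm_real]; exact lo_mu_le P m
    · intro m hm
      rw [lo_apply, if_neg (not_le.mpr hm)]; simp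
  -- normalised coefficients
  have hnorm : ∀ g : ℕ → ℝ, (∀ n, |g n| ≤ Real.log n) → ∀ (s : ℕ → Prop) [DecidablePred s] (m : ℕ),
      ‖(if m < K ∧ s m then ((g m / L : ℝ) : ℂ) else 0)‖ ≤ 1 := by
    intro g hg s _ m
    split_ifs with h
    · rw [Complex.norm_real, Real.norm_eq_abs, abs_div, abs_of_pos hL, div_le_one hL]
      exact (hg m).trans (hLK m h.1)
    · simp
  have hT3 : ‖∑ n ∈ Finset.range K, (((hi mu P * (zt * hi La P)) n : ℝ) : ℂ) * fX X c x n‖ ≤ L * B := by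
    rw [conv_sum _ _ _ K hf0 hfK]
    have h := hII (fun m => ((hi mu P m : ℝ) : ℂ))
      (fun m => if m < K ∧ P < (m : ℝ) then ((((zt * hi La P) m) / L : ℝ) : ℂ) else 0) ?_ ?_ ?_ ?_
    · have h2 : ∑ d ∈ Finset.range K, ∑ k ∈ Finset.range K, ((hi mu P d : ℝ) : ℂ) * (((zt * hi La P) k : ℝ) : ℂ) * fX X c x (d * k)
          = (L : ℂ) * ∑ m ∈ Finset.range K, ∑ n ∈ Finset.range K, ((hi mu P m : ℝ) : ℂ) *
            (if n < K ∧ P < (n : ℝ) then ((((zt * hi La P) n) / L : ℝ) : ℂ) else 0) * fX X c x (m * n) := by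
        rw [Finset.mul_sum]
        refine Finset.sum_congr rfl fun d _ => ?_
        rw [Finset.mul_sum]
        refine Finset.sum_congr rfl fun k hk => ?_
        rw [Finset.mem_range] at hk
        have hL' : (L : ℂ) ≠ 0 := by exact_mod_cast hL.ne'
        split_ifs with hh
        · push_cast; field_simp
        · have : (k : ℝ) ≤ P := by
            by_contra h3; exact hh ⟨hk, not_le.mp h3⟩
          rw [del_supp P k this]; simp
      rw [h2, norm_mul, Complex.norm_real, Real.norm_eq_abs, abs_of_pos hL]
      exact mul_le_mul_of_nonneg_left h hL.le
    · intro m; rw [Complex.norm_real]; exact hi_mu_le P m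
    · exact hnorm _ (del_bound P) (fun m => P < (m : ℝ))
    · intro m hm
      rw [hi_apply, if_pos hm]; simp
    · intro m hm
      exact if_neg (fun h => (not_lt.mpr hm) h.2)
  have hT2 : ‖∑ n ∈ Finset.range K, ((((lo mu P * lo La P) * zt) n : ℝ) : ℂ) * fX X c x n‖ ≤ L * B + L * B := by
    rw [conv_sum _ _ _ K hf0 hfK]
    have ha := hI (fun m => if m < K ∧ (m : ℝ) ≤ P then ((((lo mu P * lo La P) m) / L : ℝ) : ℂ) else 0) (fun _ => 1)
      (hnorm _ (gam_bound P) (fun m => (m : ℝ) ≤ P)) (Or.inl rfl)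
      (fun m hm => if_neg (fun h => (not_le.mpr hm) h.2))
    have hb := hII (fun m => if m < K ∧ P < (m : ℝ) then ((((lo mu P * lo La P) m) / L : ℝ) : ℂ) else 0)
      (fun n => if P < (n : ℝ) then 1 else 0)
      (hnorm _ (gam_bound P) (fun m => P < (m : ℝ)))
      (fun n => by split_ifs <;> simp)
      (fun m hm => if_neg (fun h => (not_lt.mpr hm) h.2))
      (fun m hm => if_neg (not_lt.mpr hm))
    have h2 : ∑ d ∈ Finset.range K, ∑ k ∈ Finset.range K, (((lo mu P * lo La P) d : ℝ) : ℂ) * ((zt k : ℝ) : ℂ) * fX X c x (d * k)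
        = (L : ℂ) * (∑ m ∈ Finset.range K, ∑ n ∈ Finset.range K,
            (if m < K ∧ (m : ℝ) ≤ P then ((((lo mu P * lo La P) m) / L : ℝ) : ℂ) else 0) * 1 * fX X c x (m * n))
          + (L : ℂ) * (∑ m ∈ Finset.range K, ∑ n ∈ Finset.range K,
            (if m < K ∧ P < (m : ℝ) then ((((lo mu P * lo La P) m) / L : ℝ) : ℂ) else 0) *
            (if P < (n : ℝ) then 1 else 0) * fX X c x (m * n)) := by
      rw [← mul_add, ← Finset.sum_add_distrib, Finset.mul_sum]
      refine Finset.sum_congr rfl fun d hd => ?_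
      rw [← Finset.sum_add_distrib, Finset.mul_sum]
      refine Finset.sum_congr rfl fun k hk => ?_
      rw [Finset.mem_range] at hk hd
      have hL' : (L : ℂ) ≠ 0 := by exact_mod_cast hL.ne'
      rcases Nat.eq_zero_or_pos k with rfl | hk0
      · rw [mul_zero, hf0]; simp
      rw [zt_apply k hk0.ne']
      by_cases hdP : (d : ℝ) ≤ P
      · rw [if_pos ⟨hd, hdP⟩, if_neg (fun h => (not_lt.mpr hdP) h.2)]
        push_cast; field_simp; ring
      · have hdP' := not_le.mp hdP
        rw [if_neg (fun h => hdP h.2), if_pos ⟨hd, hdP'⟩]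
        by_cases hkP : P < (k : ℝ)
        · rw [if_pos hkP]; push_cast; field_simp; ring
        · rw [if_neg hkP]
          by_cases hg : (lo mu P * lo La P) d = 0
          · rw [hg]; simp
          · have h3 := gam_supp P d hg
            rw [hsmall (d * k)]
            · simp
            · push_cast
              refine le_trans (mul_le_mul h3 (not_lt.mp hkP) (by positivity) (by positivity)) hP3
    rw [h2]
    refine (norm_add_le _ _).trans ?_
    rw [norm_mul, norm_mul, Complex.norm_real, Real.norm_eq_abs, abs_of_pos hL]
    exact add_le_add (mul_le_mul_of_nonneg_left ha hL.le) (mul_le_mul_of_nonneg_left hb hL.le)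
  rw [hV, hT0, zero_add]
  refine (norm_add_le _ _).trans ?_
  refine (add_le_add (norm_sub_le _ _) le_rfl).trans ?_
  linarith

lemma S_prime (X c x : ℝ) (hX : 16384 ≤ X) (K : ℕ) (hXK : X < (K : ℝ)) :
    ‖S X c x‖ ≤ ‖∑ n ∈ Finset.range K, (La n : ℂ) * fX X c x n‖ + 2 * Real.sqrt X * Real.log X := by
  have hX0 : 0 ≤ X := by linarith
  have hS : S X c x = ∑ n ∈ Finset.range K, ((if n.Prime then Real.log n else 0 : ℝ) : ℂ) * fX X c x n := by
    unfold S
    rw [Finset.sum_filter]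
    have hset : ∀ M : ℕ, X < (M : ℝ) → ∀ g : ℕ → ℂ, (∀ n : ℕ, ¬ ((n : ℝ) ≤ X) → g n = 0) →
        ∑ n ∈ Finset.range M, g n = ∑ n ∈ Finset.range (⌊X⌋₊ + 1), g n := by
      intro M hM g hg
      symm
      apply Finset.sum_subset
      · intro n hn
        rw [Finset.mem_range] at hn ⊢
        have h1 : (n : ℝ) ≤ X := (Nat.le_floor_iff hX0).1 (by omega)
        exact_mod_cast h1.trans_lt hM
      · intro n _ hn
        apply hg
        intro h
        apply hn
        rw [Finset.mem_range, Nat.lt_add_one_iff]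
        exact Nat.le_floor h
    rw [hset (⌈X⌉₊ + 1), hset K hXK]
    · refine Finset.sum_congr rfl fun n _ => ?_
      unfold fX
      by_cases h1 : n.Prime <;> by_cases h2 : X / 2 < (n : ℝ) ∧ (n : ℝ) ≤ X <;> simp [h1, h2]
    · intro n hn
      rw [show fX X c x n = 0 from if_neg (fun h => hn h.2), mul_zero]
    · push_cast
      have := Nat.le_ceil X
      linarith
    · intro n hn
      exact if_neg (fun h => hn h.2.2)
  have hd : ‖∑ n ∈ Finset.range K, (La n : ℂ) * fX X c x n - S X c x‖ ≤ 2 * Real.sqrt X * Real.log X := by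
    rw [hS, ← Finset.sum_sub_distrib]
    refine (norm_sum_le _ _).trans ?_
    have h1 := Chebyshev.psi_sub_theta_le (x := X) (by linarith)
    refine le_trans ?_ h1
    have h2 : Chebyshev.psi X - Chebyshev.theta X = ∑ n ∈ Finset.Ioc 0 ⌊X⌋₊, (La n - if n.Prime then Real.log n else 0) := by
      rw [Finset.sum_sub_distrib, Chebyshev.psi, Chebyshev.theta, Finset.sum_filter]
    have hnn : ∀ n : ℕ, 0 ≤ La n - if n.Prime then Real.log n else 0 := by
      intro n
      split_ifs with h
      · rw [ArithmeticFunction.vonMangoldt_apply_prime h, sub_self]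
      · rw [sub_zero]; exact La_nonneg n
    rw [h2]
    have h3 : ∀ n ∈ Finset.range K, ‖(La n : ℂ) * fX X c x n - ((if n.Prime then Real.log n else 0 : ℝ) : ℂ) * fX X c x n‖ ≤
        if n ∈ Finset.Ioc 0 ⌊X⌋₊ then (La n - if n.Prime then Real.log n else 0) else 0 := by
      intro n _
      rw [← sub_mul, norm_mul, ← Complex.ofReal_sub, Complex.norm_real, Real.norm_eq_abs, abs_of_nonneg (hnn n)]
      by_cases h : fX X c x n = 0
      · rw [h, norm_zero, mul_zero]
        split_ifs
        all_goals first | exact le_rfl | skip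
        · have := hnn n; simp_all
        · have := hnn n; simp_all
      · have h4 := fX_ne X c x n h
        have h6 : n ∈ Finset.Ioc 0 ⌊X⌋₊ := by
          rw [Finset.mem_Ioc]
          refine ⟨?_, Nat.le_floor h4.2⟩
          have : (0 : ℝ) < n := by linarith
          exact_mod_cast this
        rw [if_pos h6]
        refine mul_le_of_le_one_right (hnn n) ?_
        rw [show fX X c x n = e ((n : ℝ) ^ c * x) from if_pos h4, e_norm]
    refine (Finset.sum_le_sum h3).trans ?_
    rw [← Finset.sum_filter]
    refine Finset.sum_le_sum_of_subset_of_nonneg ?_ (fun n _ _ => hnn n)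
    intro n hn
    exact (Finset.mem_filter.1 hn).2
  have h5 := norm_sub_norm_le (S X c x) (∑ n ∈ Finset.range K, (La n : ℂ) * fX X c x n)
  rw [norm_sub_rev] at h5
  linarith

lemma main_pos (c δ η : ℝ) (hc : 1 < c) (hδ : 0 < δ) (hδ1 : δ ≤ 1 / 15) (hcδ : c ≤ 2 - 8 * δ) (hη : 0 < η) (hηδ : η ≤ δ) :
    ∃ C > 0, ∀ X : ℝ, 16384 ≤ X → ∀ x : ℝ, X ^ (1 - c - η) ≤ x → x ≤ Real.log X ^ 5 →
      ‖S X c x‖ ≤ C * X ^ (1 - δ + η) := by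
  obtain ⟨C1, hC1, H1⟩ := I_global c δ η hc hδ hδ1 hcδ hη hηδ
  obtain ⟨C2, hC2, H2⟩ := II_global c δ η hc hδ hδ1 hcδ hη hηδ
  obtain ⟨C3, hC3, H3⟩ := logpow (η / 2) (by positivity) 1
  refine ⟨4 * C3 * (C1 + C2) + 2 * C3, by positivity, ?_⟩
  intro X hX x hx1 hx2
  have hX1 : 1 ≤ X := by linarith
  have hX0 : 0 < X := by linarith
  set D := Nat.log 2 ⌊X⌋₊ + 1 with hD
  have hfl : ⌊X⌋₊ ≠ 0 := by
    have : 1 ≤ ⌊X⌋₊ := Nat.le_floor (by simpa using hX1)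
    omega
  have hXK : X < ((2 ^ D : ℕ) : ℝ) := by
    have h1 : ⌊X⌋₊ < 2 ^ D := Nat.lt_pow_succ_log_self (by norm_num) _
    exact (Nat.floor_lt hX0.le).1 h1
  have hD2 : (2 : ℝ) ^ D ≤ 2 * X := by
    have h1 : 2 ^ Nat.log 2 ⌊X⌋₊ ≤ ⌊X⌋₊ := Nat.pow_log_le_self 2 hfl
    have h2 : ((2 ^ Nat.log 2 ⌊X⌋₊ : ℕ) : ℝ) ≤ X := (Nat.le_floor_iff hX0.le).1 h1
    push_cast at h2
    rw [hD, pow_succ]; linarith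
  set P := X ^ (4 * δ) with hP
  have hP1 : 1 ≤ P := Real.one_le_rpow hX1 (by positivity)
  have hP3 : P * P * P ≤ X / 2 := by
    rw [hP, ← Real.rpow_add hX0, ← Real.rpow_add hX0]
    have h1 : X ^ (4 * δ + 4 * δ + 4 * δ) ≤ X ^ (4 / 5 : ℝ) := rpow_le_of_le' hX1 (by linarith)
    have h2 : X = X ^ (4 / 5 : ℝ) * X ^ (1 / 5 : ℝ) := by
      rw [← Real.rpow_add hX0]; norm_num
    have h3 : 2 ≤ X ^ (1 / 5 : ℝ) := by
      have h4 : ((32 : ℝ)) ^ (1 / 5 : ℝ) ≤ X ^ (1 / 5 : ℝ) :=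
        Real.rpow_le_rpow (by norm_num) (by linarith) (by norm_num)
      have h5 : (32 : ℝ) ^ (1 / 5 : ℝ) = 2 := by
        rw [show (32 : ℝ) = 2 ^ (5 : ℝ) by norm_num, ← Real.rpow_mul (by norm_num)]; norm_num
      linarith
    have h6 : 0 < X ^ (4 / 5 : ℝ) := by positivity
    nlinarith
  have hlX : 0 ≤ Real.log X := Real.log_nonneg hX1
  set L := 1 + Real.log X with hL
  have hL0 : 0 < L := by positivity
  have hLK : ∀ n : ℕ, n < 2 ^ D → Real.log n ≤ L := by
    intro n hn
    rcases Nat.eq_zero_or_pos n with rfl | h0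
    · simp; exact hL0.le
    · have h1 : (n : ℝ) ≤ 2 * X := by
        have : (n : ℝ) ≤ ((2 ^ D : ℕ) : ℝ) := by exact_mod_cast hn.le
        push_cast at this; linarith
      have h2 : Real.log n ≤ Real.log (2 * X) := Real.log_le_log (by exact_mod_cast h0) h1
      rw [Real.log_mul (by norm_num) hX0.ne'] at h2
      have := Real.log_two_lt_d9
      linarith
  set Y := X ^ (1 - δ + η / 2) with hY
  have hY0 : 0 < Y := by positivity
  have hv := vsum_aux X c x P ((C1 + C2) * Y) L (2 ^ D) hX hXK hL0 hLK hP1 hP3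
    (fun α β h1 h2 h3 => (H1 X hX x hx1 hx2 α β h1 h2 h3 D hD2).trans (by nlinarith [mul_pos hC2 hY0]))
    (fun α β h1 h2 h3 h4 => (H2 X hX x hx1 hx2 α β h1 h2 h3 h4 D hD2).trans (by nlinarith [mul_pos hC1 hY0]))
  have hs := S_prime X c x hX (2 ^ D) hXK
  have h3 := H3 X hX1
  rw [pow_one] at h3
  have hYe : X ^ (η / 2) * Y = X ^ (1 - δ + η) := by
    rw [hY, ← Real.rpow_add hX0]; congr 1; ring
  have hsq : Real.sqrt X ≤ Y := by
    rw [Real.sqrt_eq_rpow]; exact rpow_le_of_le' hX1 (by linarith)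
  have hZ : 0 < X ^ (η / 2) := by positivity
  rw [← hYe]
  have hb : (1 + 3 * L) * ((C1 + C2) * Y) ≤ 4 * (C3 * X ^ (η / 2)) * ((C1 + C2) * Y) := by
    apply mul_le_mul_of_nonneg_right _ (by positivity)
    linarith
  have hc' : 2 * Real.sqrt X * Real.log X ≤ 2 * Y * (C3 * X ^ (η / 2)) := by
    apply mul_le_mul _ _ hlX (by positivity)
    · linarith
    · linarith
  calc ‖S X c x‖ ≤ _ := hs
    _ ≤ 4 * (C3 * X ^ (η / 2)) * ((C1 + C2) * Y) + 2 * Y * (C3 * X ^ (η / 2)) := add_le_add (hv.trans hb) hc'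
    _ = _ := by ring

lemma S_trivial (X c x : ℝ) (hX : 0 ≤ X) : ‖S X c x‖ ≤ Real.log 4 * X := by
  refine le_trans ?_ (Chebyshev.theta_le_log4_mul_x hX)
  unfold S Chebyshev.theta
  refine (norm_sum_le _ _).trans ?_
  have h1 : ∀ p : ℕ, ‖(Real.log p : ℂ) * e ((p : ℝ) ^ c * x)‖ = Real.log p := by
    intro p
    rw [norm_mul, e_norm, mul_one, Complex.norm_real, Real.norm_eq_abs, abs_of_nonneg (Real.log_natCast_nonneg p)]
  simp_rw [h1]
  refine Finset.sum_le_sum_of_subset_of_nonneg ?_ (fun n _ _ => Real.log_natCast_nonneg n)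
  intro p hp
  rw [Finset.mem_filter] at hp ⊢
  rw [Finset.mem_Ioc]
  exact ⟨⟨hp.2.1.pos, Nat.le_floor hp.2.2.2⟩, hp.2.1⟩

lemma S_neg (X c x : ℝ) : ‖S X c (-x)‖ = ‖S X c x‖ := by
  have : S X c (-x) = (starRingEnd ℂ) (S X c x) := by
    unfold S
    rw [map_sum]
    refine Finset.sum_congr rfl fun p _ => ?_
    rw [map_mul, e_neg_conj, Complex.conj_ofReal, mul_neg]
  rw [this, Complex.norm_conj]

/-- Lemma 2.10: for `1 < c < 2`, every fixed `η > 0`, and sufficiently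
large `X`, with `τ = X^{1−c−η}` and `K = (log X)⁵`, for all `τ ≤ |x| ≤ K` one has
`S(x) ≪_{c,η} X^{(6+c)/8+η} + X^{14/15+η}`. -/
theorem stmt12 (c : ℝ) (hc1 : 1 < c) (hc2 : c < 2) (η : ℝ) (hη : 0 < η) :
    ∃ C > 0, ∃ X₀ : ℝ, ∀ X ≥ X₀, ∀ τ K : ℝ,
      τ = X ^ (1 - c - η) → K = (Real.log X) ^ 5 →
      ∀ x : ℝ, τ ≤ |x| → |x| ≤ K →
        ‖S X c x‖ ≤ C * (X ^ ((6 + c) / 8 + η) + X ^ (14 / 15 + η)) := by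
  set δ := min ((2 - c) / 8) (1 / 15) with hδ
  have hδ0 : 0 < δ := lt_min (by linarith) (by norm_num)
  have hδ1 : δ ≤ 1 / 15 := min_le_right _ _
  have hδ2 : δ ≤ (2 - c) / 8 := min_le_left _ _
  have hkey : ∀ X : ℝ, 1 ≤ X → X ^ (1 - δ + η) ≤ X ^ ((6 + c) / 8 + η) + X ^ (14 / 15 + η) := by
    intro X hX
    have h1 : 0 ≤ X ^ ((6 + c) / 8 + η) := by positivity
    have h2 : 0 ≤ X ^ (14 / 15 + η) := by positivity
    rcases min_choice ((2 - c) / 8) (1 / 15) with h | h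
    · rw [hδ, h, show 1 - (2 - c) / 8 + η = (6 + c) / 8 + η by ring]; linarith
    · rw [hδ, h, show 1 - 1 / 15 + η = 14 / 15 + η by ring]; linarith
  rcases le_or_gt η δ with h | h
  · obtain ⟨C, hC, H⟩ := main_pos c δ η hc1 hδ0 hδ1 (by linarith) hη h
    refine ⟨C, hC, 16384, ?_⟩
    rintro X hX τ K rfl rfl x hx1 hx2
    have hX1 : 1 ≤ X := by linarith
    have h1 := H X hX |x| hx1 hx2
    have h2 : ‖S X c |x|‖ = ‖S X c x‖ := by
      rcases abs_choice x with h | h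
      · rw [h]
      · rw [h, S_neg]
    rw [h2] at h1
    exact h1.trans (mul_le_mul_of_nonneg_left (hkey X hX1) hC.le)
  · have hl : 0 < Real.log 4 := Real.log_pos (by norm_num)
    refine ⟨Real.log 4, hl, 1, ?_⟩
    rintro X hX τ K _ _ x _ _
    refine (S_trivial X c x (by linarith)).trans (mul_le_mul_of_nonneg_left ?_ hl.le)
    refine le_trans ?_ (hkey X hX)
    conv_lhs => rw [← Real.rpow_one X]
    exact rpow_le_of_le' hX (by linarith)
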